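/- (Boundedness of bounded operators on unconditional norms.) Let 0<p₁,p₂<∞. There is a constant C = C(p₁,p₂) such that for all n, m, every linear map u : M_n(ℂ) → M_m(ℂ), and every K ≥ 0 with ‖u(y)‖_{p₂} ≤ K‖y‖_{p₁} for all y ∈ M_n(ℂ), one has |||(u(x_1),…,u(x_N))|||_{p₂} ≤ C·K·|||(x_1,…,x_N)|||_{p₁} for every finite sequence x_1,…,x_N ∈ M_n(ℂ). -/

import Mathlib

open scoped BigOperators
open Matrix MeasureTheory
open scoped ComplexOrder

/-- `A^β` for a Hermitian (in practice positive semidefinite) matrix `A`, via the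
spectral functional calculus (with the conventions of `Real.rpow` on eigenvalues,
in particular `0 ^ β = 0` for `β ≠ 0`), extended by `0` to non-Hermitian matrices. -/
noncomputable def posPow {ι : Type*} [Fintype ι] [DecidableEq ι]
    (A : Matrix ι ι ℂ) (β : ℝ) : Matrix ι ι ℂ :=
  if hA : A.IsHermitian then hA.cfc (fun t => t ^ β) else 0

/-- Schatten `p`-(quasi)norm of a complex matrix: `(Tr((A*A)^(p/2)))^(1/p)`. -/
noncomputable def schattenNorm {ι : Type*} [Fintype ι] [DecidableEq ι]
    (p : ℝ) (A : Matrix ι ι ℂ) : ℝ :=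
  ((posPow (Aᴴ * A) (p / 2)).trace.re) ^ (1 / p)

/-- Operator norm of a matrix, acting on the Euclidean space. -/
noncomputable def opNorm {ι : Type*} [Fintype ι] [DecidableEq ι]
    (A : Matrix ι ι ℂ) : ℝ :=
  ‖Matrix.toEuclideanCLM (𝕜 := ℂ) A‖

/-- The quantity `|||x|||_p` for `0 < p ≤ 2`: the infimum of
`‖(∑ aₖ*aₖ)^(1/2)‖_p + ‖(∑ bₖbₖ*)^(1/2)‖_p` over decompositions `xₖ = aₖ + bₖ`. -/
noncomputable def tripleNorm {n N : ℕ} (p : ℝ)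
    (x : Fin N → Matrix (Fin n) (Fin n) ℂ) : ℝ :=
  sInf { r : ℝ | ∃ a b : Fin N → Matrix (Fin n) (Fin n) ℂ,
    (∀ k, x k = a k + b k) ∧
    r = schattenNorm p (posPow (∑ k, (a k)ᴴ * a k) (1/2))
        + schattenNorm p (posPow (∑ k, b k * (b k)ᴴ) (1/2)) }

/-- `E_ε ‖∑ ε_k x_k‖_p ^ p`, the average over a uniformly random choice of signs. -/
noncomputable def radAvg {n N : ℕ} (p : ℝ)
    (x : Fin N → Matrix (Fin n) (Fin n) ℂ) : ℝ :=
  (1 / 2 ^ N) * ∑ ε : Fin N → Bool,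
    (schattenNorm p (∑ k, (if ε k then (1 : ℂ) else -1) • x k)) ^ p

/-- The quantity `|||x|||_p` for all `0 < p < ∞`: the infimum form for `p ≤ 2`
and the maximum form for `p > 2`. -/
noncomputable def tripleNormFull {n N : ℕ} (p : ℝ)
    (x : Fin N → Matrix (Fin n) (Fin n) ℂ) : ℝ :=
  if p ≤ 2 then tripleNorm p x
  else max (schattenNorm p (posPow (∑ k, (x k)ᴴ * x k) (1/2)))
           (schattenNorm p (posPow (∑ k, x k * (x k)ᴴ) (1/2)))


namespace SchattenKhintchine

open scoped MatrixOrder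

set_option linter.unusedSectionVars false

variable {n : Type*} [Fintype n]

/-- The real part of the trace. -/
noncomputable def rtr (M : Matrix n n ℂ) : ℝ := M.trace.re

lemma rtr_zero : rtr (0 : Matrix n n ℂ) = 0 := by simp [rtr]

lemma rtr_add (M M' : Matrix n n ℂ) : rtr (M + M') = rtr M + rtr M' := by simp [rtr]

lemma rtr_sub (M M' : Matrix n n ℂ) : rtr (M - M') = rtr M - rtr M' := by simp [rtr]

lemma rtr_smul (c : ℝ) (M : Matrix n n ℂ) : rtr (c • M) = c * rtr M := by
  simp [rtr, Matrix.trace_smul]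

lemma rtr_sum {ι : Type*} (s : Finset ι) (M : ι → Matrix n n ℂ) :
    rtr (∑ i ∈ s, M i) = ∑ i ∈ s, rtr (M i) := by
  simp [rtr, Matrix.trace_sum]

lemma rtr_mul_comm (M M' : Matrix n n ℂ) : rtr (M * M') = rtr (M' * M) := by
  simp [rtr, Matrix.trace_mul_comm M M']

lemma rtr_conjTranspose (M : Matrix n n ℂ) : rtr Mᴴ = rtr M := by
  simp [rtr, Matrix.trace_conjTranspose]

lemma conj_mul_self_nonneg (M : Matrix n n ℂ) : 0 ≤ Mᴴ * M :=
  (posSemidef_conjTranspose_mul_self M).nonneg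

lemma self_mul_conj_nonneg (M : Matrix n n ℂ) : 0 ≤ M * Mᴴ :=
  (posSemidef_self_mul_conjTranspose M).nonneg

lemma rtr_nonneg {M : Matrix n n ℂ} (h : 0 ≤ M) : 0 ≤ rtr M :=
  (Complex.le_def.1 h.posSemidef.trace_nonneg).1

lemma rtr_mono {M M' : Matrix n n ℂ} (h : M ≤ M') : rtr M ≤ rtr M' := by
  have := rtr_nonneg (sub_nonneg.2 h)
  rw [rtr_sub] at this; linarith

lemma conj_mono {A B : Matrix n n ℂ} (h : A ≤ B) (T : Matrix n n ℂ) :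
    Tᴴ * A * T ≤ Tᴴ * B * T := by
  rw [Matrix.le_iff] at h ⊢
  have := h.conjTranspose_mul_mul_same T
  rwa [Matrix.mul_sub, Matrix.sub_mul] at this

lemma conj_mono' {A B : Matrix n n ℂ} (h : A ≤ B) (T : Matrix n n ℂ) :
    T * A * Tᴴ ≤ T * B * Tᴴ := by
  simpa using conj_mono h Tᴴ

variable [DecidableEq n]

lemma cfc_continuousOn (f : ℝ → ℝ) (A : Matrix n n ℂ) : ContinuousOn f (spectrum ℝ A) :=
  (Matrix.finite_real_spectrum (A := A)).continuousOn f

lemma cfc_mul_mat (f g : ℝ → ℝ) (A : Matrix n n ℂ) :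
    cfc f A * cfc g A = cfc (fun t => f t * g t) A :=
  (cfc_mul f g A (cfc_continuousOn f A) (cfc_continuousOn g A)).symm

lemma cfc_add_mat (f g : ℝ → ℝ) (A : Matrix n n ℂ) :
    cfc f A + cfc g A = cfc (fun t => f t + g t) A :=
  (cfc_add A f g (cfc_continuousOn f A) (cfc_continuousOn g A)).symm

lemma cfc_sum_mat {ι : Type*} (s : Finset ι) (f : ι → ℝ → ℝ) (A : Matrix n n ℂ) :
    ∑ i ∈ s, cfc (f i) A = cfc (fun t => ∑ i ∈ s, f i t) A := by
  have h := cfc_sum (a := A) f s (fun i _ => cfc_continuousOn (f i) A)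
  rw [← h]; congr 1; ext; simp

lemma cfc_smul_mat (c : ℝ) (f : ℝ → ℝ) (A : Matrix n n ℂ) :
    c • cfc f A = cfc (fun t => c * f t) A :=
  (cfc_const_mul c f A (cfc_continuousOn f A)).symm

lemma cfc_comp_mat (g f : ℝ → ℝ) {A : Matrix n n ℂ} (hA : IsSelfAdjoint A) :
    cfc g (cfc f A) = cfc (fun t => g (f t)) A :=
  (cfc_comp g f A hA (((Matrix.finite_real_spectrum (A := A)).image f).continuousOn g)
    (cfc_continuousOn f A)).symm

lemma cfc_isSelfAdjoint (f : ℝ → ℝ) (A : Matrix n n ℂ) : (cfc f A)ᴴ = cfc f A :=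
  cfc_predicate f A

lemma nonneg_isSelfAdjoint {A : Matrix n n ℂ} (hA : 0 ≤ A) : IsSelfAdjoint A :=
  hA.posSemidef.isHermitian

lemma spectrum_nonneg' {A : Matrix n n ℂ} (hA : 0 ≤ A) {t : ℝ} (ht : t ∈ spectrum ℝ A) : 0 ≤ t :=
  spectrum_nonneg_of_nonneg hA ht

lemma cfc_congr_nonneg {A : Matrix n n ℂ} (hA : 0 ≤ A) {f g : ℝ → ℝ}
    (h : ∀ t, 0 ≤ t → f t = g t) : cfc f A = cfc g A :=
  cfc_congr fun t ht => h t (spectrum_nonneg' hA ht)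

lemma cfc_nonneg_mat {A : Matrix n n ℂ} (hA : 0 ≤ A) {f : ℝ → ℝ}
    (h : ∀ t, 0 ≤ t → 0 ≤ f t) : 0 ≤ cfc f A :=
  cfc_nonneg fun t ht => h t (spectrum_nonneg' hA ht)

lemma cfc_mono_mat {A : Matrix n n ℂ} (hA : 0 ≤ A) {f g : ℝ → ℝ}
    (h : ∀ t, 0 ≤ t → f t ≤ g t) : cfc f A ≤ cfc g A :=
  cfc_mono (fun t ht => h t (spectrum_nonneg' hA ht)) (cfc_continuousOn f A) (cfc_continuousOn g A)

lemma cfc_eq_self {A : Matrix n n ℂ} (hA : IsSelfAdjoint A) : cfc (fun t : ℝ => t) A = A :=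
  cfc_id' ℝ A

lemma cfc_mul_self_mat (f : ℝ → ℝ) {A : Matrix n n ℂ} (hA : IsSelfAdjoint A) :
    cfc f A * A = cfc (fun t => f t * t) A := by
  rw [← cfc_mul_mat, cfc_eq_self hA]

lemma self_mul_cfc_mat (f : ℝ → ℝ) {A : Matrix n n ℂ} (hA : IsSelfAdjoint A) :
    A * cfc f A = cfc (fun t => t * f t) A := by
  rw [← cfc_mul_mat, cfc_eq_self hA]

lemma cfc_eq_one {A : Matrix n n ℂ} (hA : IsSelfAdjoint A) : cfc (fun _ : ℝ => (1 : ℝ)) A = 1 :=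
  cfc_one ℝ A

/-- The trace of the product of a function of `A` and a function of `B` is a doubly stochastic
average over pairs of eigenvalues. -/
lemma exists_weights {A B : Matrix n n ℂ} (hA : A.IsHermitian) (hB : B.IsHermitian) :
    ∃ w : n → n → ℝ, (∀ i j, 0 ≤ w i j) ∧ (∀ i, ∑ j, w i j = 1) ∧ (∀ j, ∑ i, w i j = 1) ∧
      ∀ f g : ℝ → ℝ, rtr (cfc f A * cfc g B) =
        ∑ i, ∑ j, w i j * (f (hA.eigenvalues i) * g (hB.eigenvalues j)) := by
  set U : Matrix n n ℂ := (hA.eigenvectorUnitary : Matrix n n ℂ) with hU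
  set V : Matrix n n ℂ := (hB.eigenvectorUnitary : Matrix n n ℂ) with hV
  have hU1 : U * star U = 1 := Unitary.mul_star_self_of_mem hA.eigenvectorUnitary.2
  have hV1 : V * star V = 1 := Unitary.mul_star_self_of_mem hB.eigenvectorUnitary.2
  have hU2 : star U * U = 1 := Unitary.star_mul_self_of_mem hA.eigenvectorUnitary.2
  have hV2 : star V * V = 1 := Unitary.star_mul_self_of_mem hB.eigenvectorUnitary.2
  set W : Matrix n n ℂ := star U * V with hW
  have hW1 : W * star W = 1 := by
    rw [hW, star_mul, star_star, mul_assoc, ← mul_assoc V, hV1, one_mul, hU2]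
  have hW2 : star W * W = 1 := by
    rw [hW, star_mul, star_star, mul_assoc, ← mul_assoc U, hU1, one_mul, hV2]
  refine ⟨fun i j => Complex.normSq (W i j), fun i j => Complex.normSq_nonneg _, fun i => ?_,
    fun j => ?_, fun f g => ?_⟩
  · have := congrFun (congrFun hW1 i) i
    rw [Matrix.mul_apply] at this
    simp only [Matrix.star_apply, RCLike.star_def, Complex.mul_conj, Matrix.one_apply_eq] at this
    exact_mod_cast this
  · have := congrFun (congrFun hW2 j) j
    rw [Matrix.mul_apply] at this
    simp only [Matrix.star_apply, RCLike.star_def, mul_comm, Complex.mul_conj,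
      Matrix.one_apply_eq] at this
    exact_mod_cast this
  · rw [hA.cfc_eq, hB.cfc_eq, Matrix.IsHermitian.cfc, Matrix.IsHermitian.cfc,
      Unitary.conjStarAlgAut_apply, Unitary.conjStarAlgAut_apply]
    change rtr (U * diagonal _ * star U * (V * diagonal _ * star V)) = _
    have : U * diagonal (RCLike.ofReal ∘ f ∘ hA.eigenvalues : n → ℂ) * star U *
        (V * diagonal (RCLike.ofReal ∘ g ∘ hB.eigenvalues : n → ℂ) * star V) =
        U * (diagonal (RCLike.ofReal ∘ f ∘ hA.eigenvalues : n → ℂ) * W *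
          diagonal (RCLike.ofReal ∘ g ∘ hB.eigenvalues : n → ℂ) * star V) := by
      simp only [hW, mul_assoc]
    rw [this, rtr_mul_comm, mul_assoc, show star V * U = star W by simp [hW]]
    simp only [rtr, Matrix.trace, Matrix.diag_apply, Matrix.mul_apply (M := _ * diagonal _),
      Matrix.mul_diagonal, Matrix.diagonal_mul, Complex.re_sum]
    refine Finset.sum_congr rfl fun i _ => Finset.sum_congr rfl fun j _ => ?_
    simp only [Function.comp, Matrix.star_apply, RCLike.star_def]
    rw [Complex.normSq_apply]
    simp
    ring

lemma rtr_cfc {A : Matrix n n ℂ} (hA : A.IsHermitian) (f : ℝ → ℝ) :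
    rtr (cfc f A) = ∑ i, f (hA.eigenvalues i) := by
  rw [hA.cfc_eq, Matrix.IsHermitian.cfc, Unitary.conjStarAlgAut_apply]
  rw [rtr_mul_comm, ← mul_assoc, Unitary.star_mul_self_of_mem hA.eigenvectorUnitary.2, one_mul]
  simp [rtr, Matrix.trace]

/-- A general form of Klein's inequality. -/
lemma klein_spectrum {κ : Type*} [Fintype κ] {A B : Matrix n n ℂ} (hA : A.IsHermitian)
    (hB : B.IsHermitian) (f g : κ → ℝ → ℝ)
    (h : ∀ a ∈ spectrum ℝ A, ∀ b ∈ spectrum ℝ B, 0 ≤ ∑ k, f k a * g k b) :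
    0 ≤ ∑ k, rtr (cfc (f k) A * cfc (g k) B) := by
  obtain ⟨w, hw, -, -, hfg⟩ := exists_weights hA hB
  simp only [hfg]
  rw [Finset.sum_comm]
  refine Finset.sum_nonneg fun i _ => ?_
  rw [Finset.sum_comm]
  refine Finset.sum_nonneg fun j _ => ?_
  rw [← Finset.mul_sum]
  exact mul_nonneg (hw i j) (h _ (hA.eigenvalues_mem_spectrum_real i) _
    (hB.eigenvalues_mem_spectrum_real j))

lemma klein {κ : Type*} [Fintype κ] {A B : Matrix n n ℂ} (hA : 0 ≤ A) (hB : 0 ≤ B)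
    (f g : κ → ℝ → ℝ) (h : ∀ a b, 0 ≤ a → 0 ≤ b → 0 ≤ ∑ k, f k a * g k b) :
    0 ≤ ∑ k, rtr (cfc (f k) A * cfc (g k) B) :=
  klein_spectrum hA.posSemidef.1 hB.posSemidef.1 f g fun a ha b hb =>
    h a b (spectrum_nonneg' hA ha) (spectrum_nonneg' hB hb)

lemma rtr_mul_nonneg {A B : Matrix n n ℂ} (hA : 0 ≤ A) (hB : 0 ≤ B) : 0 ≤ rtr (A * B) := by
  have := klein hA hB (fun _ : Unit => fun t => t) (fun _ => fun t => t)
    (by intro a b ha hb; simpa using mul_nonneg ha hb)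
  simpa [cfc_eq_self (nonneg_isSelfAdjoint hA), cfc_eq_self (nonneg_isSelfAdjoint hB)] using this

lemma rtr_mul_mono_right {A B B' : Matrix n n ℂ} (hA : 0 ≤ A) (hB : B ≤ B') :
    rtr (A * B) ≤ rtr (A * B') := by
  have := rtr_mul_nonneg hA (sub_nonneg.2 hB)
  rw [mul_sub, rtr_sub] at this; linarith

lemma rtr_mul_mono_left {A B B' : Matrix n n ℂ} (hA : 0 ≤ A) (hB : B ≤ B') :
    rtr (B * A) ≤ rtr (B' * A) := by
  rw [rtr_mul_comm B, rtr_mul_comm B']; exact rtr_mul_mono_right hA hB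

/-- `Tr A^s`. -/
noncomputable def trPow (s : ℝ) (A : Matrix n n ℂ) : ℝ := rtr (cfc (fun t : ℝ => t ^ s) A)

lemma trPow_eq {A : Matrix n n ℂ} (hA : A.IsHermitian) (s : ℝ) :
    trPow s A = ∑ i, hA.eigenvalues i ^ s := rtr_cfc hA _

lemma trPow_nonneg {A : Matrix n n ℂ} (hA : 0 ≤ A) (s : ℝ) : 0 ≤ trPow s A :=
  rtr_nonneg (cfc_nonneg_mat hA fun _ ht => Real.rpow_nonneg ht s)

lemma trPow_one {A : Matrix n n ℂ} (hA : IsSelfAdjoint A) : trPow 1 A = rtr A := by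
  simp only [trPow, Real.rpow_one, cfc_eq_self hA]

lemma rtr_cfc_conj (f : ℝ → ℝ) (M : Matrix n n ℂ) : rtr (cfc f (Mᴴ * M)) = rtr (cfc f (M * Mᴴ)) := by
  have h1 := (posSemidef_conjTranspose_mul_self M).1
  have h2 := (posSemidef_self_mul_conjTranspose M).1
  rw [rtr_cfc h1, rtr_cfc h2]
  have h3 := h1.roots_charpoly_eq_eigenvalues
  have h4 := h2.roots_charpoly_eq_eigenvalues
  rw [Matrix.charpoly_mul_comm, h4] at h3
  have h5 := congrArg (fun s : Multiset ℂ => (s.map (fun z => f z.re)).sum) h3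
  simpa using h5.symm

lemma trPow_conj (s : ℝ) (M : Matrix n n ℂ) : trPow s (Mᴴ * M) = trPow s (M * Mᴴ) :=
  rtr_cfc_conj _ M

/-- Young's inequality with a small constant in front of one of the terms. -/
lemma exists_young {θ : ℝ} (h0 : 0 < θ) (h1 : θ < 1) {δ : ℝ} (hδ : 0 < δ) :
    ∃ C : ℝ, 0 < C ∧ ∀ u v : ℝ, 0 ≤ u → 0 ≤ v → u ^ θ * v ^ (1 - θ) ≤ δ * v + C * u := by
  have h1' : 0 < 1 - θ := by linarith
  set t : ℝ := δ ^ (-((1 - θ) / θ)) with ht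
  have htpos : 0 < t := Real.rpow_pos_of_pos hδ _
  refine ⟨t, htpos, fun u v hu hv => ?_⟩
  have key := Real.geom_mean_le_arith_mean2_weighted h0.le h1'.le (mul_nonneg hu htpos.le)
    (mul_nonneg hv hδ.le) (by ring)
  rw [Real.mul_rpow hu htpos.le, Real.mul_rpow hv hδ.le, ht, ← Real.rpow_mul hδ.le] at key
  have e : δ ^ (-((1 - θ) / θ) * θ) * δ ^ (1 - θ) = 1 := by
    rw [← Real.rpow_add hδ]
    have : -((1 - θ) / θ) * θ + (1 - θ) = 0 := by field_simp; ring
    rw [this, Real.rpow_zero]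
  have : u ^ θ * v ^ (1 - θ) ≤ θ * (u * t) + (1 - θ) * (v * δ) := by
    calc u ^ θ * v ^ (1 - θ)
        = u ^ θ * v ^ (1 - θ) * (δ ^ (-((1 - θ) / θ) * θ) * δ ^ (1 - θ)) := by rw [e, mul_one]
      _ = u ^ θ * δ ^ (-((1 - θ) / θ) * θ) * (v ^ (1 - θ) * δ ^ (1 - θ)) := by ring
      _ ≤ _ := key
  nlinarith [mul_nonneg hu htpos.le, mul_nonneg hv hδ.le]

lemma rpow_sub_one_mul_self {s : ℝ} (hs : s ≠ 0) {t : ℝ} (ht : 0 ≤ t) :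
    t ^ (s - 1) * t = t ^ s := by
  rcases ht.eq_or_lt with rfl | ht
  · simp [Real.zero_rpow hs]
  · nth_rewrite 2 [← Real.rpow_one t]
    rw [← Real.rpow_add ht]; ring_nf

lemma rtr_cfc_rpow_mul_self {s : ℝ} (hs : s ≠ 0) {A : Matrix n n ℂ} (hA : 0 ≤ A) :
    rtr (cfc (fun t : ℝ => t ^ (s - 1)) A * A) = trPow s A := by
  nth_rewrite 2 [← cfc_eq_self (nonneg_isSelfAdjoint hA)]
  rw [cfc_mul_mat, trPow]
  congr 1
  exact cfc_congr_nonneg hA fun t ht => rpow_sub_one_mul_self hs ht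

lemma rpow_le_tangent {s : ℝ} (h0 : 0 < s) (h1 : s < 1) {a z : ℝ} (ha : 0 < a) (hz : 0 ≤ z) :
    z ^ s ≤ s * (a ^ (s - 1) * z) + (1 - s) * a ^ s := by
  have key := Real.geom_mean_le_arith_mean2_weighted h0.le (by linarith : 0 ≤ 1 - s)
    (mul_nonneg (Real.rpow_nonneg ha.le (s - 1)) hz) (Real.rpow_nonneg ha.le s) (by ring)
  refine le_of_eq_of_le ?_ key
  rw [Real.mul_rpow (Real.rpow_nonneg ha.le _) hz, ← Real.rpow_mul ha.le, ← Real.rpow_mul ha.le,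
    mul_right_comm, ← Real.rpow_add ha]
  ring_nf; simp

/-- A tangent bound for the concave power `s`. -/
lemma trPow_le_tangent {s : ℝ} (h0 : 0 < s) (h1 : s < 1) {A Z : Matrix n n ℂ} (hA : 0 ≤ A)
    (hZ : 0 ≤ Z) {c : ℝ} (hZA : Z ≤ c • A) :
    trPow s Z ≤ s * rtr (cfc (fun t : ℝ => t ^ (s - 1)) A * Z) + (1 - s) * trPow s A := by
  obtain ⟨w, hw, hw1, hw2, hfg⟩ := exists_weights hA.posSemidef.1 hZ.posSemidef.1
  set a := hA.posSemidef.1.eigenvalues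
  set z := hZ.posSemidef.1.eigenvalues
  have ha : ∀ i, 0 ≤ a i := hA.posSemidef.eigenvalues_nonneg
  have hz : ∀ i, 0 ≤ z i := hZ.posSemidef.eigenvalues_nonneg
  have hAs := nonneg_isSelfAdjoint hA
  have hZs := nonneg_isSelfAdjoint hZ
  set P := cfc (fun t : ℝ => if t = 0 then (1 : ℝ) else 0) A with hP
  have hP0 : 0 ≤ P := cfc_nonneg_mat hA fun t _ => by split_ifs <;> norm_num
  have hPA : P * A = 0 := by
    have : P * cfc (fun t : ℝ => t) A = 0 := by
      rw [hP, cfc_mul_mat, cfc_congr_nonneg hA (g := fun _ => 0) (fun t _ => by simp),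
        cfc_const_zero]
    rwa [cfc_eq_self hAs] at this
  have hPZ : rtr (P * Z) ≤ 0 := by
    refine (rtr_mul_mono_right hP0 hZA).trans ?_
    rw [Matrix.mul_smul, hPA, smul_zero, rtr_zero]
  have hPZ' : ∀ i j, a i = 0 → w i j * z j = 0 := by
    have h1 : rtr (P * Z) = ∑ i, ∑ j, w i j * ((if a i = 0 then 1 else 0) * z j) := by
      rw [← hfg (fun t : ℝ => if t = 0 then (1 : ℝ) else 0) (fun t => t), cfc_eq_self hZs]
    have hnn : ∀ i j, 0 ≤ w i j * ((if a i = 0 then 1 else 0) * z j) := fun i j =>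
      mul_nonneg (hw i j) (mul_nonneg (by split_ifs <;> norm_num) (hz j))
    rw [h1] at hPZ
    have h2 := le_antisymm hPZ (Finset.sum_nonneg fun i _ => Finset.sum_nonneg fun j _ => hnn i j)
    intro i j hi
    have h3 := (Finset.sum_eq_zero_iff_of_nonneg
      (fun i _ => Finset.sum_nonneg fun j _ => hnn i j)).1 h2 i (Finset.mem_univ _)
    have h4 := (Finset.sum_eq_zero_iff_of_nonneg (fun j _ => hnn i j)).1 h3 j (Finset.mem_univ _)
    simpa [hi] using h4
  have e1 : trPow s Z = ∑ i, ∑ j, w i j * z j ^ s := by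
    have := hfg (fun _ => 1) (fun t => t ^ s)
    rw [cfc_eq_one hAs, one_mul] at this
    simpa [trPow] using this
  have e2 : trPow s A = ∑ i, ∑ j, w i j * a i ^ s := by
    have := hfg (fun t => t ^ s) (fun _ => 1)
    rw [cfc_eq_one hZs, mul_one] at this
    simpa [trPow] using this
  have e3 : rtr (cfc (fun t : ℝ => t ^ (s - 1)) A * Z) = ∑ i, ∑ j, w i j * (a i ^ (s - 1) * z j) := by
    rw [← hfg (fun t : ℝ => t ^ (s - 1)) (fun t => t), cfc_eq_self hZs]
  rw [e1, e2, e3, Finset.mul_sum, Finset.mul_sum, ← Finset.sum_add_distrib]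
  refine Finset.sum_le_sum fun i _ => ?_
  rw [Finset.mul_sum, Finset.mul_sum, ← Finset.sum_add_distrib]
  refine Finset.sum_le_sum fun j _ => ?_
  rcases (ha i).eq_or_lt with hi | hi
  · have h5 := hPZ' i j hi.symm
    rcases mul_eq_zero.1 h5 with h | h
    · simp [h]
    · rw [h, ← hi, Real.zero_rpow h0.ne']; simp
  · have := mul_le_mul_of_nonneg_left (rpow_le_tangent h0 h1 hi (hz j)) (hw i j)
    linarith

/-- Young's inequality for traces of powers. -/
lemma rtr_cfc_rpow_mul_le {σ : ℝ} (h1 : 1 < σ) {δ C : ℝ}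
    (hC : ∀ u v : ℝ, 0 ≤ u → 0 ≤ v → u ^ (1 / σ) * v ^ (1 - 1 / σ) ≤ δ * v + C * u)
    {A Z : Matrix n n ℂ} (hA : 0 ≤ A) (hZ : 0 ≤ Z) :
    rtr (cfc (fun t : ℝ => t ^ (σ - 1)) A * Z) ≤ δ * trPow σ A + C * trPow σ Z := by
  have hAs := nonneg_isSelfAdjoint hA
  have hZs := nonneg_isSelfAdjoint hZ
  have h0 : 0 < σ := by linarith
  have := klein hA hZ ![fun t => δ * t ^ σ, fun _ => 1, fun t => -1 * t ^ (σ - 1)]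
    ![fun _ => 1, fun t => C * t ^ σ, fun t => t] (by
      intro a b ha hb
      have := hC (b ^ σ) (a ^ σ) (Real.rpow_nonneg hb _) (Real.rpow_nonneg ha _)
      rw [← Real.rpow_mul hb, ← Real.rpow_mul ha, mul_one_div_cancel h0.ne', Real.rpow_one,
        mul_sub, mul_one_div_cancel h0.ne', mul_one] at this
      simp [Fin.sum_univ_three]
      linarith)
  simp only [Fin.sum_univ_three, Matrix.cons_val_zero, Matrix.cons_val_one, Matrix.cons_val,
    cfc_eq_self hZs, cfc_eq_one hAs, cfc_eq_one hZs, mul_one, one_mul] at this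
  rw [← cfc_smul_mat, ← cfc_smul_mat, ← cfc_smul_mat, Matrix.smul_mul] at this
  simp only [rtr_smul] at this
  simp only [trPow]; linarith

lemma young_conj {σ : ℝ} (h1 : 1 < σ) {u v : ℝ} (hu : 0 ≤ u) (hv : 0 ≤ v) :
    u ^ (1 / σ) * v ^ (1 - 1 / σ) ≤ (1 - 1 / σ) * v + (1 / σ) * u := by
  have h0 : 0 < σ := by linarith
  have hle : 1 / σ ≤ 1 := by rw [div_le_one h0]; exact h1.le
  have := Real.geom_mean_le_arith_mean2_weighted (by positivity : 0 ≤ 1 / σ)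
    (by linarith : 0 ≤ 1 - 1 / σ) hu hv (by ring)
  linarith

lemma trPow_mono {s : ℝ} (h0 : 0 < s) {A Z : Matrix n n ℂ} (hZ : 0 ≤ Z) (hZA : Z ≤ A) :
    trPow s Z ≤ trPow s A := by
  have hA : 0 ≤ A := hZ.trans hZA
  rcases lt_trichotomy s 1 with h | rfl | h
  · have h1 := trPow_le_tangent h0 h hA hZ (c := 1) (by simpa using hZA)
    have h2 := rtr_mul_mono_right (cfc_nonneg_mat hA fun t ht => Real.rpow_nonneg ht (s - 1)) hZA
    rw [rtr_cfc_rpow_mul_self h0.ne' hA] at h2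
    nlinarith
  · rw [trPow_one (nonneg_isSelfAdjoint hA), trPow_one (nonneg_isSelfAdjoint hZ)]
    exact rtr_mono hZA
  · have h1 := rtr_cfc_rpow_mul_le h (fun u v hu hv => young_conj h hu hv) hZ hA
    have h2 := rtr_mul_mono_right (cfc_nonneg_mat hZ fun t ht => Real.rpow_nonneg ht (s - 1)) hZA
    rw [rtr_cfc_rpow_mul_self h0.ne' hZ] at h2
    have h3 : 0 < 1 / s := by positivity
    have h4 : (1 / s) * trPow s Z ≤ (1 / s) * trPow s A := by nlinarith
    exact le_of_mul_le_mul_left h4 h3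

lemma trPow_smul {s : ℝ} {c : ℝ} (hc : 0 ≤ c) {A : Matrix n n ℂ} (hA : 0 ≤ A) :
    trPow s (c • A) = c ^ s * trPow s A := by
  have hAs := nonneg_isSelfAdjoint hA
  nth_rewrite 1 [← cfc_eq_self hAs]
  rw [cfc_smul_mat, trPow, cfc_comp_mat _ _ hAs, trPow, ← rtr_smul, cfc_smul_mat]
  congr 1
  exact cfc_congr_nonneg hA fun t ht => Real.mul_rpow hc ht

lemma trPow_zero_mat {s : ℝ} (hs : s ≠ 0) : trPow s (0 : Matrix n n ℂ) = 0 := by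
  have := trPow_smul (s := s) le_rfl (le_refl (0 : Matrix n n ℂ))
  simpa [Real.zero_rpow hs] using this

/-- Jensen's inequality for the concave power `s`. -/
lemma sum_trPow_le {Ω : Type*} [Fintype Ω] [Nonempty Ω] {s : ℝ} (h0 : 0 < s) (h1 : s ≤ 1)
    (Z : Ω → Matrix n n ℂ) (hZ : ∀ ω, 0 ≤ Z ω) (A : Matrix n n ℂ)
    (hA : (Fintype.card Ω : ℝ) • A = ∑ ω, Z ω) :
    ∑ ω, trPow s (Z ω) ≤ Fintype.card Ω * trPow s A := by
  have hsum : 0 ≤ ∑ ω, Z ω := Finset.sum_nonneg fun ω _ => hZ ω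
  have hN : (0 : ℝ) < Fintype.card Ω := by exact_mod_cast Fintype.card_pos
  have hA' : A = (Fintype.card Ω : ℝ)⁻¹ • ∑ ω, Z ω := by
    rw [← hA, smul_smul, inv_mul_cancel₀ hN.ne', one_smul]
  have hA0 : 0 ≤ A := by
    rw [hA']
    exact (hsum.posSemidef.smul (by positivity : (0 : ℝ) ≤ (Fintype.card Ω : ℝ)⁻¹)).nonneg
  rcases h1.eq_or_lt with rfl | h1
  · simp only [trPow_one (nonneg_isSelfAdjoint (hZ _)), trPow_one (nonneg_isSelfAdjoint hA0)]
    rw [← rtr_sum, ← hA, rtr_smul]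
  · have h : ∀ ω, trPow s (Z ω) ≤
        s * rtr (cfc (fun t : ℝ => t ^ (s - 1)) A * Z ω) + (1 - s) * trPow s A := fun ω =>
      trPow_le_tangent h0 h1 hA0 (hZ ω) (c := Fintype.card Ω) (by
        rw [hA]; exact Finset.single_le_sum (fun ω _ => hZ ω) (Finset.mem_univ ω))
    refine (Finset.sum_le_sum fun ω _ => h ω).trans (le_of_eq ?_)
    rw [Finset.sum_add_distrib, ← Finset.mul_sum, ← rtr_sum, ← Matrix.mul_sum, ← hA, Matrix.mul_smul,
      rtr_smul, rtr_cfc_rpow_mul_self h0.ne' hA0]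
    simp
    ring

lemma smul_nonneg_mat {c : ℝ} (hc : 0 ≤ c) {A : Matrix n n ℂ} (hA : 0 ≤ A) : 0 ≤ c • A :=
  (hA.posSemidef.smul hc).nonneg

/-- Jensen's inequality for two matrices and a convex power, and subadditivity up to a constant. -/
lemma trPow_add_le_of_one_lt {s : ℝ} (h1 : 1 < s) {A B : Matrix n n ℂ} (hA : 0 ≤ A) (hB : 0 ≤ B) :
    trPow s (A + B) ≤ 2 ^ s * (trPow s A + trPow s B) := by
  have h0 : 0 < s := by linarith
  set D : Matrix n n ℂ := (1 / 2 : ℝ) • (A + B) with hD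
  have hAB := add_nonneg hA hB
  have hD0 : 0 ≤ D := smul_nonneg_mat (by norm_num) hAB
  have e : A + B = (2 : ℝ) • D := by rw [hD, smul_smul]; norm_num
  have hy := fun {Z : Matrix n n ℂ} (hZ : 0 ≤ Z) =>
    rtr_cfc_rpow_mul_le h1 (fun u v hu hv => young_conj h1 hu hv) hD0 hZ
  have h2 := hy hA
  have h3 := hy hB
  have h4 := rtr_cfc_rpow_mul_self h0.ne' hD0
  nth_rewrite 2 [hD] at h4
  rw [Matrix.mul_smul, rtr_smul, Matrix.mul_add, rtr_add] at h4
  have h5 : (1 / s) * trPow s D ≤ (1 / s) * ((trPow s A + trPow s B) / 2) := by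
    nlinarith
  have h6 := le_of_mul_le_mul_left h5 (by positivity)
  rw [e, trPow_smul (by norm_num) hD0]
  have := trPow_nonneg hA s
  have := trPow_nonneg hB s
  exact mul_le_mul_of_nonneg_left (by linarith) (by positivity)

section OperatorMonotone

open scoped Matrix.Norms.L2Operator

lemma cfc_rpow_neg_anti {θ : ℝ} (h0 : 0 < θ) (h1 : θ ≤ 1) {A B : Matrix n n ℂ}
    (hA : IsStrictlyPositive A) (hAB : A ≤ B) :
    cfc (fun t : ℝ => t ^ (-θ)) B ≤ cfc (fun t : ℝ => t ^ (-θ)) A := by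
  have hB : IsStrictlyPositive B :=
    (CStarAlgebra.isUnit_of_le A hAB).isStrictlyPositive (hA.nonneg.trans hAB)
  have h2 : A ^ θ ≤ B ^ θ := CFC.rpow_le_rpow ⟨h0.le, h1⟩ hAB
  have hAθ : IsStrictlyPositive (A ^ θ) := by
    exact IsStrictlyPositive.rpow A θ hA
  have h3 := CStarAlgebra.rpow_neg_one_le_rpow_neg_one h2 hAθ
  rw [CFC.rpow_rpow A θ (-1) h0.ne', CFC.rpow_rpow B θ (-1) h0.ne', mul_neg_one,
    CFC.rpow_eq_cfc_real hA.nonneg, CFC.rpow_eq_cfc_real hB.nonneg] at h3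
  exact h3

end OperatorMonotone

lemma isStrictlyPositive_add_smul_one {A : Matrix n n ℂ} (hA : 0 ≤ A) {δ : ℝ} (hδ : 0 < δ) :
    IsStrictlyPositive (A + δ • (1 : Matrix n n ℂ)) := by
  rw [Matrix.isStrictlyPositive_iff_posDef]
  exact PosDef.posSemidef_add hA.posSemidef (PosDef.one.smul hδ)

lemma sp_add {A B : Matrix n n ℂ} (hA : IsStrictlyPositive A) (hB : 0 ≤ B) :
    IsStrictlyPositive (A + B) := by
  rw [Matrix.isStrictlyPositive_iff_posDef] at *
  exact hA.add_posSemidef hB.posSemidef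

lemma sp_spectrum_pos {A : Matrix n n ℂ} (hA : IsStrictlyPositive A) {t : ℝ}
    (ht : t ∈ spectrum ℝ A) : 0 < t := hA.spectrum_pos ht

/-- The perturbation `A + δ` in the functional calculus. -/
lemma trPow_add_smul_one (s : ℝ) {A : Matrix n n ℂ} (hA : 0 ≤ A) (δ : ℝ) :
    trPow s (A + δ • (1 : Matrix n n ℂ)) = ∑ i, (hA.posSemidef.1.eigenvalues i + δ) ^ s := by
  have hAs := nonneg_isSelfAdjoint hA
  have : A + δ • (1 : Matrix n n ℂ) = cfc (fun t : ℝ => t + δ) A := by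
    rw [← cfc_add_mat (fun t => t) (fun _ => δ), cfc_eq_self hAs, cfc_const δ A hAs,
      Algebra.algebraMap_eq_smul_one]
  rw [this, trPow, cfc_comp_mat _ _ hAs, rtr_cfc hA.posSemidef.1]

open Filter Topology in
lemma tendsto_trPow_add {s : ℝ} (hs : 0 < s) {A : Matrix n n ℂ} (hA : 0 ≤ A) (c : ℝ) :
    Tendsto (fun δ : ℝ => trPow s (A + (c * δ) • (1 : Matrix n n ℂ))) (𝓝[>] 0) (𝓝 (trPow s A)) := by
  simp only [trPow_add_smul_one s hA]
  rw [trPow_eq hA.posSemidef.1]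
  refine Tendsto.mono_left ?_ nhdsWithin_le_nhds
  have : Continuous fun δ : ℝ => ∑ i, (hA.posSemidef.1.eigenvalues i + c * δ) ^ s :=
    continuous_finsetSum _ fun i _ => (by fun_prop : Continuous fun δ : ℝ =>
      hA.posSemidef.1.eigenvalues i + c * δ).rpow_const fun _ => Or.inr hs.le
  simpa using this.tendsto 0

/-- Subadditivity of `Tr A^s` for `s ≤ 1`. -/
lemma trPow_sum_le_of_pos {κ : Type*} [Fintype κ] {s : ℝ} (h0 : 0 < s) (h1 : s ≤ 1)
    (A : κ → Matrix n n ℂ) (hA : ∀ l, IsStrictlyPositive (A l)) :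
    trPow s (∑ l, A l) ≤ ∑ l, trPow s (A l) := by
  have hS : 0 ≤ ∑ l, A l := Finset.sum_nonneg fun l _ => (hA l).nonneg
  rw [← rtr_cfc_rpow_mul_self h0.ne' hS, Matrix.mul_sum, rtr_sum]
  refine Finset.sum_le_sum fun l _ => ?_
  rw [← rtr_cfc_rpow_mul_self h0.ne' (hA l).nonneg]
  refine rtr_mul_mono_left (hA l).nonneg ?_
  rcases h1.eq_or_lt with rfl | h1
  · simp only [sub_self, Real.rpow_zero]
    rw [cfc_eq_one (nonneg_isSelfAdjoint hS), cfc_eq_one (nonneg_isSelfAdjoint (hA l).nonneg)]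
  · have := cfc_rpow_neg_anti (θ := 1 - s) (by linarith) (by linarith) (hA l)
      (Finset.single_le_sum (fun l _ => (hA l).nonneg) (Finset.mem_univ l))
    simpa using this

lemma trPow_add_le {s : ℝ} (h0 : 0 < s) {A B : Matrix n n ℂ} (hA : 0 ≤ A) (hB : 0 ≤ B) :
    trPow s (A + B) ≤ 2 ^ s * (trPow s A + trPow s B) := by
  rcases lt_or_ge 1 s with h1 | h1
  · exact trPow_add_le_of_one_lt h1 hA hB
  · have key : trPow s (A + B) ≤ trPow s A + trPow s B := by
      refine le_of_tendsto_of_tendsto (tendsto_trPow_add h0 (add_nonneg hA hB) 2)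
        ((tendsto_trPow_add h0 hA 1).add (tendsto_trPow_add h0 hB 1)) ?_
      filter_upwards [self_mem_nhdsWithin] with δ hδ
      have := trPow_sum_le_of_pos h0 h1 ![A + δ • (1 : Matrix n n ℂ), B + δ • (1 : Matrix n n ℂ)]
        (by
          intro l
          fin_cases l
          · exact isStrictlyPositive_add_smul_one hA hδ
          · exact isStrictlyPositive_add_smul_one hB hδ)
      simp only [Fin.sum_univ_two, Matrix.cons_val_zero, Matrix.cons_val_one] at this
      rw [one_mul, two_mul, add_smul, add_add_add_comm]
      exact this
    have h2 : (1 : ℝ) ≤ 2 ^ s := Real.one_le_rpow (by norm_num) h0.le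
    have := trPow_nonneg hA s
    have := trPow_nonneg hB s
    nlinarith

/-- Joint convexity of `(b, h) ↦ bᴴ h⁻¹ b`, in trace form. -/
lemma rtr_inv_convex {κ : Type*} [Fintype κ] (h g b : κ → Matrix n n ℂ) (G : Matrix n n ℂ)
    (hh : ∀ l, 0 ≤ h l) (hg : ∀ l, (g l)ᴴ = g l) (hhg : ∀ l, h l * g l = 1)
    (hG : Gᴴ = G) (hhG : (∑ l, h l) * G = 1) :
    rtr (G * ((∑ l, b l) * (∑ l, b l)ᴴ)) ≤ ∑ l, rtr (g l * (b l * (b l)ᴴ)) := by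
  set B := ∑ l, b l with hB
  set v := G * B with hv
  have key : ∀ l, 2 * rtr ((b l)ᴴ * v) ≤ rtr (vᴴ * h l * v) + rtr (g l * (b l * (b l)ᴴ)) := by
    intro l
    have h1 := rtr_mono (conj_mono (hh l) (v - g l * b l))
    have h2 : (v - g l * b l)ᴴ * h l * (v - g l * b l) =
        vᴴ * h l * v - vᴴ * (h l * g l) * b l - (b l)ᴴ * (h l * g l)ᴴ * v
          + (b l)ᴴ * g l * (h l * g l) * b l := by
      simp only [conjTranspose_sub, conjTranspose_mul, hg, (hh l).posSemidef.1.eq]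
      noncomm_ring
    rw [mul_zero, zero_mul, rtr_zero, h2, hhg] at h1
    simp only [conjTranspose_one, mul_one, rtr_sub, rtr_add] at h1
    have h3 : rtr (vᴴ * b l) = rtr ((b l)ᴴ * v) := by
      rw [← rtr_conjTranspose]; simp
    have h4 : rtr ((b l)ᴴ * g l * b l) = rtr (g l * (b l * (b l)ᴴ)) := by
      rw [rtr_mul_comm, ← mul_assoc, rtr_mul_comm]
    rw [h3, h4] at h1
    linarith
  have hs := Finset.sum_le_sum fun l (_ : l ∈ Finset.univ) => key l
  rw [← Finset.mul_sum, ← rtr_sum, ← Matrix.sum_mul, ← conjTranspose_sum, ← hB,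
    Finset.sum_add_distrib, ← rtr_sum, ← Matrix.sum_mul, ← Matrix.mul_sum] at hs
  have e1 : vᴴ * (∑ l, h l) * v = Bᴴ * v := by
    rw [hv, mul_assoc, ← mul_assoc _ G, hhG, one_mul, conjTranspose_mul, hG, mul_assoc]
  have e2 : rtr (Bᴴ * v) = rtr (G * (B * Bᴴ)) := by
    rw [hv, rtr_mul_comm, mul_assoc]
  rw [e1, e2] at hs
  linarith

lemma cfc_congr_pos {A : Matrix n n ℂ} (hA : IsStrictlyPositive A) {f g : ℝ → ℝ}
    (h : ∀ t, 0 < t → f t = g t) : cfc f A = cfc g A :=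
  cfc_congr fun t ht => h t (sp_spectrum_pos hA ht)

lemma cfc_mul_cfc_eq_one {A : Matrix n n ℂ} (hA : IsStrictlyPositive A) {f g : ℝ → ℝ}
    (h : ∀ t, 0 < t → f t * g t = 1) : cfc f A * cfc g A = 1 := by
  rw [cfc_mul_mat, cfc_congr_pos hA (g := fun _ => 1) h, cfc_eq_one hA.isSelfAdjoint]

lemma cfc_sp {A : Matrix n n ℂ} (hA : IsStrictlyPositive A) {f : ℝ → ℝ}
    (h : ∀ t, 0 < t → 0 < f t) : IsStrictlyPositive (cfc f A) := by
  have h1 : 0 ≤ cfc f A := cfc_nonneg fun t ht => (h t (sp_spectrum_pos hA ht)).le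
  refine IsUnit.isStrictlyPositive ?_ h1
  exact IsUnit.of_mul_eq_one _ (cfc_mul_cfc_eq_one hA fun t ht => mul_inv_cancel₀ (h t ht).ne')

lemma trPow_cfc_rpow {A : Matrix n n ℂ} (hA : 0 ≤ A) (r s : ℝ) :
    trPow s (cfc (fun t : ℝ => t ^ r) A) = trPow (r * s) A := by
  rw [trPow, cfc_comp_mat _ _ (nonneg_isSelfAdjoint hA), trPow]
  congr 1
  exact cfc_congr_nonneg hA fun t ht => (Real.rpow_mul ht r s).symm

/-- A variational upper bound for `Tr β^s`. -/
lemma trPow_le_inv {s : ℝ} (h0 : 0 < s) (h1 : s < 1) {h β : Matrix n n ℂ}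
    (hh : IsStrictlyPositive h) (hβ : 0 ≤ β) :
    trPow s β ≤ s * rtr (cfc (fun t : ℝ => t⁻¹) h * β) + (1 - s) * trPow (s / (1 - s)) h := by
  have h1' : 0 < 1 - s := by linarith
  have := klein_spectrum hh.nonneg.posSemidef.1 hβ.posSemidef.1
    ![fun t => s * t⁻¹, fun t => (1 - s) * t ^ (s / (1 - s)), fun _ => -1]
    ![fun t => t, fun _ => 1, fun t => t ^ s] (by
      intro a ha b hb
      have ha := sp_spectrum_pos hh ha
      have hb := spectrum_nonneg' hβ hb
      have key := Real.geom_mean_le_arith_mean2_weighted h0.le h1'.le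
        (mul_nonneg (inv_nonneg.2 ha.le) hb) (Real.rpow_nonneg ha.le (s / (1 - s))) (by ring)
      rw [Real.mul_rpow (inv_nonneg.2 ha.le) hb, ← Real.rpow_mul ha.le, div_mul_cancel₀ _ h1'.ne',
        Real.inv_rpow ha.le] at key
      have e : (a ^ s)⁻¹ * b ^ s * a ^ s = b ^ s := by
        have := (Real.rpow_pos_of_pos ha s).ne'
        field_simp
      rw [e] at key
      simp [Fin.sum_univ_three]
      linarith)
  simp only [Fin.sum_univ_three, Matrix.cons_val_zero, Matrix.cons_val_one, Matrix.cons_val,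
    cfc_eq_self (nonneg_isSelfAdjoint hβ), cfc_eq_one (nonneg_isSelfAdjoint hβ), mul_one] at this
  rw [← cfc_smul_mat, ← cfc_smul_mat, cfc_const (-1 : ℝ) h hh.isSelfAdjoint,
    Algebra.algebraMap_eq_smul_one, Matrix.smul_mul, Matrix.smul_mul, one_mul] at this
  simp only [rtr_smul] at this
  simp only [trPow]
  linarith

/-- The triangle inequality for `Tr (∑ bₖ bₖ*)^s`, `s ≤ 1 / 2`. -/
lemma trPow_sum_mul_conj_le {κ ι : Type*} [Fintype κ] [Nonempty κ] [Fintype ι] {s : ℝ}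
    (h0 : 0 < s) (h1 : s ≤ 1 / 2) (b : κ → ι → Matrix n n ℂ) :
    trPow s (∑ k, (∑ l, b l k) * (∑ l, b l k)ᴴ) ≤ ∑ l, trPow s (∑ k, b l k * (b l k)ᴴ) := by
  classical
  have h1' : 0 < 1 - s := by linarith
  set β : κ → Matrix n n ℂ := fun l => ∑ k, b l k * (b l k)ᴴ with hβdef
  have hβ : ∀ l, 0 ≤ β l := fun l => Finset.sum_nonneg fun k _ => self_mul_conj_nonneg _
  have hB : 0 ≤ ∑ k, (∑ l, b l k) * (∑ l, b l k)ᴴ :=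
    Finset.sum_nonneg fun k _ => self_mul_conj_nonneg _
  refine ge_of_tendsto (tendsto_finsetSum Finset.univ fun l _ =>
    tendsto_trPow_add h0 (hβ l) 1) ?_
  filter_upwards [self_mem_nhdsWithin] with δ hδ
  have hδ : 0 < 1 * δ := by simpa using hδ
  set α : κ → Matrix n n ℂ := fun l => β l + (1 * δ) • (1 : Matrix n n ℂ) with hα
  have hαp : ∀ l, IsStrictlyPositive (α l) := fun l => isStrictlyPositive_add_smul_one (hβ l) hδ
  have hβα : ∀ l, β l ≤ α l := fun l =>
    le_add_of_nonneg_right (smul_nonneg_mat hδ.le zero_le_one)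
  set h : κ → Matrix n n ℂ := fun l => cfc (fun t : ℝ => t ^ (1 - s)) (α l) with hh
  have hhp : ∀ l, IsStrictlyPositive (h l) := fun l =>
    cfc_sp (hαp l) fun t ht => Real.rpow_pos_of_pos ht _
  set g : κ → Matrix n n ℂ := fun l => cfc (fun t : ℝ => t ^ (s - 1)) (α l) with hg
  have hhg : ∀ l, h l * g l = 1 := fun l => cfc_mul_cfc_eq_one (hαp l) fun t ht => by
    rw [← Real.rpow_add ht]; simp
  set H := ∑ l, h l with hH
  have hHp : IsStrictlyPositive H := by
    obtain ⟨l0⟩ := ‹Nonempty κ›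
    rw [hH, ← Finset.add_sum_erase _ _ (Finset.mem_univ l0)]
    exact sp_add (hhp l0) (Finset.sum_nonneg fun l _ => (hhp l).nonneg)
  set G := cfc (fun t : ℝ => t⁻¹) H with hG
  have hHG : H * G = 1 := by
    nth_rewrite 1 [← cfc_eq_self hHp.isSelfAdjoint]
    exact cfc_mul_cfc_eq_one hHp fun t ht => mul_inv_cancel₀ ht.ne'
  refine (trPow_le_inv h0 (by linarith) hHp hB).trans ?_
  have e1 : rtr (G * ∑ k, (∑ l, b l k) * (∑ l, b l k)ᴴ) ≤ ∑ l, trPow s (α l) := by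
    rw [Matrix.mul_sum, rtr_sum]
    calc _ ≤ ∑ k, ∑ l, rtr (g l * (b l k * (b l k)ᴴ)) := Finset.sum_le_sum fun k _ =>
          rtr_inv_convex h g (fun l => b l k) G (fun l => (hhp l).nonneg)
            (fun l => cfc_isSelfAdjoint _ _) hhg (cfc_isSelfAdjoint _ _) hHG
      _ = ∑ l, rtr (g l * β l) := by
          rw [Finset.sum_comm]
          simp only [hβdef, Matrix.mul_sum, rtr_sum]
      _ ≤ _ := Finset.sum_le_sum fun l _ => by
          rw [← rtr_cfc_rpow_mul_self h0.ne' (hαp l).nonneg]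
          exact rtr_mul_mono_right
            (cfc_nonneg_mat (hαp l).nonneg fun t ht => Real.rpow_nonneg ht _) (hβα l)
  have e2 : trPow (s / (1 - s)) H ≤ ∑ l, trPow s (α l) := by
    refine (trPow_sum_le_of_pos (by positivity) ?_ h hhp).trans (le_of_eq ?_)
    · rw [div_le_one h1']; linarith
    · refine Finset.sum_congr rfl fun l _ => ?_
      rw [hh]
      simp only
      rw [trPow_cfc_rpow (hαp l).nonneg, mul_div_cancel₀ _ h1'.ne']
  nlinarith

/-- Traces of increasing concave functions are monotone. -/
lemma rtr_cfc_div_mono {τ : ℝ} (hτ : 0 < τ) {A Z : Matrix n n ℂ} (hZ : 0 ≤ Z) (hZA : Z ≤ A) :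
    rtr (cfc (fun t : ℝ => t / (t + τ)) Z) ≤ rtr (cfc (fun t : ℝ => t / (t + τ)) A) := by
  have hA : 0 ≤ A := hZ.trans hZA
  have hAs := nonneg_isSelfAdjoint hA
  have hZs := nonneg_isSelfAdjoint hZ
  have h1 := klein hA hZ
    ![fun t => t / (t + τ), fun t => τ / (t + τ) ^ 2, fun t => -(τ / (t + τ) ^ 2 * t), fun _ => 1]
    ![fun _ => 1, fun t => t, fun _ => 1, fun t => -1 * (t / (t + τ))] (by
      intro a b ha hb
      have ha' : 0 < a + τ := by linarith
      have hb' : 0 < b + τ := by linarith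
      simp [Fin.sum_univ_four]
      have : a / (a + τ) + τ / (a + τ) ^ 2 * b + -(τ / (a + τ) ^ 2 * a) + -(b / (b + τ)) =
          τ * (a - b) ^ 2 / ((a + τ) ^ 2 * (b + τ)) := by
        field_simp; ring
      have h5 : 0 ≤ τ * (a - b) ^ 2 / ((a + τ) ^ 2 * (b + τ)) := by positivity
      linarith)
  simp only [Fin.sum_univ_four, Matrix.cons_val_zero, Matrix.cons_val_one, Matrix.cons_val,
    cfc_eq_self hZs, cfc_eq_one hAs, cfc_eq_one hZs, mul_one, one_mul] at h1
  rw [← cfc_smul_mat (-1), rtr_smul] at h1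
  have h2 := rtr_mul_mono_right (cfc_nonneg_mat hA (f := fun t : ℝ => τ / (t + τ) ^ 2)
    fun t ht => by positivity) hZA
  have h3 : rtr (cfc (fun t : ℝ => τ / (t + τ) ^ 2) A * A) +
      rtr (cfc (fun t : ℝ => -(τ / (t + τ) ^ 2 * t)) A) = 0 := by
    nth_rewrite 2 [← cfc_eq_self hAs]
    rw [cfc_mul_mat, ← rtr_add, cfc_add_mat]
    simp [rtr_zero]
  linarith

variable {ι : Type*} [Fintype ι] [DecidableEq ι]


/-- The sign attached to a boolean. -/
def sgn (b : Bool) : ℝ := if b then 1 else -1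

lemma sgn_mul_self (b : Bool) : sgn b * sgn b = 1 := by cases b <;> simp [sgn]

lemma sgn_not (b : Bool) : sgn (!b) = -sgn b := by cases b <;> simp [sgn]

/-- The signed sum `∑ εₖ xₖ`. -/
noncomputable def rad (x : ι → Matrix n n ℂ) (ε : ι → Bool) : Matrix n n ℂ :=
  ∑ k, sgn (ε k) • x k

variable (ι) in
/-- The number of sign patterns. -/
noncomputable def numSigns : ℝ := Fintype.card (ι → Bool)

lemma numSigns_pos : 0 < numSigns ι := by
  unfold numSigns; exact_mod_cast Fintype.card_pos

/-- Changing one sign. -/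
def flipSign (k : ι) (ε : ι → Bool) : ι → Bool := Function.update ε k (!ε k)

lemma flipSign_involutive (k : ι) : Function.Involutive (flipSign k) := by
  intro ε; simp [flipSign]

lemma sum_flipSign {M : Type*} [AddCommMonoid M] (k : ι) (f : (ι → Bool) → M) :
    ∑ ε, f (flipSign k ε) = ∑ ε, f ε :=
  (Equiv.sum_comp (flipSign_involutive k).toPerm f)

lemma sum_sgn_mul_sgn (j k : ι) :
    ∑ ε : ι → Bool, sgn (ε j) * sgn (ε k) = if j = k then numSigns ι else 0 := by
  split_ifs with h
  · subst h; simp [sgn_mul_self, numSigns]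
  · have h1 := sum_flipSign k fun ε : ι → Bool => sgn (ε j) * sgn (ε k)
    have h2 : ∀ ε : ι → Bool, sgn (flipSign k ε j) * sgn (flipSign k ε k) =
        -(sgn (ε j) * sgn (ε k)) := by
      intro ε; simp [flipSign, Function.update_of_ne h, sgn_not]
    simp only [h2, Finset.sum_neg_distrib] at h1
    linarith

lemma sum_rad_mul_rad (x y : ι → Matrix n n ℂ) :
    ∑ ε, rad x ε * rad y ε = numSigns ι • ∑ k, x k * y k := by
  have h : ∀ ε, rad x ε * rad y ε = ∑ j, ∑ k, (sgn (ε j) * sgn (ε k)) • (x j * y k) := by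
    intro ε
    rw [rad, rad, Finset.sum_mul_sum]
    exact Finset.sum_congr rfl fun j _ => Finset.sum_congr rfl fun k _ =>
      smul_mul_smul_comm _ _ _ _
  simp only [h]
  rw [Finset.sum_comm, Finset.smul_sum]
  refine Finset.sum_congr rfl fun j _ => ?_
  rw [Finset.sum_comm]
  simp only [← Finset.sum_smul, sum_sgn_mul_sgn, ite_smul, zero_smul]
  simp

lemma rad_conjTranspose (x : ι → Matrix n n ℂ) (ε : ι → Bool) :
    (rad x ε)ᴴ = rad (fun k => (x k)ᴴ) ε := by
  simp [rad, conjTranspose_sum]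

lemma rad_mul (x : ι → Matrix n n ℂ) (M : Matrix n n ℂ) (ε : ι → Bool) :
    rad (fun k => x k * M) ε = rad x ε * M := by
  simp [rad, Matrix.sum_mul]

lemma mul_rad (x : ι → Matrix n n ℂ) (M : Matrix n n ℂ) (ε : ι → Bool) :
    rad (fun k => M * x k) ε = M * rad x ε := by
  simp [rad, Matrix.mul_sum]

lemma rad_add (x y : ι → Matrix n n ℂ) (ε : ι → Bool) :
    rad (fun k => x k + y k) ε = rad x ε + rad y ε := by
  simp [rad, Finset.sum_add_distrib]

lemma rad_smul (c : ℂ) (x : ι → Matrix n n ℂ) (ε : ι → Bool) :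
    rad (fun k => c • x k) ε = c • rad x ε := by
  simp only [rad, Finset.smul_sum]
  exact Finset.sum_congr rfl fun k _ => smul_comm _ _ _

lemma rad_flipSign (x : ι → Matrix n n ℂ) (k : ι) (ε : ι → Bool) :
    rad x (flipSign k ε) = rad x ε - (2 * sgn (ε k)) • x k := by
  rw [rad, rad, ← Finset.add_sum_erase _ _ (Finset.mem_univ k),
    ← Finset.add_sum_erase (a := k) _ (fun j => sgn (ε j) • x j) (Finset.mem_univ k)]
  have : ∑ j ∈ Finset.univ.erase k, sgn (flipSign k ε j) • x j =
      ∑ j ∈ Finset.univ.erase k, sgn (ε j) • x j := by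
    refine Finset.sum_congr rfl fun j hj => ?_
    simp [flipSign, Function.update_of_ne (Finset.ne_of_mem_erase hj)]
  rw [this]
  simp [flipSign, sgn_not, two_mul, add_smul]
  abel

/-- The squared Hilbert–Schmidt norm. -/
noncomputable def hs (V : Matrix n n ℂ) : ℝ := rtr (Vᴴ * V)

lemma hs_nonneg (V : Matrix n n ℂ) : 0 ≤ hs V := rtr_nonneg (conj_mul_self_nonneg V)

lemma hs_add_smul (S V : Matrix n n ℂ) (t : ℝ) :
    hs (S + t • V) = hs S + 2 * t * rtr (Sᴴ * V) + t ^ 2 * hs V := by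
  have h : rtr (Vᴴ * S) = rtr (Sᴴ * V) := by
    rw [← rtr_conjTranspose]; simp
  simp only [hs, conjTranspose_add, conjTranspose_smul, star_trivial, Matrix.add_mul,
    Matrix.mul_add, rtr_add, Matrix.smul_mul, Matrix.mul_smul, rtr_smul, h]
  ring

lemma rtr_sq_le (S V : Matrix n n ℂ) : rtr (Sᴴ * V) ^ 2 ≤ hs S * hs V := by
  have h : ∀ t : ℝ, 0 ≤ hs V * (t * t) + 2 * rtr (Sᴴ * V) * t + hs S := by
    intro t
    have := hs_nonneg (S + t • V)
    rw [hs_add_smul] at this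
    linarith
  have := discrim_le_zero h
  rw [discrim] at this
  nlinarith

lemma sum_hs_rad (v : ι → Matrix n n ℂ) : ∑ ε, hs (rad v ε) = numSigns ι * ∑ k, hs (v k) := by
  simp only [hs, rad_conjTranspose]
  rw [← rtr_sum, sum_rad_mul_rad, rtr_smul, rtr_sum]

lemma sum_hs_rad_sq_le (v : ι → Matrix n n ℂ) :
    ∑ ε, hs (rad v ε) ^ 2 ≤ 3 * numSigns ι * (∑ k, hs (v k)) ^ 2 := by
  classical
  have hN := numSigns_pos (ι := ι)
  suffices h : ∀ s : Finset ι, ∑ ε, hs (rad (fun k => if k ∈ s then v k else 0) ε) ^ 2 ≤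
      3 * numSigns ι * (∑ k ∈ s, hs (v k)) ^ 2 by simpa using h Finset.univ
  intro s
  induction s using Finset.induction_on with
  | empty => simp [rad, hs, rtr_zero]
  | insert j s hj ih =>
    set S : (ι → Bool) → Matrix n n ℂ := rad (fun k => if k ∈ s then v k else 0) with hS
    set T : (ι → Bool) → Matrix n n ℂ := rad (fun k => if k ∈ insert j s then v k else 0) with hT
    have hTS : ∀ ε, T ε = S ε + sgn (ε j) • v j := by
      intro ε
      simp only [hT, hS, rad]
      have : ∀ k, sgn (ε k) • (if k ∈ insert j s then v k else 0) =
          sgn (ε k) • (if k ∈ s then v k else 0) + if k = j then sgn (ε k) • v k else 0 := by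
        intro k
        by_cases hk : k = j
        · subst hk; simp [hj]
        · simp [hk]
      simp only [this, Finset.sum_add_distrib]
      simp
    have hSf : ∀ ε, S (flipSign j ε) = S ε := by
      intro ε; rw [hS, rad_flipSign]; simp [hj]
    have hTf : ∀ ε, T (flipSign j ε) = S ε + (-sgn (ε j)) • v j := by
      intro ε; rw [hTS, hSf]; simp [flipSign, sgn_not]
    set b := hs (v j)
    have hb : 0 ≤ b := hs_nonneg _
    set a := ∑ k ∈ s, hs (v k)
    have ha : 0 ≤ a := Finset.sum_nonneg fun k _ => hs_nonneg _
    have hpt : ∀ ε, hs (T ε) ^ 2 + hs (T (flipSign j ε)) ^ 2 ≤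
        2 * hs (S ε) ^ 2 + 12 * b * hs (S ε) + 2 * b ^ 2 := by
      intro ε
      rw [hTf, hTS, hs_add_smul, hs_add_smul]
      have h1 := rtr_sq_le (S ε) (v j)
      have h2 : sgn (ε j) ^ 2 = 1 := by rw [sq, sgn_mul_self]
      have h3 : (-sgn (ε j)) ^ 2 = 1 := by rw [neg_sq, h2]
      rw [h2, h3]
      have h4 : (hs (S ε) + 2 * sgn (ε j) * rtr ((S ε)ᴴ * v j) + 1 * hs (v j)) ^ 2 +
          (hs (S ε) + 2 * -sgn (ε j) * rtr ((S ε)ᴴ * v j) + 1 * hs (v j)) ^ 2 =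
          2 * (hs (S ε) + hs (v j)) ^ 2 + 8 * sgn (ε j) ^ 2 * rtr ((S ε)ᴴ * v j) ^ 2 := by ring
      rw [h4, h2]
      change _ ≤ hs (S ε) * b at h1
      change 2 * (hs (S ε) + b) ^ 2 + _ ≤ _
      nlinarith
    have hsum : ∑ ε, hs (S ε) = numSigns ι * a := by
      rw [hS, sum_hs_rad]
      congr 1
      simp only [apply_ite hs]
      simp [hs, rtr_zero, a]
    have h5 := Finset.sum_le_sum fun ε (_ : ε ∈ Finset.univ) => hpt ε
    simp only [Finset.sum_add_distrib, ← Finset.mul_sum] at h5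
    rw [sum_flipSign j fun ε => hs (T ε) ^ 2, hsum] at h5
    have h6 : ∑ _ε : ι → Bool, b ^ 2 = numSigns ι * b ^ 2 := by simp [numSigns]
    rw [h6] at h5
    rw [Finset.sum_insert hj]
    have h7 : (∑ ε, hs (T ε) ^ 2) ≤ 3 * numSigns ι * a ^ 2 + 6 * b * (numSigns ι * a) +
        numSigns ι * b ^ 2 := by linarith
    have h8 : 0 ≤ numSigns ι * b ^ 2 := by positivity
    change _ ≤ 3 * numSigns ι * (b + a) ^ 2
    nlinarith

/-- A weight on the sign patterns that keeps at least `11 / 12` of the mass. -/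
structure IsHeavy (χ : (ι → Bool) → ℝ) : Prop where
  nonneg : ∀ ε, 0 ≤ χ ε
  le_one : ∀ ε, χ ε ≤ 1
  mass : ∑ ε, (1 - χ ε) ≤ numSigns ι / 12

lemma IsHeavy.hs_le {χ : (ι → Bool) → ℝ} (hχ : IsHeavy χ) (v : ι → Matrix n n ℂ) :
    numSigns ι * ∑ k, hs (v k) ≤ 2 * ∑ ε, χ ε * hs (rad v ε) := by
  have hN := numSigns_pos (ι := ι)
  set a := ∑ k, hs (v k)
  have ha : 0 ≤ a := Finset.sum_nonneg fun k _ => hs_nonneg _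
  rcases ha.eq_or_lt with ha | ha
  · rw [← ha, mul_zero]
    exact mul_nonneg zero_le_two
      (Finset.sum_nonneg fun ε _ => mul_nonneg (hχ.nonneg ε) (hs_nonneg _))
  have h1 : ∀ ε, (1 - χ ε) * hs (rad v ε) ≤ 3 * a * (1 - χ ε) + 1 / (12 * a) * hs (rad v ε) ^ 2 := by
    intro ε
    set r := hs (rad v ε)
    have h2 : 0 ≤ 1 - χ ε := sub_nonneg.2 (hχ.le_one ε)
    have h3 : (1 - χ ε) ^ 2 ≤ 1 - χ ε := by nlinarith [hχ.nonneg ε]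
    have h4 : 0 ≤ 1 / (12 * a) * (6 * a * (1 - χ ε) - r) ^ 2 := by positivity
    have h5 : 1 / (12 * a) * (6 * a * (1 - χ ε) - r) ^ 2 =
        3 * a * (1 - χ ε) ^ 2 - (1 - χ ε) * r + 1 / (12 * a) * r ^ 2 := by
      field_simp; ring
    nlinarith
  have h2 := Finset.sum_le_sum fun ε (_ : ε ∈ Finset.univ) => h1 ε
  rw [Finset.sum_add_distrib, ← Finset.mul_sum, ← Finset.mul_sum] at h2
  have h3 : 1 / (12 * a) * ∑ ε, hs (rad v ε) ^ 2 ≤ 1 / (12 * a) * (3 * numSigns ι * a ^ 2) :=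
    mul_le_mul_of_nonneg_left (sum_hs_rad_sq_le v) (by positivity)
  have h4 : 1 / (12 * a) * (3 * numSigns ι * a ^ 2) = numSigns ι * a / 4 := by field_simp; ring
  have h5 : 3 * a * ∑ ε, (1 - χ ε) ≤ 3 * a * (numSigns ι / 12) :=
    mul_le_mul_of_nonneg_left hχ.mass (by positivity)
  have h6 := sum_hs_rad v
  simp only [sub_mul, one_mul, Finset.sum_sub_distrib] at h2 h5
  change _ = numSigns ι * a at h6
  linarith

lemma exists_sqrt {M : Matrix n n ℂ} (hM : 0 ≤ M) : ∃ S : Matrix n n ℂ, 0 ≤ S ∧ Sᴴ = S ∧ S * S = M := by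
  refine ⟨cfc Real.sqrt M, cfc_nonneg_mat hM fun t _ => Real.sqrt_nonneg t,
    cfc_isSelfAdjoint _ _, ?_⟩
  rw [cfc_mul_mat, cfc_congr_nonneg hM (g := fun t => t) fun t ht => Real.mul_self_sqrt ht,
    cfc_eq_self (nonneg_isSelfAdjoint hM)]

lemma IsHeavy.column_le {χ : (ι → Bool) → ℝ} (hχ : IsHeavy χ) (x : ι → Matrix n n ℂ)
    {M : Matrix n n ℂ} (hM : 0 ≤ M) :
    numSigns ι * rtr (M * ∑ k, (x k)ᴴ * x k) ≤
      2 * ∑ ε, χ ε * rtr (M * ((rad x ε)ᴴ * rad x ε)) := by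
  obtain ⟨S, -, hS, hSM⟩ := exists_sqrt hM
  have e : ∀ y : Matrix n n ℂ, hs (y * S) = rtr (M * (yᴴ * y)) := by
    intro y
    rw [hs, conjTranspose_mul, hS, ← hSM, mul_assoc, rtr_mul_comm, mul_assoc, mul_assoc,
      ← mul_assoc yᴴ, rtr_mul_comm]
  have := hχ.hs_le fun k => x k * S
  simp only [e, rad_mul] at this
  rwa [Matrix.mul_sum, rtr_sum]

lemma IsHeavy.row_le {χ : (ι → Bool) → ℝ} (hχ : IsHeavy χ) (x : ι → Matrix n n ℂ)
    {M : Matrix n n ℂ} (hM : 0 ≤ M) :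
    numSigns ι * rtr (M * ∑ k, x k * (x k)ᴴ) ≤
      2 * ∑ ε, χ ε * rtr (M * (rad x ε * (rad x ε)ᴴ)) := by
  have := hχ.column_le (fun k => (x k)ᴴ) hM
  simpa [← rad_conjTranspose] using this

lemma conj_add_mul_add_le (A B : Matrix n n ℂ) :
    (A + B)ᴴ * (A + B) ≤ (2 : ℝ) • (Aᴴ * A + Bᴴ * B) := by
  have h : (2 : ℝ) • (Aᴴ * A + Bᴴ * B) - (A + B)ᴴ * (A + B) = (A - B)ᴴ * (A - B) := by
    simp only [conjTranspose_add, conjTranspose_sub, two_smul]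
    noncomm_ring
  rw [← sub_nonneg, h]
  exact conj_mul_self_nonneg _

lemma trPow_conj_add_le {s : ℝ} (hs : 0 < s) (A B : Matrix n n ℂ) :
    trPow s ((A + B)ᴴ * (A + B)) ≤ 4 ^ s * (trPow s (Aᴴ * A) + trPow s (Bᴴ * B)) := by
  have h1 := trPow_mono hs (conj_mul_self_nonneg (A + B)) (conj_add_mul_add_le A B)
  rw [trPow_smul (by norm_num) (add_nonneg (conj_mul_self_nonneg A) (conj_mul_self_nonneg B))] at h1
  have h2 := trPow_add_le hs (conj_mul_self_nonneg A) (conj_mul_self_nonneg B)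
  have h3 : (4 : ℝ) ^ s = 2 ^ s * 2 ^ s := by
    rw [← Real.mul_rpow (by norm_num) (by norm_num)]; norm_num
  rw [h3, mul_assoc]
  exact h1.trans (mul_le_mul_of_nonneg_left h2 (by positivity))

lemma sum_trPow_rad_column_le {s : ℝ} (h0 : 0 < s) (h1 : s ≤ 1) (a : ι → Matrix n n ℂ) :
    ∑ ε, trPow s ((rad a ε)ᴴ * rad a ε) ≤ numSigns ι * trPow s (∑ k, (a k)ᴴ * a k) := by
  refine sum_trPow_le h0 h1 _ (fun ε => conj_mul_self_nonneg _) _ ?_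
  simp only [rad_conjTranspose]
  rw [sum_rad_mul_rad]; rfl

/-- The upper Khintchine inequality for small exponents. -/
lemma upper_khintchine_small {s : ℝ} (h0 : 0 < s) (h1 : s ≤ 1) (x a b : ι → Matrix n n ℂ)
    (hx : ∀ k, x k = a k + b k) :
    ∑ ε, trPow s ((rad x ε)ᴴ * rad x ε) ≤ 4 ^ s * numSigns ι *
      (trPow s (∑ k, (a k)ᴴ * a k) + trPow s (∑ k, b k * (b k)ᴴ)) := by
  have e : ∀ ε, rad x ε = rad a ε + rad b ε := fun ε => by
    rw [← rad_add]; congr 1; exact funext hx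
  have h2 := Finset.sum_le_sum fun ε (_ : ε ∈ Finset.univ) =>
    trPow_conj_add_le h0 (rad a ε) (rad b ε)
  simp only [← e] at h2
  rw [← Finset.mul_sum, Finset.sum_add_distrib] at h2
  have h3 := sum_trPow_rad_column_le h0 h1 a
  have h4 := sum_trPow_rad_column_le h0 h1 fun k => (b k)ᴴ
  simp only [← rad_conjTranspose, conjTranspose_conjTranspose, ← trPow_conj] at h4
  refine h2.trans ?_
  rw [mul_assoc]
  refine mul_le_mul_of_nonneg_left ?_ (by positivity)
  linarith

lemma signed_rpow_diff_le {r : ℝ} (hr : 0 < r) (a b : ℝ) :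
    (a - b) * (a * |a| ^ r - b * |b| ^ r) ≤ (1 + r) * ((|a| ^ r + |b| ^ r) * ((a - b) * (a - b))) := by
  wlog h : |b| ≤ |a| generalizing a b
  · have := this b a (le_of_not_ge h)
    linarith
  have hu := abs_nonneg b
  have hp : 0 ≤ |a| ^ r := Real.rpow_nonneg (abs_nonneg a) r
  have hq : 0 ≤ |b| ^ r := Real.rpow_nonneg hu r
  have key : |b| * (|a| ^ r - |b| ^ r) ≤ r * |a| ^ r * |a - b| := by
    rcases (abs_nonneg a).eq_or_lt with ha | ha
    · rw [← ha] at h hp ⊢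
      have : |b| = 0 := le_antisymm h hu
      rw [this]; rw [zero_mul]; positivity
    · have hb := one_add_mul_self_le_rpow_one_add (s := |b| / |a| - 1) (p := r + 1)
        (by have : 0 ≤ |b| / |a| := by positivity
            linarith) (by linarith)
      rw [add_sub_cancel, Real.div_rpow hu ha.le, Real.rpow_add ha, Real.rpow_one,
        Real.rpow_add_one' hu (by linarith)] at hb
      have hpa : 0 < |a| ^ r := Real.rpow_pos_of_pos ha r
      rw [le_div_iff₀ (by positivity)] at hb
      have e : (1 + (r + 1) * (|b| / |a| - 1)) * (|a| ^ r * |a|) =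
          |a| ^ r * |a| + (r + 1) * (|b| - |a|) * |a| ^ r := by field_simp
      rw [e] at hb
      have h1 : |b| * (|a| ^ r - |b| ^ r) ≤ r * |a| ^ r * (|a| - |b|) := by nlinarith
      refine h1.trans (mul_le_mul_of_nonneg_left (abs_sub_abs_le_abs_sub a b) (by positivity))
  have h2 : (a - b) * (b * (|a| ^ r - |b| ^ r)) ≤ r * |a| ^ r * ((a - b) * (a - b)) := by
    calc (a - b) * (b * (|a| ^ r - |b| ^ r)) ≤ |(a - b) * (b * (|a| ^ r - |b| ^ r))| := le_abs_self _
      _ = |a - b| * (|b| * (|a| ^ r - |b| ^ r)) := by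
          rw [abs_mul, abs_mul, abs_of_nonneg (a := |a| ^ r - |b| ^ r)]
          exact sub_nonneg.2 (Real.rpow_le_rpow hu h hr.le)
      _ ≤ |a - b| * (r * |a| ^ r * |a - b|) := mul_le_mul_of_nonneg_left key (abs_nonneg _)
      _ = r * |a| ^ r * (|a - b| * |a - b|) := by ring
      _ = _ := by rw [abs_mul_abs_self]
  have h3 : 0 ≤ |b| ^ r * ((a - b) * (a - b)) := mul_nonneg hq (mul_self_nonneg _)
  nlinarith

lemma rtr_cfc_mul_sub_sq {A B : Matrix n n ℂ} (hA : IsSelfAdjoint A) (hB : IsSelfAdjoint B)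
    {w : n → n → ℝ} {α β : n → ℝ}
    (h : ∀ f g : ℝ → ℝ, rtr (cfc f A * cfc g B) = ∑ i, ∑ j, w i j * (f (α i) * g (β j)))
    (f : ℝ → ℝ) :
    rtr (cfc f A * ((A - B) * (A - B))) =
      ∑ i, ∑ j, w i j * (f (α i) * ((α i - β j) * (α i - β j))) := by
  have h1 : rtr (cfc f A * (B * A)) = rtr (cfc f A * A * B) := by
    rw [← mul_assoc, rtr_mul_comm, ← mul_assoc, cfc_mul_self_mat f hA, self_mul_cfc_mat f hA]
    simp only [mul_comm]
  have h2 : rtr (cfc f A * ((A - B) * (A - B))) =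
      rtr (cfc (fun t => f t * t * t) A * cfc (fun _ => (1 : ℝ)) B) -
      2 * rtr (cfc (fun t => f t * t) A * cfc (fun t : ℝ => t) B) +
      rtr (cfc f A * cfc (fun t : ℝ => t * t) B) := by
    rw [cfc_eq_one hB, cfc_eq_self hB, mul_one, ← self_mul_cfc_mat (fun t => t) hB,
      cfc_eq_self hB, ← cfc_mul_self_mat (fun t => f t * t) hA, ← cfc_mul_self_mat f hA]
    simp only [mul_sub, sub_mul, rtr_sub] at *
    simp only [← mul_assoc] at *
    linarith
  rw [h2, h, h, h, Finset.mul_sum, ← Finset.sum_sub_distrib, ← Finset.sum_add_distrib]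
  refine Finset.sum_congr rfl fun i _ => ?_
  rw [Finset.mul_sum, ← Finset.sum_sub_distrib, ← Finset.sum_add_distrib]
  exact Finset.sum_congr rfl fun j _ => by ring

lemma rtr_signed_rpow_diff_le {r : ℝ} (hr : 0 < r) {A B : Matrix n n ℂ} (hA : A.IsHermitian)
    (hB : B.IsHermitian) :
    rtr ((A - B) * (cfc (fun t : ℝ => t * |t| ^ r) A - cfc (fun t : ℝ => t * |t| ^ r) B)) ≤
      (1 + r) * (rtr (cfc (fun t : ℝ => |t| ^ r) A * ((A - B) * (A - B))) +
        rtr (cfc (fun t : ℝ => |t| ^ r) B * ((B - A) * (B - A)))) := by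
  obtain ⟨w, hw, -, -, h⟩ := exists_weights hA hB
  have hAs : IsSelfAdjoint A := hA
  have hBs : IsSelfAdjoint B := hB
  set α := hA.eigenvalues
  set β := hB.eigenvalues
  have h' : ∀ f g : ℝ → ℝ, rtr (cfc f B * cfc g A) = ∑ i, ∑ j, w j i * (f (β i) * g (α j)) := by
    intro f g
    rw [rtr_mul_comm, h, Finset.sum_comm]
    simp only [mul_comm (g _)]
  have e1 := rtr_cfc_mul_sub_sq hAs hBs h fun t => |t| ^ r
  have e2 := rtr_cfc_mul_sub_sq hBs hAs h' fun t => |t| ^ r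
  rw [Finset.sum_comm] at e2
  set F : ℝ → ℝ := fun t => t * |t| ^ r with hF
  have e3 : rtr ((A - B) * (cfc F A - cfc F B)) =
      ∑ i, ∑ j, w i j * ((α i - β j) * (F (α i) - F (β j))) := by
    have h2 : rtr ((A - B) * (cfc F A - cfc F B)) =
        rtr (cfc (fun t : ℝ => t * F t) A * cfc (fun _ : ℝ => (1 : ℝ)) B) -
        rtr (cfc (fun t : ℝ => t) A * cfc F B) - rtr (cfc F A * cfc (fun t : ℝ => t) B) +
        rtr (cfc (fun _ : ℝ => (1 : ℝ)) A * cfc (fun t : ℝ => t * F t) B) := by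
      rw [cfc_eq_one hBs, cfc_eq_one hAs, cfc_eq_self hAs, cfc_eq_self hBs, mul_one, one_mul,
        ← self_mul_cfc_mat F hAs, ← self_mul_cfc_mat F hBs, rtr_mul_comm (cfc F A) B]
      simp only [mul_sub, sub_mul, rtr_sub]
      ring
    rw [h2, h, h, h, h, ← Finset.sum_sub_distrib, ← Finset.sum_sub_distrib,
      ← Finset.sum_add_distrib]
    refine Finset.sum_congr rfl fun i _ => ?_
    rw [← Finset.sum_sub_distrib, ← Finset.sum_sub_distrib, ← Finset.sum_add_distrib]
    exact Finset.sum_congr rfl fun j _ => by ring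
  rw [e1, e2, e3, ← Finset.sum_add_distrib, Finset.mul_sum]
  refine Finset.sum_le_sum fun i _ => ?_
  rw [← Finset.sum_add_distrib, Finset.mul_sum]
  refine Finset.sum_le_sum fun j _ => ?_
  have := mul_le_mul_of_nonneg_left (signed_rpow_diff_le hr (α i) (β j)) (hw i j)
  simp only [hF]
  linarith

lemma rad_isHermitian {x : ι → Matrix n n ℂ} (hx : ∀ k, (x k)ᴴ = x k) (ε : ι → Bool) :
    (rad x ε)ᴴ = rad x ε := by
  rw [rad_conjTranspose]; congr 1; exact funext hx

/-- The upper Khintchine inequality for large exponents and Hermitian coefficients. -/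
lemma upper_khintchine_hermitian {s : ℝ} (h1 : 1 < s) {C : ℝ}
    (hC : ∀ u v : ℝ, 0 ≤ u → 0 ≤ v →
      u ^ (1 / s) * v ^ (1 - 1 / s) ≤ 1 / (4 * (2 * s - 1)) * v + C * u)
    (x : ι → Matrix n n ℂ) (hx : ∀ k, (x k)ᴴ = x k) :
    ∑ ε, trPow s (rad x ε * rad x ε) ≤
      4 * (2 * s - 1) * C * numSigns ι * trPow s (∑ k, x k * x k) := by
  have h0 : 0 < s := by linarith
  set r : ℝ := 2 * s - 2 with hr
  have hr0 : 0 < r := by linarith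
  set F : ℝ → ℝ := fun t => t * |t| ^ r with hF
  set G : ℝ → ℝ := fun t => |t| ^ r with hG
  have hX : ∀ ε, (rad x ε)ᴴ = rad x ε := rad_isHermitian hx
  have hXs : ∀ ε, IsSelfAdjoint (rad x ε) := hX
  have hXX : ∀ ε, 0 ≤ rad x ε * rad x ε := fun ε => by
    have := conj_mul_self_nonneg (rad x ε); rwa [hX] at this
  have hH : 0 ≤ ∑ k, x k * x k := Finset.sum_nonneg fun k _ => by
    have := conj_mul_self_nonneg (x k); rwa [hx] at this
  have eX : ∀ ε, rad x ε * rad x ε = cfc (fun t : ℝ => t * t) (rad x ε) := fun ε => by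
    rw [← self_mul_cfc_mat (fun t => t) (hXs ε), cfc_eq_self (hXs ε)]
  have eG : ∀ ε, cfc (fun t : ℝ => t ^ (s - 1)) (rad x ε * rad x ε) = cfc G (rad x ε) := fun ε => by
    rw [eX, cfc_comp_mat _ _ (hXs ε)]
    congr 1
    funext t
    rw [hG, ← abs_mul_abs_self, ← sq, ← Real.rpow_natCast, ← Real.rpow_mul (abs_nonneg t)]
    congr 1; push_cast; ring
  have eF : ∀ ε, trPow s (rad x ε * rad x ε) = rtr (rad x ε * cfc F (rad x ε)) := fun ε => by
    rw [← rtr_cfc_rpow_mul_self h0.ne' (hXX ε), eG, eX, cfc_mul_mat, self_mul_cfc_mat _ (hXs ε)]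
    congr 2
    funext t
    simp only [hF, hG]; ring
  have hk : ∀ k, ∑ ε, sgn (ε k) * rtr (x k * cfc F (rad x ε)) ≤
      2 * (1 + r) * ∑ ε, rtr (cfc G (rad x ε) * (x k * x k)) := by
    intro k
    have hpt : ∀ ε, sgn (ε k) * rtr (x k * cfc F (rad x ε)) +
        sgn (flipSign k ε k) * rtr (x k * cfc F (rad x (flipSign k ε))) ≤
        2 * (1 + r) * (rtr (cfc G (rad x ε) * (x k * x k)) +
          rtr (cfc G (rad x (flipSign k ε)) * (x k * x k))) := by
      intro ε
      have hd : rad x ε - rad x (flipSign k ε) = (2 * sgn (ε k)) • x k := by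
        rw [rad_flipSign]; abel
      have hd' : rad x (flipSign k ε) - rad x ε = (-(2 * sgn (ε k))) • x k := by
        rw [rad_flipSign, neg_smul]; abel
      have h2 := rtr_signed_rpow_diff_le hr0 (hX ε) (hX (flipSign k ε))
      rw [hd, hd'] at h2
      simp only [Matrix.smul_mul, Matrix.mul_smul, smul_smul, rtr_smul, mul_sub, rtr_sub] at h2
      have h3 : sgn (ε k) * sgn (ε k) = 1 := sgn_mul_self _
      have h4 : 2 * sgn (ε k) * (2 * sgn (ε k)) = 4 := by linear_combination 4 * h3
      have h5 : -(2 * sgn (ε k)) * -(2 * sgn (ε k)) = 4 := by linear_combination 4 * h3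
      rw [h4, h5] at h2
      simp only [flipSign, Function.update_self, sgn_not]
      simp only [flipSign] at h2
      change _ ≤ _ at h2
      linarith
    have h6 := Finset.sum_le_sum fun ε (_ : ε ∈ Finset.univ) => hpt ε
    simp only [← Finset.mul_sum, Finset.sum_add_distrib] at h6
    rw [sum_flipSign k fun ε => sgn (ε k) * rtr (x k * cfc F (rad x ε)),
      sum_flipSign k fun ε => rtr (cfc G (rad x ε) * (x k * x k))] at h6
    linarith
  have h7 : ∑ ε, trPow s (rad x ε * rad x ε) ≤
      2 * (1 + r) * ∑ ε, rtr (cfc G (rad x ε) * ∑ k, x k * x k) := by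
    have e : ∀ ε, trPow s (rad x ε * rad x ε) = ∑ k, sgn (ε k) * rtr (x k * cfc F (rad x ε)) := by
      intro ε
      rw [eF]
      nth_rewrite 1 [rad]
      simp [Matrix.sum_mul, rtr_sum, rtr_smul]
    simp only [e, Matrix.mul_sum, rtr_sum]
    rw [Finset.sum_comm, Finset.sum_comm (f := fun ε k => rtr (cfc G (rad x ε) * (x k * x k))),
      Finset.mul_sum]
    exact Finset.sum_le_sum fun k _ => hk k
  have h8 : ∀ ε, rtr (cfc G (rad x ε) * ∑ k, x k * x k) ≤
      1 / (4 * (2 * s - 1)) * trPow s (rad x ε * rad x ε) + C * trPow s (∑ k, x k * x k) := by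
    intro ε
    rw [← eG]
    exact rtr_cfc_rpow_mul_le h1 hC (hXX ε) hH
  have h9 := Finset.sum_le_sum fun ε (_ : ε ∈ Finset.univ) => h8 ε
  rw [Finset.sum_add_distrib, ← Finset.mul_sum] at h9
  have h10 : ∑ _ε : ι → Bool, C * trPow s (∑ k, x k * x k) =
      numSigns ι * (C * trPow s (∑ k, x k * x k)) := by simp [numSigns]
  rw [h10] at h9
  have h11 : 2 * (1 + r) = 2 * (2 * s - 1) := by rw [hr]; ring
  rw [h11] at h7
  have h12 := mul_le_mul_of_nonneg_left h9 (by linarith : 0 ≤ 2 * (2 * s - 1))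
  have h13 : 2 * (2 * s - 1) * (1 / (4 * (2 * s - 1)) * ∑ ε, trPow s (rad x ε * rad x ε)) =
      1 / 2 * ∑ ε, trPow s (rad x ε * rad x ε) := by
    have : 2 * s - 1 ≠ 0 := by linarith
    field_simp; ring
  rw [mul_add, h13] at h12
  linarith

/-- The upper Khintchine inequality for large exponents. -/
lemma exists_upper_khintchine_large {s : ℝ} (h1 : 1 < s) :
    ∃ C : ℝ, 0 < C ∧ ∀ (n N : ℕ) (x : Fin N → Matrix (Fin n) (Fin n) ℂ),
      ∑ ε, trPow s ((rad x ε)ᴴ * rad x ε) ≤ C * numSigns (Fin N) *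
        (trPow s (∑ k, (x k)ᴴ * x k) + trPow s (∑ k, x k * (x k)ᴴ)) := by
  have h0 : 0 < s := by linarith
  obtain ⟨C, hC0, hC⟩ := exists_young (θ := 1 / s) (by positivity)
    (by rw [div_lt_one h0]; exact h1) (δ := 1 / (4 * (2 * s - 1)))
    (by have : 0 < 2 * s - 1 := by linarith
        positivity)
  have hD : 0 < 4 * (2 * s - 1) * C := by
    have : 0 < 2 * s - 1 := by linarith
    positivity
  refine ⟨4 ^ s * (2 * (4 * (2 * s - 1) * C) * 2 ^ s), by positivity, fun n N x => ?_⟩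
  set D := 4 * (2 * s - 1) * C with hDdef
  have hN := numSigns_pos (ι := Fin N)
  set h : Fin N → Matrix (Fin n) (Fin n) ℂ := fun k => (1 / 2 : ℂ) • (x k + (x k)ᴴ) with hh
  set g : Fin N → Matrix (Fin n) (Fin n) ℂ := fun k => (-Complex.I / 2 : ℂ) • (x k - (x k)ᴴ) with hg
  have hhs : ∀ k, (h k)ᴴ = h k := fun k => by
    simp [hh, conjTranspose_smul, add_comm]
  have hgs : ∀ k, (g k)ᴴ = g k := fun k => by
    simp only [hg, conjTranspose_smul, conjTranspose_sub, conjTranspose_conjTranspose]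
    simp [smul_sub, neg_div]
    abel
  have hx : ∀ k, x k = h k + Complex.I • g k := fun k => by
    simp only [hh, hg, smul_smul]
    have : Complex.I * (-Complex.I / 2) = 1 / 2 := by
      rw [mul_div_assoc', mul_neg, Complex.I_mul_I]; norm_num
    rw [this, ← smul_add, add_add_sub_cancel, ← two_smul ℂ, smul_smul]; norm_num
  have hpt : ∀ ε, trPow s ((rad x ε)ᴴ * rad x ε) ≤
      4 ^ s * (trPow s (rad h ε * rad h ε) + trPow s (rad g ε * rad g ε)) := by
    intro ε
    have e : rad x ε = rad h ε + Complex.I • rad g ε := by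
      rw [← rad_smul, ← rad_add]; congr 1; exact funext hx
    have := trPow_conj_add_le h0 (rad h ε) (Complex.I • rad g ε)
    rw [← e, conjTranspose_smul, Matrix.smul_mul, Matrix.mul_smul, smul_smul] at this
    simpa [rad_isHermitian hhs, rad_isHermitian hgs] using this
  have hsq : ∀ k, h k * h k + g k * g k = (1 / 2 : ℝ) • ((x k)ᴴ * x k + x k * (x k)ᴴ) := by
    intro k
    have e : (1 / 2 : ℝ) • ((x k)ᴴ * x k + x k * (x k)ᴴ) =
        (1 / 2 : ℂ) • ((x k)ᴴ * x k + x k * (x k)ᴴ) := by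
      rw [← Complex.coe_smul]; norm_num
    rw [e]
    simp only [hh, hg, Matrix.smul_mul, Matrix.mul_smul, smul_smul]
    have h1 : -Complex.I / 2 * (-Complex.I / 2) = -(1 / 4) := by
      rw [div_mul_div_comm, neg_mul_neg, Complex.I_mul_I]; norm_num
    rw [h1]
    have h2 : (1 / 2 : ℂ) * (1 / 2) = 1 / 4 := by norm_num
    rw [h2, neg_smul, ← sub_eq_add_neg, ← smul_sub]
    have h3 : (x k + (x k)ᴴ) * (x k + (x k)ᴴ) - (x k - (x k)ᴴ) * (x k - (x k)ᴴ) =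
        (2 : ℂ) • ((x k)ᴴ * x k + x k * (x k)ᴴ) := by
      rw [two_smul]; noncomm_ring
    rw [h3, smul_smul]; norm_num
  have hc0 : 0 ≤ ∑ k, (x k)ᴴ * x k := Finset.sum_nonneg fun k _ => conj_mul_self_nonneg _
  have hr0 : 0 ≤ ∑ k, x k * (x k)ᴴ := Finset.sum_nonneg fun k _ => self_mul_conj_nonneg _
  have hh0 : ∀ k, 0 ≤ h k * h k := fun k => by
    have := conj_mul_self_nonneg (h k); rwa [hhs] at this
  have hg0 : ∀ k, 0 ≤ g k * g k := fun k => by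
    have := conj_mul_self_nonneg (g k); rwa [hgs] at this
  have hsum : ∀ k, h k * h k + g k * g k ≤ (x k)ᴴ * x k + x k * (x k)ᴴ := by
    intro k
    rw [hsq, ← sub_nonneg]
    have e : ∀ M : Matrix (Fin n) (Fin n) ℂ, M - (1 / 2 : ℝ) • M = (1 / 2 : ℝ) • M := fun M => by
      nth_rewrite 1 [← one_smul ℝ M]
      rw [← sub_smul]; norm_num
    rw [e]
    exact smul_nonneg_mat (by norm_num)
      (add_nonneg (conj_mul_self_nonneg _) (self_mul_conj_nonneg _))
  have hle : ∀ f : Fin N → Matrix (Fin n) (Fin n) ℂ, (∀ k, 0 ≤ f k) →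
      (∀ k, f k ≤ h k * h k + g k * g k) → trPow s (∑ k, f k) ≤
        2 ^ s * (trPow s (∑ k, (x k)ᴴ * x k) + trPow s (∑ k, x k * (x k)ᴴ)) := by
    intro f hf0 hf
    refine (trPow_mono h0 (Finset.sum_nonneg fun k _ => hf0 k) ?_).trans (trPow_add_le h0 hc0 hr0)
    rw [← Finset.sum_add_distrib]
    exact Finset.sum_le_sum fun k _ => (hf k).trans (hsum k)
  have h2 := hle (fun k => h k * h k) hh0 fun k => le_add_of_nonneg_right (hg0 k)
  have h3 := hle (fun k => g k * g k) hg0 fun k => le_add_of_nonneg_left (hh0 k)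
  have h4 := upper_khintchine_hermitian h1 hC h hhs
  have h5 := upper_khintchine_hermitian h1 hC g hgs
  rw [← hDdef] at h4 h5
  have h6 := Finset.sum_le_sum fun ε (_ : ε ∈ Finset.univ) => hpt ε
  rw [← Finset.mul_sum, Finset.sum_add_distrib] at h6
  refine h6.trans ?_
  set T := trPow s (∑ k, (x k)ᴴ * x k) + trPow s (∑ k, x k * (x k)ᴴ)
  have h7 := mul_le_mul_of_nonneg_left h2 (by positivity : 0 ≤ D * numSigns (Fin N))
  have h8 := mul_le_mul_of_nonneg_left h3 (by positivity : 0 ≤ D * numSigns (Fin N))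
  calc _ ≤ (4 : ℝ) ^ s * (2 * (D * numSigns (Fin N) * (2 ^ s * T))) :=
        mul_le_mul_of_nonneg_left (by linarith) (by positivity)
    _ = _ := by ring

lemma IsHeavy.sum_le {χ : (ι → Bool) → ℝ} (hχ : IsHeavy χ) : ∑ ε, χ ε ≤ numSigns ι := by
  calc ∑ ε, χ ε ≤ ∑ _ε : ι → Bool, (1 : ℝ) := Finset.sum_le_sum fun ε _ => hχ.le_one ε
    _ = numSigns ι := by simp [numSigns]

lemma IsHeavy.trPow_column_le {χ : (ι → Bool) → ℝ} (hχ : IsHeavy χ) {s : ℝ} (h1 : 1 < s) {C : ℝ}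
    (hC : ∀ u v : ℝ, 0 ≤ u → 0 ≤ v → u ^ (1 / s) * v ^ (1 - 1 / s) ≤ 1 / 4 * v + C * u)
    (x : ι → Matrix n n ℂ) :
    numSigns ι * trPow s (∑ k, (x k)ᴴ * x k) ≤
      4 * C * ∑ ε, χ ε * trPow s ((rad x ε)ᴴ * rad x ε) := by
  set α := ∑ k, (x k)ᴴ * x k with hα
  have h0 : 0 ≤ α := Finset.sum_nonneg fun k _ => conj_mul_self_nonneg _
  have e1 := hχ.column_le x (M := cfc (fun t : ℝ => t ^ (s - 1)) α)
    (cfc_nonneg_mat h0 fun t ht => Real.rpow_nonneg ht _)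
  rw [← hα, rtr_cfc_rpow_mul_self (by linarith) h0] at e1
  have e2 : ∑ ε, χ ε * rtr (cfc (fun t : ℝ => t ^ (s - 1)) α * ((rad x ε)ᴴ * rad x ε)) ≤
      ∑ ε, χ ε * (1 / 4 * trPow s α + C * trPow s ((rad x ε)ᴴ * rad x ε)) :=
    Finset.sum_le_sum fun ε _ => mul_le_mul_of_nonneg_left
      (rtr_cfc_rpow_mul_le h1 hC h0 (conj_mul_self_nonneg _)) (hχ.nonneg ε)
  have e3 : ∑ ε, χ ε * (1 / 4 * trPow s α + C * trPow s ((rad x ε)ᴴ * rad x ε)) =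
      1 / 4 * ((∑ ε, χ ε) * trPow s α) + C * ∑ ε, χ ε * trPow s ((rad x ε)ᴴ * rad x ε) := by
    rw [Finset.sum_mul, Finset.mul_sum, Finset.mul_sum, ← Finset.sum_add_distrib]
    exact Finset.sum_congr rfl fun ε _ => by ring
  have e4 := mul_le_mul_of_nonneg_right hχ.sum_le (trPow_nonneg h0 s)
  linarith

/-- The lower Khintchine inequality for large exponents, on a large set of sign patterns. -/
lemma exists_lower_khintchine_large {s : ℝ} (h1 : 1 < s) :
    ∃ C : ℝ, 0 < C ∧ ∀ (n N : ℕ) (χ : (Fin N → Bool) → ℝ), IsHeavy χ →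
      ∀ x : Fin N → Matrix (Fin n) (Fin n) ℂ,
      numSigns (Fin N) * (trPow s (∑ k, (x k)ᴴ * x k) + trPow s (∑ k, x k * (x k)ᴴ)) ≤
        C * ∑ ε, χ ε * trPow s ((rad x ε)ᴴ * rad x ε) := by
  obtain ⟨C, hC0, hC⟩ := exists_young (θ := 1 / s) (by positivity)
    (by rw [div_lt_one (by linarith)]; exact h1) (δ := 1 / 4) (by norm_num)
  refine ⟨8 * C, by positivity, fun n N χ hχ x => ?_⟩
  have e1 := hχ.trPow_column_le h1 hC x
  have e2 := hχ.trPow_column_le h1 hC fun k => (x k)ᴴ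
  simp only [← rad_conjTranspose, conjTranspose_conjTranspose, ← trPow_conj] at e2
  linarith

lemma lower_khintchine_one {χ : (ι → Bool) → ℝ} (hχ : IsHeavy χ) (x : ι → Matrix n n ℂ) :
    numSigns ι * trPow 1 (∑ k, (x k)ᴴ * x k) ≤
      2 * ∑ ε, χ ε * trPow 1 ((rad x ε)ᴴ * rad x ε) := by
  have h := hχ.hs_le x
  have h0 : 0 ≤ ∑ k, (x k)ᴴ * x k := Finset.sum_nonneg fun k _ => conj_mul_self_nonneg _
  simp only [trPow_one (nonneg_isSelfAdjoint (conj_mul_self_nonneg _)),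
    trPow_one (nonneg_isSelfAdjoint h0), rtr_sum]
  exact h

lemma continuous_cfc_rpow {X : Type*} [TopologicalSpace X] {r : ℝ} (hr : 0 < r)
    {a : X → Matrix n n ℂ} (ha : Continuous a) (h : ∀ x, IsSelfAdjoint (a x)) :
    Continuous fun x => cfc (fun t : ℝ => t ^ r) (a x) := by
  open scoped Matrix.Norms.L2Operator in
  exact Continuous.cfc_of_mem_nhdsSet (s := Set.univ) _ Filter.univ_mem ha h
    (Real.continuous_rpow_const hr.le).continuousOn

lemma continuous_rtr {X : Type*} [TopologicalSpace X] {a : X → Matrix n n ℂ} (ha : Continuous a) :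
    Continuous fun x => rtr (a x) :=
  Complex.continuous_re.comp ha.matrix_trace

lemma eq_zero_of_hs_nonpos {V : Matrix n n ℂ} (h : hs V ≤ 0) : V = 0 := by
  have h0 := (posSemidef_conjTranspose_mul_self V).trace_nonneg
  rw [← Matrix.trace_conjTranspose_mul_self_eq_zero_iff]
  have h1 := Complex.le_def.1 h0
  exact Complex.ext (le_antisymm h h1.1) h1.2.symm

lemma hs_eq_sum (V : Matrix n n ℂ) : hs V = ∑ j, ∑ i, ‖V i j‖ ^ 2 := by
  simp only [hs, rtr, Matrix.trace, Matrix.diag, Matrix.mul_apply, Complex.re_sum,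
    conjTranspose_apply]
  refine Finset.sum_congr rfl fun j _ => Finset.sum_congr rfl fun i _ => ?_
  rw [← Complex.normSq_eq_norm_sq, Complex.star_def, ← Complex.normSq_eq_conj_mul_self]
  simp

lemma two_rtr_le (V W : Matrix n n ℂ) : 2 * rtr (Vᴴ * W) ≤ hs V + hs W := by
  have := hs_add_smul V W (-1)
  have h2 := hs_nonneg (V + (-1 : ℝ) • W)
  linarith

lemma trPow_sub_le {σ : ℝ} (h1 : 1 < σ) {A B : Matrix n n ℂ} (hA : 0 ≤ A) (hB : 0 ≤ B) :
    trPow σ B - trPow σ A ≤ σ * rtr (cfc (fun t : ℝ => t ^ (σ - 1)) B * (B - A)) := by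
  have := rtr_cfc_rpow_mul_le h1 (fun u v => young_conj h1) hB hA
  rw [mul_sub, rtr_sub, rtr_cfc_rpow_mul_self (by linarith) hB]
  have h2 := mul_le_mul_of_nonneg_left this (by linarith : 0 ≤ σ)
  have h3 : σ * ((1 - 1 / σ) * trPow σ B + 1 / σ * trPow σ A) = (σ - 1) * trPow σ B + trPow σ A := by
    field_simp
  linarith

lemma mul_rtr_le_trPow {σ : ℝ} (h1 : 1 < σ) {A : Matrix n n ℂ} (hA : 0 ≤ A) :
    σ * rtr A ≤ trPow σ A + (σ - 1) * Fintype.card n := by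
  rw [trPow_eq hA.posSemidef.1, ← trPow_one (nonneg_isSelfAdjoint hA), trPow_eq hA.posSemidef.1]
  simp only [Real.rpow_one]
  have : ((σ - 1) * Fintype.card n : ℝ) = ∑ _i : n, (σ - 1) := by simp; ring
  rw [this, Finset.mul_sum, ← Finset.sum_add_distrib]
  refine Finset.sum_le_sum fun i _ => ?_
  have := one_add_mul_self_le_rpow_one_add
    (by linarith [hA.posSemidef.eigenvalues_nonneg i] : -1 ≤ hA.posSemidef.1.eigenvalues i - 1) h1.le
  rw [add_sub_cancel] at this
  linarith

/-- The symmetric square function of a family. -/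
noncomputable def symSq (y : ι → Matrix n n ℂ) : Matrix n n ℂ :=
  ∑ k, (y k * (y k)ᴴ + (y k)ᴴ * y k)

lemma symSq_nonneg (y : ι → Matrix n n ℂ) : 0 ≤ symSq y :=
  Finset.sum_nonneg fun _ _ => add_nonneg (self_mul_conj_nonneg _) (conj_mul_self_nonneg _)

lemma rtr_symSq (y : ι → Matrix n n ℂ) : rtr (symSq y) = 2 * ∑ k, hs (y k) := by
  simp only [symSq, rtr_sum, rtr_add, hs, rtr_mul_comm (y _), Finset.mul_sum, two_mul]

lemma continuous_symSq : Continuous (symSq : (ι → Matrix n n ℂ) → Matrix n n ℂ) := by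
  unfold symSq
  fun_prop

lemma symSq_add_smul (y d : ι → Matrix n n ℂ) (t : ℝ) :
    symSq (fun k => y k + t • d k) = symSq y +
      t • ((∑ k, (y k * (d k)ᴴ + d k * (y k)ᴴ + (y k)ᴴ * d k + (d k)ᴴ * y k)) + t • symSq d) := by
  simp only [symSq, smul_add, Finset.smul_sum, ← Finset.sum_add_distrib]
  refine Finset.sum_congr rfl fun k _ => ?_
  simp only [conjTranspose_add, conjTranspose_smul, star_trivial, mul_add, add_mul,
    smul_mul_assoc, mul_smul_comm, smul_add]
  abel

lemma rtr_mul_symSq_deriv {B : Matrix n n ℂ} (hB : Bᴴ = B) (y d : Matrix n n ℂ) :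
    rtr (B * (y * dᴴ + d * yᴴ + yᴴ * d + dᴴ * y)) = 2 * rtr (dᴴ * (B * y + y * B)) := by
  have e1 : rtr (B * (y * dᴴ)) = rtr (dᴴ * (B * y)) := by rw [← mul_assoc, rtr_mul_comm]
  have e2 : rtr (B * (d * yᴴ)) = rtr (dᴴ * (B * y)) := by
    rw [← rtr_conjTranspose]
    simp only [conjTranspose_mul, conjTranspose_conjTranspose, hB]
    rw [mul_assoc, rtr_mul_comm, mul_assoc]
  have e3 : rtr (B * (yᴴ * d)) = rtr (dᴴ * (y * B)) := by
    rw [← rtr_conjTranspose]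
    simp only [conjTranspose_mul, conjTranspose_conjTranspose, hB, mul_assoc]
  have e4 : rtr (B * (dᴴ * y)) = rtr (dᴴ * (y * B)) := by rw [rtr_mul_comm, mul_assoc]
  simp only [mul_add, rtr_add, e1, e2, e3, e4]
  ring

/-- The functional whose minimisers give optimal decompositions. -/
noncomputable def dualFun (σ : ℝ) (x y : ι → Matrix n n ℂ) : ℝ :=
  trPow σ (symSq y) - 2 * σ * ∑ k, rtr ((y k)ᴴ * x k)

lemma continuous_dualFun {σ : ℝ} (h1 : 1 < σ) (x : ι → Matrix n n ℂ) :
    Continuous (dualFun σ x) := by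
  refine Continuous.sub (continuous_rtr (continuous_cfc_rpow (by linarith) continuous_symSq
    fun y => nonneg_isSelfAdjoint (symSq_nonneg y))) (continuous_const.mul ?_)
  refine continuous_finsetSum _ fun k _ => continuous_rtr ?_
  fun_prop

lemma exists_dualFun_min {σ : ℝ} (h1 : 1 < σ) (x : ι → Matrix n n ℂ) :
    ∃ y, ∀ z, dualFun σ x y ≤ dualFun σ x z := by
  set c := (σ - 1) * Fintype.card n + σ * ∑ k, hs (x k) with hc
  have hσ : 0 < σ := by linarith
  have hc0 : 0 ≤ c := add_nonneg (mul_nonneg (by linarith) (by positivity))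
    (mul_nonneg hσ.le (Finset.sum_nonneg fun k _ => hs_nonneg _))
  set R := 1 + c / σ with hR
  have hR1 : 1 ≤ R := le_add_of_nonneg_right (div_nonneg hc0 hσ.le)
  have hlow : ∀ z, σ * ∑ k, hs (z k) - c ≤ dualFun σ x z := by
    intro z
    have e1 := mul_rtr_le_trPow h1 (symSq_nonneg z)
    rw [rtr_symSq] at e1
    have e2 : 2 * ∑ k, rtr ((z k)ᴴ * x k) ≤ ∑ k, hs (z k) + ∑ k, hs (x k) := by
      rw [Finset.mul_sum, ← Finset.sum_add_distrib]
      exact Finset.sum_le_sum fun k _ => two_rtr_le _ _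
    have e3 := mul_le_mul_of_nonneg_left e2 hσ.le
    rw [dualFun, hc]
    linarith
  set K : Set (ι → Matrix n n ℂ) := Set.pi Set.univ fun _ =>
    (Set.pi Set.univ fun _ => Set.pi Set.univ fun _ => Metric.closedBall (0 : ℂ) R :
      Set (n → n → ℂ)) with hK
  have hKc : IsCompact K := isCompact_univ_pi fun _ => isCompact_univ_pi fun _ =>
    isCompact_univ_pi fun _ => isCompact_closedBall 0 R
  have h0K : (0 : ι → Matrix n n ℂ) ∈ K := fun k _ i _ j _ => by
    simp; linarith
  obtain ⟨y, -, hy⟩ := hKc.exists_isMinOn ⟨0, h0K⟩ (continuous_dualFun h1 x).continuousOn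
  refine ⟨y, fun z => ?_⟩
  by_cases hz : z ∈ K
  · exact hy hz
  have hy0 : dualFun σ x y ≤ 0 := by
    refine (hy h0K).trans (le_of_eq ?_)
    simp [dualFun, symSq, trPow_zero_mat (n := n) hσ.ne', rtr_zero]
  refine hy0.trans (le_trans ?_ (hlow z))
  have hz : ∃ k i j, R < ‖z k i j‖ := by
    by_contra! h
    exact hz fun k _ i _ j _ => mem_closedBall_zero_iff.2 (h k i j)
  obtain ⟨k, i, j, hz⟩ := hz
  have e1 : ‖z k i j‖ ^ 2 ≤ ∑ k, hs (z k) := by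
    refine le_trans ?_ (Finset.single_le_sum (fun k _ => hs_nonneg (z k)) (Finset.mem_univ k))
    rw [hs_eq_sum]
    refine le_trans ?_ (Finset.single_le_sum
      (fun j _ => Finset.sum_nonneg fun i _ => sq_nonneg ‖z k i j‖) (Finset.mem_univ j))
    exact Finset.single_le_sum (f := fun i => ‖z k i j‖ ^ 2) (fun i _ => sq_nonneg _)
      (Finset.mem_univ i)
  have e2 : R ≤ ‖z k i j‖ ^ 2 := by nlinarith
  have e3 := mul_le_mul_of_nonneg_left (e2.trans e1) hσ.le
  have e4 : σ * R = σ + c := by rw [hR]; field_simp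
  linarith

lemma exists_dual_factor {σ : ℝ} (h1 : 1 < σ) (x : ι → Matrix n n ℂ) :
    ∃ y : ι → Matrix n n ℂ, ∀ k, x k = cfc (fun t : ℝ => t ^ (σ - 1)) (symSq y) * y k +
      y k * cfc (fun t : ℝ => t ^ (σ - 1)) (symSq y) := by
  have hσ : 0 < σ := by linarith
  obtain ⟨y, hy⟩ := exists_dualFun_min h1 x
  refine ⟨y, ?_⟩
  set B := cfc (fun t : ℝ => t ^ (σ - 1)) (symSq y) with hB
  set d : ι → Matrix n n ℂ := fun k => x k - (B * y k + y k * B) with hd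
  set L := ∑ k, (y k * (d k)ᴴ + d k * (y k)ᴴ + (y k)ᴴ * d k + (d k)ᴴ * y k) with hL
  set At : ℝ → Matrix n n ℂ := fun t => symSq fun k => y k + t • d k with hAt
  have hAt0 : ∀ t, 0 ≤ At t := fun t => symSq_nonneg _
  have key : ∀ t : ℝ, 0 < t → 2 * ∑ k, rtr ((d k)ᴴ * x k) ≤
      rtr (cfc (fun t : ℝ => t ^ (σ - 1)) (At t) * (L + t • symSq d)) := by
    intro t ht
    have e1 := hy fun k => y k + t • d k
    have e2 := trPow_sub_le h1 (symSq_nonneg y) (hAt0 t)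
    have e3 : At t - symSq y = t • (L + t • symSq d) := by
      rw [hAt, hL]; simp only [symSq_add_smul]; abel
    rw [e3, mul_smul_comm, rtr_smul] at e2
    simp only [dualFun, conjTranspose_add, conjTranspose_smul, star_trivial, add_mul, rtr_add,
      smul_mul_assoc, rtr_smul, Finset.sum_add_distrib, ← Finset.mul_sum] at e1
    have e4 : 0 ≤ σ * t * (rtr (cfc (fun t : ℝ => t ^ (σ - 1)) (At t) * (L + t • symSq d)) -
        2 * ∑ k, rtr ((d k)ᴴ * x k)) := by
      change trPow σ (symSq y) - _ ≤ trPow σ (At t) - _ at e1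
      linarith
    have := nonneg_of_mul_nonneg_right e4 (by positivity)
    linarith
  have hcont : Continuous fun t : ℝ =>
      rtr (cfc (fun t : ℝ => t ^ (σ - 1)) (At t) * (L + t • symSq d)) := by
    refine continuous_rtr (Continuous.mul (continuous_cfc_rpow (by linarith) ?_
      fun t => nonneg_isSelfAdjoint (hAt0 t)) (by fun_prop))
    exact continuous_symSq.comp (by fun_prop)
  have hlim : 2 * ∑ k, rtr ((d k)ᴴ * x k) ≤ rtr (B * L) := by
    have h2 := (hcont.tendsto 0).mono_left (nhdsWithin_le_nhds (s := Set.Ioi 0))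
    simp only [hAt, zero_smul, add_zero] at h2
    refine ge_of_tendsto h2 ?_
    filter_upwards [self_mem_nhdsWithin] with t ht using key t ht
  rw [hL, Finset.mul_sum Finset.univ _ B, rtr_sum] at hlim
  have hBs : Bᴴ = B := cfc_isSelfAdjoint _ _
  simp only [rtr_mul_symSq_deriv hBs] at hlim
  rw [← Finset.mul_sum] at hlim
  have h3 : ∑ k, hs (d k) ≤ 0 := by
    have : ∀ k, hs (d k) = rtr ((d k)ᴴ * x k) - rtr ((d k)ᴴ * (B * y k + y k * B)) := by
      intro k
      rw [← rtr_sub, ← mul_sub, hs]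
    simp only [this, Finset.sum_sub_distrib]
    linarith
  intro k
  have h4 := (Finset.single_le_sum (fun k _ => hs_nonneg (d k)) (Finset.mem_univ k)).trans h3
  exact sub_eq_zero.1 (eq_zero_of_hs_nonpos h4)

lemma two_rtr_le_smul {c : ℝ} (hc : 0 < c) (V W : Matrix n n ℂ) :
    2 * rtr (Vᴴ * W) ≤ c * hs V + c⁻¹ * hs W := by
  have h1 := hs_add_smul V W (-c⁻¹)
  have h2 := mul_nonneg hc.le (hs_nonneg (V + (-c⁻¹) • W))
  rw [h1] at h2
  have h3 : c * (hs V + 2 * -c⁻¹ * rtr (Vᴴ * W) + (-c⁻¹) ^ 2 * hs W) =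
    c * hs V - 2 * rtr (Vᴴ * W) + c⁻¹ * hs W := by field_simp; ring
  linarith

lemma hs_mul (M X : Matrix n n ℂ) : hs (M * X) = rtr (Mᴴ * M * (X * Xᴴ)) := by
  rw [hs, conjTranspose_mul, mul_assoc, rtr_mul_comm]
  simp only [mul_assoc]

lemma hs_cfc_mul (f : ℝ → ℝ) (A X : Matrix n n ℂ) :
    hs (cfc f A * X) = rtr (cfc (fun t => f t * f t) A * (X * Xᴴ)) := by
  rw [hs_mul, cfc_isSelfAdjoint, cfc_mul_mat]

/-- A function equal to `1` on the nonzero spectrum of `XXᴴ` fixes `X`. -/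
lemma cfc_mul_conj_mul_self {X : Matrix n n ℂ} {f : ℝ → ℝ} (h : ∀ t, 0 < t → f t = 1) :
    cfc f (X * Xᴴ) * X = X := by
  have hZ0 : 0 ≤ X * Xᴴ := self_mul_conj_nonneg X
  have hZs := nonneg_isSelfAdjoint hZ0
  have e : cfc (fun t => 1 - f t) (X * Xᴴ) + cfc f (X * Xᴴ) = 1 := by
    rw [cfc_add_mat]
    simp only [sub_add_cancel]
    exact cfc_eq_one hZs
  have e2 : cfc (fun t => 1 - f t) (X * Xᴴ) * X = 0 := by
    refine eq_zero_of_hs_nonpos (le_of_eq ?_)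
    rw [hs_cfc_mul, cfc_mul_self_mat _ hZs, cfc_congr_nonneg hZ0 (g := fun _ => 0), cfc_const_zero,
      rtr_zero]
    intro t ht
    rcases ht.eq_or_lt with rfl | ht
    · simp
    · simp [h t ht]
  have e3 := congrArg (· * X) e
  simpa [add_mul, e2] using e3

lemma rtr_holder {s σ : ℝ} (h0 : 1 / 2 < s) (h1 : s < 1) (hσ : σ = s / (2 * s - 1)) {c : ℝ}
    (hc : 0 < c) (Y X : Matrix n n ℂ) :
    2 * rtr (Yᴴ * X) ≤ c * trPow σ (Yᴴ * Y) + (c + c⁻¹) * trPow s (Xᴴ * X) := by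
  have hσ1 : 1 < σ := by rw [hσ, lt_div_iff₀ (by linarith)]; linarith
  rw [trPow_conj, trPow_conj]
  set Z := X * Xᴴ with hZ
  have hZ0 : 0 ≤ Z := self_mul_conj_nonneg X
  set T := cfc (fun t : ℝ => t ^ ((1 - s) / 2)) Z with hT
  set T' := cfc (fun t : ℝ => t ^ (-((1 - s) / 2))) Z with hT'
  have e1 : T * (T' * X) = X := by
    rw [← mul_assoc, hT, hT', cfc_mul_mat]
    refine cfc_mul_conj_mul_self fun t ht => ?_
    rw [← Real.rpow_add ht]; simp
  have e2 : rtr (Yᴴ * X) = rtr ((T * Y)ᴴ * (T' * X)) := by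
    conv_lhs => rw [← e1]
    rw [conjTranspose_mul, hT, cfc_isSelfAdjoint, mul_assoc]
  have e3 : hs (T' * X) = trPow s Z := by
    rw [hs_cfc_mul, ← hZ, cfc_mul_self_mat _ (nonneg_isSelfAdjoint hZ0), trPow]
    congr 1
    refine cfc_congr_nonneg hZ0 fun t ht => ?_
    rcases ht.eq_or_lt with rfl | ht
    · rw [Real.zero_rpow (by linarith : s ≠ 0)]; simp
    · rw [← Real.rpow_add ht, ← Real.rpow_add_one ht.ne']; ring_nf
  have e4 : hs (T * Y) ≤ trPow s Z + trPow σ (Y * Yᴴ) := by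
    have h2 : hs (T * Y) = rtr (cfc (fun t : ℝ => t ^ (σ - 1))
        (cfc (fun t : ℝ => t ^ (s / σ)) Z) * (Y * Yᴴ)) := by
      rw [hs_cfc_mul, cfc_comp_mat _ _ (nonneg_isSelfAdjoint hZ0)]
      congr 2
      refine cfc_congr_nonneg hZ0 fun t ht => ?_
      rw [← Real.rpow_mul ht, ← Real.rpow_add_of_nonneg ht (by linarith) (by linarith)]
      congr 1
      have h2 : σ * (2 * s - 1) = s := by rw [hσ]; exact div_mul_cancel₀ _ (by linarith)
      rw [(div_eq_iff (by linarith)).2 ((mul_comm _ _).trans h2).symm]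
      linarith
    have h3 := rtr_cfc_rpow_mul_le hσ1 (fun u v => young_conj hσ1)
      (cfc_nonneg_mat hZ0 fun t ht => Real.rpow_nonneg ht (s / σ)) (self_mul_conj_nonneg Y)
    rw [← h2, trPow_cfc_rpow hZ0, div_mul_cancel₀ _ (by linarith : σ ≠ 0)] at h3
    refine h3.trans (add_le_add ?_ ?_)
    · exact mul_le_of_le_one_left (trPow_nonneg hZ0 s) (by
        have : 0 < 1 / σ := by positivity
        linarith)
    · exact mul_le_of_le_one_left (trPow_nonneg (self_mul_conj_nonneg Y) σ)
        ((div_le_one (by linarith)).2 hσ1.le)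
  rw [e2]
  have e5 := two_rtr_le_smul hc (T * Y) (T' * X)
  have e6 := mul_le_mul_of_nonneg_left e4 hc.le
  rw [e3] at e5
  linarith

lemma trPow_conj_rpow_le {s σ : ℝ} (h0 : 1 / 2 < s) (h1 : s < 1) (hσ : σ = s / (2 * s - 1))
    {A M : Matrix n n ℂ} (hM : 0 ≤ M) (hMA : M ≤ A) :
    trPow s (cfc (fun t : ℝ => t ^ (σ - 1)) A * M * cfc (fun t : ℝ => t ^ (σ - 1)) A) ≤
      trPow σ A := by
  have hσ1 : 1 < σ := by rw [hσ, lt_div_iff₀ (by linarith)]; linarith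
  have hA : 0 ≤ A := hM.trans hMA
  set B := cfc (fun t : ℝ => t ^ (σ - 1)) A with hB
  have hBs : Bᴴ = B := cfc_isSelfAdjoint _ _
  have e1 : 0 ≤ B * M * B := by simpa [hBs] using conj_mono hM B
  have e2 : B * M * B ≤ B * A * B := by simpa only [hBs] using conj_mono hMA B
  refine (trPow_mono (by linarith) e1 e2).trans (le_of_eq ?_)
  have e3 : B * A * B = cfc (fun t : ℝ => t ^ (2 * σ - 1)) A := by
    rw [hB, cfc_mul_self_mat _ (nonneg_isSelfAdjoint hA), cfc_mul_mat]
    refine cfc_congr_nonneg hA fun t ht => ?_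
    rw [rpow_sub_one_mul_self (by linarith) ht,
      ← Real.rpow_add_of_nonneg ht (by linarith) (by linarith)]
    ring_nf
  rw [e3, trPow_cfc_rpow hA]
  congr 1
  rw [hσ]
  have : 2 * s - 1 ≠ 0 := by linarith
  field_simp
  ring

/-- The lower Khintchine inequality for `1 / 2 < s < 1`, on a large set of sign patterns. -/
lemma exists_lower_khintchine_mid {s : ℝ} (h0 : 1 / 2 < s) (h1 : s < 1) :
    ∃ C : ℝ, 0 < C ∧ ∀ (n N : ℕ) (χ : (Fin N → Bool) → ℝ), IsHeavy χ →
      ∀ x : Fin N → Matrix (Fin n) (Fin n) ℂ,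
      ∃ a b : Fin N → Matrix (Fin n) (Fin n) ℂ, (∀ k, x k = a k + b k) ∧
      numSigns (Fin N) * (trPow s (∑ k, (a k)ᴴ * a k) + trPow s (∑ k, b k * (b k)ᴴ)) ≤
        C * ∑ ε, χ ε * trPow s ((rad x ε)ᴴ * rad x ε) := by
  obtain ⟨σ, hσ⟩ : ∃ σ, σ = s / (2 * s - 1) := ⟨_, rfl⟩
  have hσ1 : 1 < σ := by rw [hσ, lt_div_iff₀ (by linarith)]; linarith
  obtain ⟨D, hD0, hD⟩ := exists_upper_khintchine_large hσ1
  obtain ⟨c, hc⟩ : ∃ c, c = 1 / (4 * D) := ⟨_, rfl⟩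
  have hc0 : 0 < c := by rw [hc]; positivity
  refine ⟨4 * (c + c⁻¹), by positivity, fun n N χ hχ x => ?_⟩
  obtain ⟨y, hy⟩ := exists_dual_factor hσ1 x
  set A := symSq y with hA
  set B := cfc (fun t : ℝ => t ^ (σ - 1)) A with hB
  have hA0 : 0 ≤ A := symSq_nonneg y
  have hB0 : 0 ≤ B := cfc_nonneg_mat hA0 fun t ht => Real.rpow_nonneg ht _
  have hBs : Bᴴ = B := cfc_isSelfAdjoint _ _
  have hAs : A = ∑ k, y k * (y k)ᴴ + ∑ k, (y k)ᴴ * y k := Finset.sum_add_distrib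
  have hr0 : 0 ≤ ∑ k, y k * (y k)ᴴ := Finset.sum_nonneg fun k _ => self_mul_conj_nonneg _
  have hc0' : 0 ≤ ∑ k, (y k)ᴴ * y k := Finset.sum_nonneg fun k _ => conj_mul_self_nonneg _
  have hrA : ∑ k, y k * (y k)ᴴ ≤ A := by rw [hAs]; exact le_add_of_nonneg_right hc0'
  have hcA : ∑ k, (y k)ᴴ * y k ≤ A := by rw [hAs]; exact le_add_of_nonneg_left hr0
  refine ⟨fun k => y k * B, fun k => B * y k, fun k => by rw [hy k, add_comm], ?_⟩
  have ea : trPow s (∑ k, (y k * B)ᴴ * (y k * B)) ≤ trPow σ A := by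
    have : ∑ k, (y k * B)ᴴ * (y k * B) = B * (∑ k, (y k)ᴴ * y k) * B := by
      simp only [conjTranspose_mul, hBs, Finset.mul_sum, Finset.sum_mul, mul_assoc]
    rw [this]
    exact trPow_conj_rpow_le h0 h1 hσ hc0' hcA
  have eb : trPow s (∑ k, (B * y k) * (B * y k)ᴴ) ≤ trPow σ A := by
    have : ∑ k, (B * y k) * (B * y k)ᴴ = B * (∑ k, y k * (y k)ᴴ) * B := by
      simp only [conjTranspose_mul, hBs, Finset.mul_sum, Finset.sum_mul, mul_assoc]
    rw [this]
    exact trPow_conj_rpow_le h0 h1 hσ hr0 hrA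
  have hX : ∀ ε, rad x ε = B * rad y ε + rad y ε * B := by
    intro ε
    rw [← mul_rad, ← rad_mul, ← rad_add]
    congr 1; funext k; exact hy k
  have e1 : numSigns (Fin N) * trPow σ A ≤ 2 * ∑ ε, χ ε * rtr ((rad y ε)ᴴ * rad x ε) := by
    have h1 := hχ.column_le y hB0
    have h2 := hχ.row_le y hB0
    rw [← rtr_cfc_rpow_mul_self (by linarith) hA0, ← hB]
    conv_lhs => rw [hAs, mul_add, rtr_add]
    have h3 : ∀ ε, rtr ((rad y ε)ᴴ * rad x ε) =
        rtr (B * ((rad y ε)ᴴ * rad y ε)) + rtr (B * (rad y ε * (rad y ε)ᴴ)) := by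
      intro ε
      rw [hX ε, mul_add, rtr_add, ← mul_assoc _ _ B, rtr_mul_comm _ B, rtr_mul_comm (rad y ε)ᴴ,
        mul_assoc B (rad y ε)]
      ring
    simp only [h3, mul_add, Finset.sum_add_distrib]
    linarith
  have e2 : 2 * ∑ ε, χ ε * rtr ((rad y ε)ᴴ * rad x ε) ≤
      c * ∑ ε, trPow σ ((rad y ε)ᴴ * rad y ε) +
      (c + c⁻¹) * ∑ ε, χ ε * trPow s ((rad x ε)ᴴ * rad x ε) := by
    rw [Finset.mul_sum, Finset.mul_sum, Finset.mul_sum, ← Finset.sum_add_distrib]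
    refine Finset.sum_le_sum fun ε _ => ?_
    have h2 := mul_le_mul_of_nonneg_left (rtr_holder h0 h1 hσ hc0 (rad y ε) (rad x ε)) (hχ.nonneg ε)
    have h3 := mul_le_of_le_one_left (mul_nonneg hc0.le
      (trPow_nonneg (conj_mul_self_nonneg (rad y ε)) σ)) (hχ.le_one ε)
    linarith
  have e3 := hD n N y
  have e4 := mul_le_mul_of_nonneg_left e3 hc0.le
  have e5 : trPow σ (∑ k, (y k)ᴴ * y k) + trPow σ (∑ k, y k * (y k)ᴴ) ≤ 2 * trPow σ A := by
    have := trPow_mono (by linarith : 0 < σ) hr0 hrA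
    have := trPow_mono (by linarith : 0 < σ) hc0' hcA
    linarith
  have hN : 0 < numSigns (Fin N) := numSigns_pos
  have e6 : c * (D * numSigns (Fin N) * (trPow σ (∑ k, (y k)ᴴ * y k) +
      trPow σ (∑ k, y k * (y k)ᴴ))) ≤ numSigns (Fin N) * trPow σ A / 2 := by
    have h5 : c * D = 1 / 4 := by rw [hc]; field_simp
    calc _ = (c * D) * numSigns (Fin N) * (trPow σ (∑ k, (y k)ᴴ * y k) +
          trPow σ (∑ k, y k * (y k)ᴴ)) := by ring
      _ ≤ (c * D) * numSigns (Fin N) * (2 * trPow σ A) :=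
          mul_le_mul_of_nonneg_left e5 (by positivity)
      _ = _ := by rw [h5]; ring
  have e7 := mul_le_mul_of_nonneg_left (add_le_add ea eb) hN.le
  linarith

lemma exists_rpow_le_scaled {s r : ℝ} (h0 : 0 < s) (h1 : s < r) {δ : ℝ} (hδ : 0 < δ) :
    ∃ C : ℝ, 0 < C ∧ ∀ τ z : ℝ, 0 < τ → 0 ≤ z → z ^ s ≤ δ * τ ^ s + C * (τ ^ (s - r) * z ^ r) := by
  have hr : 0 < r := h0.trans h1
  obtain ⟨C, hC, H⟩ := exists_young (θ := s / r) (by positivity) ((div_lt_one hr).2 h1) hδ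
  refine ⟨C, hC, fun τ z hτ hz => ?_⟩
  have h2 := H ((z / τ) ^ r) 1 (by positivity) zero_le_one
  rw [Real.one_rpow, mul_one, ← Real.rpow_mul (by positivity), mul_div_cancel₀ _ hr.ne', mul_one,
    Real.div_rpow hz hτ.le, Real.div_rpow hz hτ.le, div_le_iff₀ (by positivity)] at h2
  refine h2.trans (le_of_eq ?_)
  rw [Real.rpow_sub hτ]
  field_simp

lemma exists_rpow_le_div {r : ℝ} (h0 : 0 < r) (h1 : r < 1) {η : ℝ} (hη : 0 < η) :
    ∃ C : ℝ, 0 < C ∧ ∀ τ z : ℝ, 0 < τ → 0 ≤ z →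
      z ^ r ≤ η * τ ^ r + (η * τ ^ (r - 1) * z + C * τ ^ r * (z / (z + τ))) := by
  obtain ⟨C₁, hC₁, H₁⟩ := exists_young h0 h1 hη
  obtain ⟨C₂, hC₂, H₂⟩ := exists_young (θ := 1 - r) (by linarith) (by linarith) hη
  refine ⟨2 * (C₁ + C₂), by positivity, fun τ z hτ hz => ?_⟩
  have key : ∀ u : ℝ, 0 ≤ u → u ^ r ≤ η + (η * u + 2 * (C₁ + C₂) * (u / (u + 1))) := by
    intro u hu
    have e1 := H₁ u 1 hu zero_le_one
    have e2 := H₂ 1 u zero_le_one hu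
    rw [Real.one_rpow, mul_one, mul_one] at e1
    rw [Real.one_rpow, one_mul, mul_one, sub_sub_cancel] at e2
    have h3 : 0 ≤ u / (u + 1) := by positivity
    rcases le_total u 1 with h | h
    · have h4 : u ≤ 2 * (u / (u + 1)) := by
        rw [← mul_div_assoc, le_div_iff₀ (by linarith)]; nlinarith
      nlinarith
    · have h4 : 1 ≤ 2 * (u / (u + 1)) := by
        rw [← mul_div_assoc, le_div_iff₀ (by linarith)]; linarith
      nlinarith
  have h2 := mul_le_mul_of_nonneg_left (key (z / τ) (by positivity)) (Real.rpow_nonneg hτ.le r)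
  have h3 : τ ^ r * (z / τ) ^ r = z ^ r := by
    rw [Real.div_rpow hz hτ.le]; field_simp
  have h4 : z / τ / (z / τ + 1) = z / (z + τ) := by
    have : z + τ ≠ 0 := by positivity
    field_simp
  rw [h3, h4] at h2
  refine h2.trans (le_of_eq ?_)
  rw [Real.rpow_sub_one hτ.ne']
  field_simp

lemma mul_cfc_of_mul_eq {P β : Matrix n n ℂ} (hβ : 0 ≤ β) (hP : P * β = β) {f : ℝ → ℝ}
    (hf : f 0 = 0) : P * cfc f β = cfc f β := by
  have h : cfc f β = β * cfc (fun t => f t / t) β := by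
    rw [self_mul_cfc_mat _ (nonneg_isSelfAdjoint hβ)]
    refine cfc_congr_nonneg hβ fun t ht => ?_
    rcases eq_or_ne t 0 with rfl | h
    · simp [hf]
    · field_simp
  rw [h, ← mul_assoc, hP]

lemma rtr_cfc_le_of_support {P β : Matrix n n ℂ} (hP0 : 0 ≤ P) (hβ : 0 ≤ β) (hP : P * β = β)
    {f h : ℝ → ℝ} (hf : f 0 = 0) (hh : h 0 = 0) {c : ℝ} (H : ∀ t, 0 ≤ t → f t ≤ c + h t) :
    rtr (cfc f β) ≤ c * rtr P + rtr (cfc h β) := by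
  have h1 := rtr_mul_mono_right hP0 (cfc_mono_mat hβ H)
  have h2 : cfc (fun t => c + h t) β = c • (1 : Matrix n n ℂ) + cfc h β := by
    rw [← cfc_add_mat (fun _ => c) h, ← cfc_eq_one (nonneg_isSelfAdjoint hβ), cfc_smul_mat]
    simp
  rw [h2, mul_cfc_of_mul_eq hβ hP hf, mul_add, mul_cfc_of_mul_eq hβ hP hh, rtr_add,
    mul_smul_comm, rtr_smul, mul_one] at h1
  exact h1

lemma trPow_compress_le {r : ℝ} (hr : 0 < r) {M β : Matrix n n ℂ} (hM : Mᴴ * M ≤ 1)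
    (hβ : 0 ≤ β) : trPow r (M * β * Mᴴ) ≤ trPow r β := by
  obtain ⟨S, -, hSs, hS⟩ := exists_sqrt hβ
  have e1 : M * β * Mᴴ = (M * S) * (M * S)ᴴ := by
    rw [conjTranspose_mul, hSs, ← hS]; simp only [mul_assoc]
  rw [e1, ← trPow_conj]
  refine trPow_mono hr (conj_mul_self_nonneg _) ?_
  have e2 := conj_mono hM S
  rw [hSs, mul_one, hS] at e2
  rw [conjTranspose_mul, hSs]
  simpa only [mul_assoc] using e2

lemma proj_nonneg {P : Matrix n n ℂ} (hP : Pᴴ = P) (hPP : P * P = P) : 0 ≤ P := by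
  have := conj_mul_self_nonneg P
  rwa [hP, hPP] at this

lemma proj_le_one {P : Matrix n n ℂ} (hP : Pᴴ = P) (hPP : P * P = P) : P ≤ 1 := by
  have h := proj_nonneg (P := 1 - P) (by simp [hP]) (by simp [sub_mul, mul_sub, hPP])
  exact sub_nonneg.1 h

/-- A family with left support in a projection `P` admits, at each scale `τ`, a decomposition
controlled by the rank of `P` and by a larger exponent. -/
lemma exists_supported_decomposition {s : ℝ} (h0 : 0 < s) (h1 : s ≤ 1 / 2) {δ : ℝ} (hδ : 0 < δ) :
    ∃ C : ℝ, 0 < C ∧ ∀ (n N : ℕ) (χ : (Fin N → Bool) → ℝ), IsHeavy χ → ∀ τ : ℝ, 0 < τ →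
      ∀ P : Matrix (Fin n) (Fin n) ℂ, Pᴴ = P → P * P = P →
      ∀ w : Fin N → Matrix (Fin n) (Fin n) ℂ, (∀ k, P * w k = w k) →
      ∃ c d : Fin N → Matrix (Fin n) (Fin n) ℂ, (∀ k, w k = c k + d k) ∧
      numSigns (Fin N) * (trPow s (∑ k, (c k)ᴴ * c k) + trPow s (∑ k, d k * (d k)ᴴ)) ≤
        δ * (numSigns (Fin N) * (τ ^ s * rtr P)) +
        C * (τ ^ (s - 2 / 3) * ∑ ε, χ ε * trPow (2 / 3) ((rad w ε)ᴴ * rad w ε)) := by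
  obtain ⟨C₀, hC₀, H₀⟩ := exists_lower_khintchine_mid (s := 2 / 3) (by norm_num) (by norm_num)
  obtain ⟨C₁, hC₁, H₁⟩ := exists_rpow_le_scaled (r := 2 / 3) h0 (by linarith) (half_pos hδ)
  obtain ⟨C₂, hC₂, H₂⟩ := exists_rpow_le_scaled (r := 1) h0 (by linarith) (half_pos hδ)
  refine ⟨(1 + C₁ + C₂) * C₀, by positivity, fun n N χ hχ τ hτ P hP hPP w hw => ?_⟩
  have hP0 := proj_nonneg hP hPP
  have hP1 := proj_le_one hP hPP
  obtain ⟨a', b', hab, hK⟩ := H₀ n N χ hχ w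
  set V := ∑ ε, χ ε * trPow (2 / 3) ((rad w ε)ᴴ * rad w ε)
  set a := fun k => P * a' k with ha
  set b := fun k => P * b' k with hb
  have hPa : ∀ k, P * a k = a k := fun k => by simp only [ha, ← mul_assoc, hPP]
  have hPb : ∀ k, P * b k = b k := fun k => by simp only [hb, ← mul_assoc, hPP]
  have hwab : ∀ k, w k = a k + b k := fun k => by rw [← hw k, hab k, mul_add]
  set γ := ∑ k, (a k)ᴴ * a k with hγ
  set β := ∑ k, b k * (b k)ᴴ with hβ
  have hγ0 : 0 ≤ γ := Finset.sum_nonneg fun k _ => conj_mul_self_nonneg _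
  have hβ0 : 0 ≤ β := Finset.sum_nonneg fun k _ => self_mul_conj_nonneg _
  have hγs := nonneg_isSelfAdjoint hγ0
  have eγ : trPow (2 / 3) γ ≤ trPow (2 / 3) (∑ k, (a' k)ᴴ * a' k) := by
    refine trPow_mono (by norm_num) hγ0 (Finset.sum_le_sum fun k _ => ?_)
    have := conj_mono hP1 (a' k)
    rw [mul_one] at this
    rw [ha, conjTranspose_mul, hP, mul_assoc, ← mul_assoc P, hPP, ← mul_assoc]
    exact this
  have eβ : trPow (2 / 3) β ≤ trPow (2 / 3) (∑ k, b' k * (b' k)ᴴ) := by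
    have e : β = P * (∑ k, b' k * (b' k)ᴴ) * Pᴴ := by
      simp only [hβ, hb, conjTranspose_mul, Finset.mul_sum, Finset.sum_mul, mul_assoc]
    rw [e]
    exact trPow_compress_le (by norm_num) (by rw [hP, hPP]; exact hP1)
      (Finset.sum_nonneg fun k _ => self_mul_conj_nonneg _)
  set E := cfc (fun t : ℝ => if t ≤ τ then (1 : ℝ) else 0) γ with hE
  set F := cfc (fun t : ℝ => if t ≤ τ then (0 : ℝ) else 1) γ with hF
  have hEs : Eᴴ = E := cfc_isSelfAdjoint _ _
  have hFs : Fᴴ = F := cfc_isSelfAdjoint _ _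
  have hEF : F + E = 1 := by
    rw [hE, hF, cfc_add_mat, ← cfc_eq_one hγs]
    congr 1; funext t; split_ifs <;> simp
  refine ⟨fun k => a k * F, fun k => a k * E + b k, fun k => ?_, ?_⟩
  · rw [← add_assoc, ← mul_add, hEF, mul_one, hwab]
  have e1 : trPow s (∑ k, (a k * F)ᴴ * (a k * F)) ≤ τ ^ (s - 2 / 3) * trPow (2 / 3) γ := by
    have e : ∑ k, (a k * F)ᴴ * (a k * F) = F * γ * F := by
      simp only [hγ, conjTranspose_mul, hFs, Finset.mul_sum, Finset.sum_mul, mul_assoc]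
    rw [e, hF, cfc_mul_self_mat _ hγs, cfc_mul_mat, trPow, cfc_comp_mat _ _ hγs, trPow, ← rtr_smul,
      cfc_smul_mat]
    refine rtr_mono (cfc_mono_mat hγ0 fun t ht => ?_)
    split_ifs with h
    · rw [zero_mul, zero_mul, Real.zero_rpow h0.ne']; positivity
    · have ht' : 0 < t := hτ.trans (not_le.1 h)
      rw [one_mul, mul_one]
      calc t ^ s = t ^ (s - 2 / 3) * t ^ (2 / 3 : ℝ) := by rw [← Real.rpow_add ht']; ring_nf
        _ ≤ _ := mul_le_mul_of_nonneg_right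
          (Real.rpow_le_rpow_of_nonpos hτ (not_le.1 h).le (by linarith)) (by positivity)
  have e2 : trPow s β ≤ δ / 2 * τ ^ s * rtr P + C₁ * (τ ^ (s - 2 / 3) * trPow (2 / 3) β) := by
    have hPβ : P * β = β := by
      simp only [hβ, Finset.mul_sum, ← mul_assoc, hPb]
    have := rtr_cfc_le_of_support hP0 hβ0 hPβ (c := δ / 2 * τ ^ s) (f := fun t => t ^ s)
      (h := fun t => C₁ * τ ^ (s - 2 / 3) * t ^ (2 / 3 : ℝ)) (Real.zero_rpow h0.ne')
      (by simp only [Real.zero_rpow (by norm_num : (2 / 3 : ℝ) ≠ 0), mul_zero])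
      (fun t ht => (H₁ τ t hτ ht).trans_eq (by ring))
    rw [← cfc_smul_mat, rtr_smul] at this
    exact this.trans_eq (by rw [trPow]; ring)
  set β' := ∑ k, (a k * E) * (a k * E)ᴴ with hβ'
  have hβ'0 : 0 ≤ β' := Finset.sum_nonneg fun k _ => self_mul_conj_nonneg _
  have e3 : rtr β' ≤ τ ^ (1 - 2 / 3 : ℝ) * trPow (2 / 3) γ := by
    have e : rtr β' = rtr (E * γ * E) := by
      simp only [hβ', hγ, Finset.mul_sum, Finset.sum_mul, rtr_sum]
      refine Finset.sum_congr rfl fun k _ => ?_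
      rw [rtr_mul_comm, conjTranspose_mul, hEs]; simp only [mul_assoc]
    rw [e, hE, cfc_mul_self_mat _ hγs, cfc_mul_mat, trPow, ← rtr_smul, cfc_smul_mat]
    refine rtr_mono (cfc_mono_mat hγ0 fun t ht => ?_)
    split_ifs with h
    · rcases ht.eq_or_lt with rfl | ht'
      · simp
      rw [one_mul, mul_one]
      calc t = t ^ (1 - 2 / 3 : ℝ) * t ^ (2 / 3 : ℝ) := by
            rw [← Real.rpow_add ht']; norm_num
        _ ≤ _ := mul_le_mul_of_nonneg_right
          (Real.rpow_le_rpow ht h (by norm_num)) (by positivity)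
    · rw [zero_mul, zero_mul]; positivity
  have e4 : trPow s β' ≤ δ / 2 * τ ^ s * rtr P + C₂ * (τ ^ (s - 2 / 3) * trPow (2 / 3) γ) := by
    have hPβ : P * β' = β' := by
      simp only [hβ', Finset.mul_sum, ← mul_assoc, hPa]
    have := rtr_cfc_le_of_support hP0 hβ'0 hPβ (c := δ / 2 * τ ^ s) (f := fun t => t ^ s)
      (h := fun t => C₂ * τ ^ (s - 1) * t) (Real.zero_rpow h0.ne') (mul_zero _)
      (fun t ht => (H₂ τ t hτ ht).trans_eq (by rw [Real.rpow_one]; ring))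
    rw [← cfc_smul_mat, rtr_smul, cfc_eq_self (nonneg_isSelfAdjoint hβ'0)] at this
    have e5 := mul_le_mul_of_nonneg_left e3 (by positivity : 0 ≤ C₂ * τ ^ (s - 1))
    refine (this.trans (add_le_add_right e5 _)).trans_eq ?_
    have e6 : τ ^ (s - 2 / 3) = τ ^ (s - 1) * τ ^ (1 - 2 / 3 : ℝ) := by
      rw [← Real.rpow_add hτ]; ring_nf
    rw [e6]; ring
  have e5 : trPow s (∑ k, (a k * E + b k) * (a k * E + b k)ᴴ) ≤ trPow s β' + trPow s β := by
    have := trPow_sum_mul_conj_le h0 h1 fun (l : Bool) k => if l then a k * E else b k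
    simpa only [Fintype.sum_bool, if_true, Bool.false_eq_true, if_false] using this
  have hA : 0 < τ ^ (s - 2 / 3) := Real.rpow_pos_of_pos hτ _
  have hN := numSigns_pos (ι := Fin N)
  have hγV : trPow (2 / 3) γ + trPow (2 / 3) β ≤ C₀ * V / numSigns (Fin N) := by
    rw [le_div_iff₀ hN, mul_comm]
    exact (mul_le_mul_of_nonneg_left (add_le_add eγ eβ) hN.le).trans hK
  have h0γ := trPow_nonneg hγ0 (2 / 3)
  have h0β := trPow_nonneg hβ0 (2 / 3)
  have e6 : trPow (2 / 3) γ + C₁ * trPow (2 / 3) β + C₂ * trPow (2 / 3) γ ≤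
      (1 + C₁ + C₂) * (C₀ * V / numSigns (Fin N)) := by
    refine le_trans ?_ (mul_le_mul_of_nonneg_left hγV (by positivity))
    nlinarith [mul_nonneg hC₁.le h0γ, mul_nonneg hC₂.le h0β]
  have e7 := mul_le_mul_of_nonneg_left e6 hA.le
  have e8 : trPow s (∑ k, (a k * F)ᴴ * (a k * F)) +
      trPow s (∑ k, (a k * E + b k) * (a k * E + b k)ᴴ) ≤
      δ * (τ ^ s * rtr P) +
        τ ^ (s - 2 / 3) * ((1 + C₁ + C₂) * (C₀ * V / numSigns (Fin N))) := by
    linarith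
  refine (mul_le_mul_of_nonneg_left e8 hN.le).trans_eq ?_
  field_simp

lemma hs_conjTranspose (V : Matrix n n ℂ) : hs Vᴴ = hs V := by
  rw [hs, hs, conjTranspose_conjTranspose, rtr_mul_comm]

lemma hs_add_le (U V : Matrix n n ℂ) : hs (U + V) ≤ 2 * (hs U + hs V) := by
  have h1 := hs_add_smul U V 1
  have h2 := hs_add_smul U V (-1)
  rw [one_smul] at h1
  have h3 := hs_nonneg (U + (-1 : ℝ) • V)
  nlinarith

lemma hs_proj_mul_le {P : Matrix n n ℂ} (hP : Pᴴ = P) (hPP : P * P = P) (Y : Matrix n n ℂ) :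
    hs (P * Y) ≤ hs Y := by
  have h := rtr_mono (conj_mono (proj_le_one hP hPP) Y)
  rw [mul_one] at h
  rw [hs, conjTranspose_mul, hP, mul_assoc, ← mul_assoc P, hPP, ← mul_assoc]
  exact h

lemma hs_mul_proj_le {P : Matrix n n ℂ} (hP : Pᴴ = P) (hPP : P * P = P) (Y : Matrix n n ℂ) :
    hs (Y * P) ≤ hs Y := by
  have h := hs_proj_mul_le hP hPP Yᴴ
  rwa [hs_conjTranspose, ← hs_conjTranspose, conjTranspose_mul, conjTranspose_conjTranspose,
    hP] at h

lemma cfc_indicator_mul_self (S : Set ℝ) [DecidablePred (· ∈ S)] (A : Matrix n n ℂ) :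
    cfc (fun t : ℝ => if t ∈ S then (1 : ℝ) else 0) A *
      cfc (fun t : ℝ => if t ∈ S then (1 : ℝ) else 0) A =
      cfc (fun t : ℝ => if t ∈ S then (1 : ℝ) else 0) A := by
  rw [cfc_mul_mat]
  congr 1; funext t; split_ifs <;> simp

lemma rtr_cfc_div_compress_le {P Q : Matrix n n ℂ} (hP : Pᴴ = P) (hPP : P * P = P) (hQ : Qᴴ = Q)
    (hQQ : Q * Q = Q) {τ : ℝ} (hτ : 0 < τ) (X : Matrix n n ℂ) :
    rtr (cfc (fun t : ℝ => t / (t + τ)) ((P * X * Q) * (P * X * Q)ᴴ)) ≤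
      rtr (cfc (fun t : ℝ => t / (t + τ)) (Xᴴ * X)) := by
  have h1 : (P * X * Q) * (P * X * Q)ᴴ ≤ (P * X) * (P * X)ᴴ := by
    have h := conj_mono' (proj_le_one hQ hQQ) (P * X)
    rw [mul_one] at h
    rw [conjTranspose_mul (P * X), hQ, mul_assoc (P * X), ← mul_assoc Q, hQQ, ← mul_assoc]
    exact h
  have h2 : (P * X)ᴴ * (P * X) ≤ Xᴴ * X := by
    have h := conj_mono (proj_le_one hP hPP) X
    rw [mul_one] at h
    rw [conjTranspose_mul, hP, mul_assoc, ← mul_assoc P, hPP, ← mul_assoc]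
    exact h
  refine (rtr_cfc_div_mono hτ (self_mul_conj_nonneg _) h1).trans ?_
  rw [← rtr_cfc_conj]
  exact rtr_cfc_div_mono hτ (conj_mul_self_nonneg _) h2

lemma exists_trPow_rad_compress_le {r : ℝ} (h0 : 0 < r) (h1 : r < 1) {η : ℝ} (hη : 0 < η) :
    ∃ C : ℝ, 0 < C ∧ ∀ (n N : ℕ) (χ : (Fin N → Bool) → ℝ), IsHeavy χ → ∀ τ : ℝ, 0 < τ →
      ∀ P Q : Matrix (Fin n) (Fin n) ℂ, Pᴴ = P → P * P = P → Qᴴ = Q → Q * Q = Q →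
      ∀ x : Fin N → Matrix (Fin n) (Fin n) ℂ,
      ∑ ε, χ ε * trPow r ((rad (fun k => P * x k * Q) ε)ᴴ * rad (fun k => P * x k * Q) ε) ≤
        numSigns (Fin N) * (η * τ ^ r * rtr P + η * τ ^ (r - 1) * ∑ k, hs (P * x k * Q)) +
        C * (τ ^ r * ∑ ε, χ ε * rtr (cfc (fun t : ℝ => t / (t + τ)) ((rad x ε)ᴴ * rad x ε))) := by
  obtain ⟨C, hC, H⟩ := exists_rpow_le_div h0 h1 hη
  refine ⟨C, hC, fun n N χ hχ τ hτ P Q hP hPP hQ hQQ x => ?_⟩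
  have hP0 := proj_nonneg hP hPP
  set w := fun k => P * x k * Q with hw
  have hrw : ∀ ε, rad w ε = P * rad x ε * Q := fun ε => by rw [hw, rad_mul, mul_rad]
  have hη1 : 0 < η * τ ^ r := by positivity
  have hη2 : 0 < η * τ ^ (r - 1) := by positivity
  have hC2 : 0 < C * τ ^ r := by positivity
  have key : ∀ ε, χ ε * trPow r ((rad w ε)ᴴ * rad w ε) ≤
      (η * τ ^ r * rtr P + η * τ ^ (r - 1) * hs (rad w ε)) +
      C * (τ ^ r * (χ ε * rtr (cfc (fun t : ℝ => t / (t + τ)) ((rad x ε)ᴴ * rad x ε)))) := by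
    intro ε
    have hZ0 := self_mul_conj_nonneg (rad w ε)
    have hPZ : P * (rad w ε * (rad w ε)ᴴ) = rad w ε * (rad w ε)ᴴ := by
      rw [hrw]; simp only [← mul_assoc, hPP]
    have e1 := rtr_cfc_le_of_support hP0 hZ0 hPZ (c := η * τ ^ r) (f := fun t => t ^ r)
      (h := fun t => η * τ ^ (r - 1) * t + C * τ ^ r * (t / (t + τ))) (Real.zero_rpow h0.ne')
      (by simp) (fun t ht => H τ t hτ ht)
    rw [← cfc_add_mat (fun t => η * τ ^ (r - 1) * t), ← cfc_smul_mat (η * τ ^ (r - 1)) (fun t => t),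
      ← cfc_smul_mat (C * τ ^ r), rtr_add, rtr_smul, rtr_smul,
      cfc_eq_self (nonneg_isSelfAdjoint hZ0), rtr_mul_comm (rad w ε)] at e1
    change trPow r _ ≤ _ + (_ * hs _ + _) at e1
    rw [trPow_conj]
    have e2 := rtr_cfc_div_compress_le hP hPP hQ hQQ hτ (rad x ε)
    rw [← hrw] at e2
    have e3 := e1.trans (add_le_add_right (add_le_add_right
      (mul_le_mul_of_nonneg_left e2 hC2.le) _) _)
    refine (mul_le_mul_of_nonneg_left e3 (hχ.nonneg ε)).trans ?_
    have e4 := mul_le_of_le_one_left (add_nonneg (mul_nonneg hη1.le (rtr_nonneg hP0))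
      (mul_nonneg hη2.le (hs_nonneg (rad w ε)))) (hχ.le_one ε)
    linarith
  refine (Finset.sum_le_sum fun ε _ => key ε).trans_eq ?_
  rw [Finset.sum_add_distrib, Finset.sum_add_distrib, Finset.sum_const, ← Finset.mul_sum,
    ← Finset.mul_sum, ← Finset.mul_sum, sum_hs_rad, Finset.card_univ, nsmul_eq_mul, numSigns]
  simp only [hw]
  ring

/-- A spectral piece of `x = a + b` at scale `τ` admits a decomposition that improves on `a, b`
up to an error controlled by the signed sums. -/
lemma exists_piece_decomposition {s : ℝ} (h0 : 0 < s) (h1 : s ≤ 1 / 2) {η : ℝ} (hη : 0 < η) :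
    ∃ C : ℝ, 0 < C ∧ ∀ (n N : ℕ) (χ : (Fin N → Bool) → ℝ), IsHeavy χ → ∀ τ σ : ℝ, 0 < τ →
      σ ≤ 4 * τ → ∀ x a b : Fin N → Matrix (Fin n) (Fin n) ℂ, (∀ k, x k = a k + b k) →
      ∃ c d : Fin N → Matrix (Fin n) (Fin n) ℂ,
      (∀ k, cfc (fun t : ℝ => if t ∈ Set.Ioc τ (4 * τ) then (1 : ℝ) else 0)
        (∑ k, b k * (b k)ᴴ) * x k *
        cfc (fun t : ℝ => if t ∈ Set.Iic σ then (1 : ℝ) else 0) (∑ k, (a k)ᴴ * a k) =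
        c k + d k) ∧
      numSigns (Fin N) * (trPow s (∑ k, (c k)ᴴ * c k) + trPow s (∑ k, d k * (d k)ᴴ)) ≤
        η * (numSigns (Fin N) * (τ ^ s * rtr (cfc (fun t : ℝ => t / (t + τ)) (∑ k, (a k)ᴴ * a k)) +
          τ ^ s * rtr (cfc (fun t : ℝ => t / (t + τ)) (∑ k, b k * (b k)ᴴ)))) +
        C * (τ ^ s * ∑ ε, χ ε * rtr (cfc (fun t : ℝ => t / (t + τ)) ((rad x ε)ᴴ * rad x ε))) := by
  obtain ⟨C₁, hC₁, H₁⟩ := exists_supported_decomposition h0 h1 (δ := η / 4) (by positivity)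
  obtain ⟨C₂, hC₂, H₂⟩ := exists_trPow_rad_compress_le (r := 2 / 3) (η := η / (24 * C₁))
    (by norm_num) (by norm_num) (by positivity)
  refine ⟨C₁ * C₂, by positivity, fun n N χ hχ τ σ hτ hσ x a b hx => ?_⟩
  set α := ∑ k, b k * (b k)ᴴ with hα
  set γ := ∑ k, (a k)ᴴ * a k with hγ
  have hγ0 : 0 ≤ γ := Finset.sum_nonneg fun k _ => conj_mul_self_nonneg _
  have hα0 : 0 ≤ α := Finset.sum_nonneg fun k _ => self_mul_conj_nonneg _
  set P := cfc (fun t : ℝ => if t ∈ Set.Ioc τ (4 * τ) then (1 : ℝ) else 0) α with hPdef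
  set Q := cfc (fun t : ℝ => if t ∈ Set.Iic σ then (1 : ℝ) else 0) γ with hQdef
  have hP : Pᴴ = P := cfc_isSelfAdjoint _ _
  have hQ : Qᴴ = Q := cfc_isSelfAdjoint _ _
  have hPP : P * P = P := cfc_indicator_mul_self _ _
  have hQQ : Q * Q = Q := cfc_indicator_mul_self _ _
  obtain ⟨c, d, hcd, hle⟩ := H₁ n N χ hχ τ hτ P hP hPP (fun k => P * x k * Q)
    (fun k => by simp only [← mul_assoc, hPP])
  refine ⟨c, d, hcd, hle.trans ?_⟩
  have hV := H₂ n N χ hχ τ hτ P Q hP hPP hQ hQQ x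
  set R := ∑ ε, χ ε * rtr (cfc (fun t : ℝ => t / (t + τ)) ((rad x ε)ᴴ * rad x ε))
  set V := ∑ ε, χ ε * trPow (2 / 3) ((rad (fun k => P * x k * Q) ε)ᴴ *
    rad (fun k => P * x k * Q) ε)
  set Φα := rtr (cfc (fun t : ℝ => t / (t + τ)) α) with hΦα
  set Φγ := rtr (cfc (fun t : ℝ => t / (t + τ)) γ) with hΦγ
  have hPr : rtr P ≤ 2 * Φα := by
    rw [hΦα, ← rtr_smul, cfc_smul_mat]
    refine rtr_mono (cfc_mono_mat hα0 fun t ht => ?_)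
    split_ifs with h
    · rw [← mul_div_assoc, le_div_iff₀ (by positivity)]; linarith [h.1]
    · positivity
  have bound : ∀ t : ℝ, 0 ≤ t → t ≤ 4 * τ → t ≤ 5 * τ * (t / (t + τ)) := fun t ht h => by
    rw [← mul_div_assoc, le_div_iff₀ (by positivity)]; nlinarith
  have hPα : ∑ k, hs (P * b k) ≤ 5 * τ * Φα := by
    have e : ∑ k, hs (P * b k) = rtr (P * α) := by
      simp only [hs_mul, hP, hPP, hα, Finset.mul_sum, rtr_sum]
    rw [e, hPdef, cfc_mul_self_mat _ (nonneg_isSelfAdjoint hα0), hΦα, ← rtr_smul, cfc_smul_mat]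
    refine rtr_mono (cfc_mono_mat hα0 fun t ht => ?_)
    split_ifs with h
    · rw [one_mul]; exact bound t ht h.2
    · rw [zero_mul]; positivity
  have hQγ : ∑ k, hs (a k * Q) ≤ 5 * τ * Φγ := by
    have e : ∑ k, hs (a k * Q) = rtr (Q * γ) := by
      rw [hγ, Finset.mul_sum, rtr_sum]
      refine Finset.sum_congr rfl fun k _ => ?_
      rw [← hs_conjTranspose, conjTranspose_mul, hs_mul, hQ, hQ, hQQ, conjTranspose_conjTranspose]
    rw [e, hQdef, cfc_mul_self_mat _ (nonneg_isSelfAdjoint hγ0), hΦγ, ← rtr_smul, cfc_smul_mat]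
    refine rtr_mono (cfc_mono_mat hγ0 fun t ht => ?_)
    split_ifs with h
    · rw [one_mul]; exact bound t ht (h.trans hσ)
    · rw [zero_mul]; positivity
  have hsum : ∑ k, hs (P * x k * Q) ≤ 10 * τ * (Φα + Φγ) := by
    have e : ∑ k, hs (P * x k * Q) ≤ ∑ k, 2 * (hs (a k * Q) + hs (P * b k)) := by
      refine Finset.sum_le_sum fun k _ => ?_
      rw [hx, mul_add, add_mul, mul_assoc P (a k)]
      exact (hs_add_le _ _).trans (mul_le_mul_of_nonneg_left
        (add_le_add (hs_proj_mul_le hP hPP _) (hs_mul_proj_le hQ hQQ _)) zero_le_two)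
    rw [← Finset.mul_sum, Finset.sum_add_distrib] at e
    linarith
  have hN := numSigns_pos (ι := Fin N)
  have hA : 0 < τ ^ (s - 2 / 3) := Real.rpow_pos_of_pos hτ _
  have e1 : τ ^ (s - 2 / 3) * τ ^ (2 / 3 : ℝ) = τ ^ s := by
    rw [← Real.rpow_add hτ]; ring_nf
  have e2 : τ ^ (s - 2 / 3) * τ ^ (2 / 3 - 1 : ℝ) * τ = τ ^ s := by
    rw [← Real.rpow_add hτ, ← Real.rpow_add_one hτ.ne']; ring_nf
  have hΦγ0 : 0 ≤ Φγ := rtr_nonneg (cfc_nonneg_mat hγ0 fun t ht => by positivity)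
  have hs0 : 0 < τ ^ s := Real.rpow_pos_of_pos hτ _
  have e3 : C₁ * (τ ^ (s - 2 / 3) * V) ≤
      numSigns (Fin N) * (η / 24 * τ ^ s * rtr P + 10 * (η / 24) * τ ^ s * (Φα + Φγ)) +
      C₁ * C₂ * (τ ^ s * R) := by
    have f1 := mul_le_mul_of_nonneg_left hsum
      (by positivity : 0 ≤ η / (24 * C₁) * τ ^ (2 / 3 - 1 : ℝ))
    have f2 := mul_le_mul_of_nonneg_left (add_le_add_right f1
      (η / (24 * C₁) * τ ^ (2 / 3 : ℝ) * rtr P)) hN.le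
    have f3 := mul_le_mul_of_nonneg_left (hV.trans (add_le_add_left f2 _))
      (by positivity : 0 ≤ C₁ * τ ^ (s - 2 / 3))
    rw [← mul_assoc]
    refine f3.trans_eq ?_
    have hc : C₁ * (η / (24 * C₁)) = η / 24 := by field_simp
    linear_combination (numSigns (Fin N) * (τ ^ (s - 2 / 3) * τ ^ (2 / 3 : ℝ) * rtr P +
      τ ^ (s - 2 / 3) * τ ^ (2 / 3 - 1 : ℝ) * (10 * τ * (Φα + Φγ)))) * hc +
      (numSigns (Fin N) * (η / 24) * rtr P + C₁ * C₂ * R) * e1 +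
      (numSigns (Fin N) * (η / 24) * 10 * (Φα + Φγ)) * e2
  have e4 := mul_le_mul_of_nonneg_left hPr hs0.le
  have e5 : 0 ≤ τ ^ s * Φγ := by positivity
  have e6 : η / 4 * (τ ^ s * rtr P) +
      (η / 24 * τ ^ s * rtr P + 10 * (η / 24) * τ ^ s * (Φα + Φγ)) ≤
      η * (τ ^ s * Φγ + τ ^ s * Φα) := by
    nlinarith [mul_le_mul_of_nonneg_left e4 hη.le, mul_nonneg hη.le e5]
  have e7 := mul_le_mul_of_nonneg_left e6 hN.le
  linarith

/-- A bounded increasing function whose increments over `[v, 4 v]` dominate `v ^ s / (1 + v)`. -/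
noncomputable def dyadicPotential (s v : ℝ) : ℝ := min v 1 ^ s + (1 - max v 1 ^ (s - 1))

lemma dyadicPotential_mem {s : ℝ} (h0 : 0 < s) (h1 : s < 1) {v : ℝ} (hv : 0 < v) :
    0 ≤ dyadicPotential s v ∧ dyadicPotential s v ≤ 2 := by
  have e1 : 0 ≤ min v 1 ^ s := by positivity
  have e2 : min v 1 ^ s ≤ 1 := Real.rpow_le_one (by positivity) (min_le_right _ _) h0.le
  have e3 : 0 ≤ max v 1 ^ (s - 1) := by positivity
  have e4 : max v 1 ^ (s - 1) ≤ 1 :=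
    Real.rpow_le_one_of_one_le_of_nonpos (le_max_right _ _) (by linarith)
  unfold dyadicPotential
  constructor <;> linarith

lemma exists_dyadicPotential_sub_ge {s : ℝ} (h0 : 0 < s) (h1 : s < 1) : ∃ c : ℝ, 0 < c ∧
    ∀ v : ℝ, 0 < v → c * (v ^ s / (1 + v)) ≤ dyadicPotential s (4 * v) - dyadicPotential s v := by
  have h2 : (1 : ℝ) < 2 ^ s := Real.one_lt_rpow one_lt_two h0
  have h3 : (4 : ℝ) ^ (s - 1) < 2 ^ (s - 1) :=
    Real.rpow_lt_rpow_of_neg two_pos (by norm_num) (by linarith)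
  refine ⟨min (2 ^ s - 1) (2 ^ (s - 1) - 4 ^ (s - 1)), lt_min (by linarith) (by linarith),
    fun v hv => ?_⟩
  have m1 : min v 1 ^ s ≤ min (4 * v) 1 ^ s :=
    Real.rpow_le_rpow (by positivity) (min_le_min_right _ (by linarith)) h0.le
  have m2 : max (4 * v) 1 ^ (s - 1) ≤ max v 1 ^ (s - 1) :=
    Real.rpow_le_rpow_of_nonpos (by positivity) (max_le_max_right _ (by linarith)) (by linarith)
  have hvs : 0 < v ^ s := by positivity
  unfold dyadicPotential
  rcases le_total v (1 / 2) with h | h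
  · have e1 : (2 * v) ^ s ≤ min (4 * v) 1 ^ s :=
      Real.rpow_le_rpow (by positivity) (le_min (by linarith) (by linarith)) h0.le
    have e2 : min v 1 = v := min_eq_left (by linarith)
    have e3 : v ^ s / (1 + v) ≤ v ^ s := div_le_self hvs.le (by linarith)
    have e4 := mul_le_mul (min_le_left (2 ^ s - 1 : ℝ) (2 ^ (s - 1) - 4 ^ (s - 1))) e3
      (by positivity) (by linarith)
    rw [Real.mul_rpow two_pos.le hv.le] at e1
    rw [e2] at m1 ⊢
    linarith
  · have e1 : (2 * v) ^ (s - 1) ≤ max v 1 ^ (s - 1) :=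
      Real.rpow_le_rpow_of_nonpos (by positivity) (max_le (by linarith) (by linarith)) (by linarith)
    have e2 : max (4 * v) 1 = 4 * v := max_eq_left (by linarith)
    have e3 : v ^ s / (1 + v) ≤ v ^ (s - 1) := by
      rw [Real.rpow_sub_one hv.ne']
      exact div_le_div_of_nonneg_left hvs.le hv (by linarith)
    have e4 := mul_le_mul (min_le_right (2 ^ s - 1 : ℝ) (2 ^ (s - 1) - 4 ^ (s - 1))) e3
      (by positivity) (by linarith)
    rw [Real.mul_rpow two_pos.le hv.le] at e1
    rw [e2, Real.mul_rpow four_pos.le hv.le] at m2 ⊢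
    linarith

lemma exists_sum_scales_le {s : ℝ} (h0 : 0 < s) (h1 : s < 1) : ∃ C : ℝ, 0 < C ∧
    ∀ (L : ℕ) (τ u : ℝ), 0 < τ → 0 ≤ u →
      ∑ l ∈ Finset.range L, (τ * 4 ^ l) ^ s * (u / (u + τ * 4 ^ l)) ≤ C * u ^ s := by
  obtain ⟨c, hc, H⟩ := exists_dyadicPotential_sub_ge h0 h1
  refine ⟨2 / c, by positivity, fun L τ u hτ hu => ?_⟩
  rcases hu.eq_or_lt with rfl | hu
  · simp [Real.zero_rpow h0.ne']
  have key : ∀ l ∈ Finset.range L, (τ * 4 ^ l) ^ s * (u / (u + τ * 4 ^ l)) ≤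
      u ^ s / c * (dyadicPotential s (τ * 4 ^ (l + 1) / u) - dyadicPotential s (τ * 4 ^ l / u)) := by
    intro l _
    have hv : 0 < τ * 4 ^ l / u := by positivity
    have e1 := mul_le_mul_of_nonneg_left (H _ hv) (by positivity : 0 ≤ u ^ s / c)
    have e2 : 4 * (τ * 4 ^ l / u) = τ * 4 ^ (l + 1) / u := by ring
    rw [e2] at e1
    refine le_trans (le_of_eq ?_) e1
    rw [Real.div_rpow (by positivity) hu.le]
    field_simp
  refine (Finset.sum_le_sum key).trans ?_
  rw [← Finset.mul_sum, Finset.sum_range_sub (fun l => dyadicPotential s (τ * 4 ^ l / u))]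
  have e1 := (dyadicPotential_mem h0 h1 (by positivity : 0 < τ * 4 ^ L / u)).2
  have e2 := (dyadicPotential_mem h0 h1 (by positivity : 0 < τ * 4 ^ 0 / u)).1
  calc _ ≤ u ^ s / c * 2 := mul_le_mul_of_nonneg_left (by linarith) (by positivity)
    _ = _ := by ring

lemma exists_sum_rtr_scales_le {s : ℝ} (h0 : 0 < s) (h1 : s < 1) : ∃ C : ℝ, 0 < C ∧
    ∀ (n L : ℕ) (τ : ℝ) (A : Matrix (Fin n) (Fin n) ℂ), 0 < τ → 0 ≤ A →
      ∑ l : Fin L, (τ * 4 ^ (l : ℕ)) ^ s *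
        rtr (cfc (fun t : ℝ => t / (t + τ * 4 ^ (l : ℕ))) A) ≤ C * trPow s A := by
  obtain ⟨C, hC, H⟩ := exists_sum_scales_le h0 h1
  refine ⟨C, hC, fun n L τ A hτ hA => ?_⟩
  rw [Fin.sum_univ_eq_sum_range
    (fun l => (τ * 4 ^ l) ^ s * rtr (cfc (fun t : ℝ => t / (t + τ * 4 ^ l)) A))]
  simp only [← rtr_smul, cfc_smul_mat, ← rtr_sum, cfc_sum_mat, trPow]
  exact rtr_mono (cfc_mono_mat hA fun t ht => H L τ t hτ ht)

lemma exists_scale (A B : Matrix n n ℂ) (hA : 0 ≤ A) (hB : 0 ≤ B) :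
    ∃ τ : ℝ, 0 < τ ∧ ∃ L : ℕ, 0 < L ∧ ∀ M, (M = A ∨ M = B) →
      (cfc (fun t : ℝ => if t ∈ Set.Iic τ then (1 : ℝ) else 0) M * M = 0 ∧
        cfc (fun t : ℝ => if t ∈ Set.Iic (τ * 4 ^ L) then (1 : ℝ) else 0) M = 1) := by
  have hfin : (spectrum ℝ A ∪ spectrum ℝ B).Finite :=
    (Matrix.finite_real_spectrum (A := A)).union (Matrix.finite_real_spectrum (A := B))
  have h1 : ∀ᶠ τ : ℝ in nhdsWithin 0 (Set.Ioi 0),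
      ∀ t ∈ spectrum ℝ A ∪ spectrum ℝ B, t ≤ τ → t ≤ 0 := by
    rw [Filter.eventually_all_finite hfin]
    intro t _
    rcases le_or_gt t 0 with h | h
    · exact Filter.Eventually.of_forall fun _ _ => h
    · filter_upwards [Filter.Eventually.filter_mono nhdsWithin_le_nhds (eventually_lt_nhds h)]
        with τ hτ h'
      exact absurd h' (not_le.2 hτ)
  obtain ⟨τ, hτ, hτ0⟩ := (h1.and self_mem_nhdsWithin).exists
  have hτ0 : 0 < τ := hτ0
  have h2 : ∀ᶠ L : ℕ in Filter.atTop, ∀ t ∈ spectrum ℝ A ∪ spectrum ℝ B, t ≤ τ * 4 ^ L := by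
    rw [Filter.eventually_all_finite hfin]
    intro t _
    exact (Filter.Tendsto.const_mul_atTop hτ0
      (tendsto_pow_atTop_atTop_of_one_lt (by norm_num : (1 : ℝ) < 4))).eventually_ge_atTop t
  obtain ⟨L, hL, hL0⟩ := (h2.and (Filter.eventually_gt_atTop 0)).exists
  refine ⟨τ, hτ0, L, hL0, fun M hM => ?_⟩
  have hM0 : 0 ≤ M := by rcases hM with rfl | rfl <;> assumption
  have hsub : ∀ t ∈ spectrum ℝ M, t ∈ spectrum ℝ A ∪ spectrum ℝ B := by
    rcases hM with rfl | rfl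
    · exact fun t ht => Or.inl ht
    · exact fun t ht => Or.inr ht
  have hMs := nonneg_isSelfAdjoint hM0
  constructor
  · rw [cfc_mul_self_mat _ hMs, ← cfc_zero ℝ M]
    refine cfc_congr fun t ht => ?_
    have := spectrum_nonneg' hM0 ht
    simp only [Pi.zero_apply]
    split_ifs with h
    · rw [one_mul]; exact le_antisymm (hτ t (hsub t ht) h) this
    · rw [zero_mul]
  · rw [← cfc_eq_one hMs]
    exact cfc_congr fun t ht => if_pos (hL t (hsub t ht))

lemma trPow_sum_conj_mul_le {κ ι : Type*} [Fintype κ] [Nonempty κ] [Fintype ι] {s : ℝ}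
    (h0 : 0 < s) (h1 : s ≤ 1 / 2) (b : κ → ι → Matrix n n ℂ) :
    trPow s (∑ k, (∑ l, b l k)ᴴ * (∑ l, b l k)) ≤ ∑ l, trPow s (∑ k, (b l k)ᴴ * b l k) := by
  have h := trPow_sum_mul_conj_le h0 h1 fun l k => (b l k)ᴴ
  simpa only [← conjTranspose_sum, conjTranspose_conjTranspose] using h

lemma proj_mul_eq_zero {P : Matrix n n ℂ} (hP : Pᴴ = P) (hPP : P * P = P)
    (b : ι → Matrix n n ℂ) (h : P * ∑ k, b k * (b k)ᴴ = 0) (k : ι) : P * b k = 0 := by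
  have e : ∑ k, hs (P * b k) = 0 := by
    have := congrArg rtr h
    rw [rtr_zero, Finset.mul_sum, rtr_sum] at this
    simpa only [hs_mul, hP, hPP] using this
  exact eq_zero_of_hs_nonpos
    ((Finset.sum_eq_zero_iff_of_nonneg fun k _ => hs_nonneg _).1 e k (Finset.mem_univ k)).le

lemma exists_scale_decomposition {s : ℝ} (h0 : 0 < s) (h1 : s ≤ 1 / 2) {η : ℝ} (hη : 0 < η) :
    ∃ C : ℝ, 0 < C ∧ ∀ (n N : ℕ) (χ : (Fin N → Bool) → ℝ), IsHeavy χ → ∀ τ : ℝ, 0 < τ →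
      ∀ x a b : Fin N → Matrix (Fin n) (Fin n) ℂ, (∀ k, x k = a k + b k) →
      ∃ c d : Bool → Fin N → Matrix (Fin n) (Fin n) ℂ,
      (∀ k, cfc (fun t : ℝ => if t ∈ Set.Iic (4 * τ) then (1 : ℝ) else 0)
          (∑ k, b k * (b k)ᴴ) * x k *
        cfc (fun t : ℝ => if t ∈ Set.Iic (4 * τ) then (1 : ℝ) else 0) (∑ k, (a k)ᴴ * a k) -
        cfc (fun t : ℝ => if t ∈ Set.Iic τ then (1 : ℝ) else 0) (∑ k, b k * (b k)ᴴ) * x k *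
        cfc (fun t : ℝ => if t ∈ Set.Iic τ then (1 : ℝ) else 0) (∑ k, (a k)ᴴ * a k) =
        ∑ i, (c i k + d i k)) ∧
      numSigns (Fin N) *
          ∑ i, (trPow s (∑ k, (c i k)ᴴ * c i k) + trPow s (∑ k, d i k * (d i k)ᴴ)) ≤
        η * (numSigns (Fin N) * (τ ^ s * rtr (cfc (fun t : ℝ => t / (t + τ)) (∑ k, (a k)ᴴ * a k)) +
          τ ^ s * rtr (cfc (fun t : ℝ => t / (t + τ)) (∑ k, b k * (b k)ᴴ)))) +
        C * (τ ^ s * ∑ ε, χ ε * rtr (cfc (fun t : ℝ => t / (t + τ)) ((rad x ε)ᴴ * rad x ε))) := by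
  obtain ⟨C, hC, H⟩ := exists_piece_decomposition h0 h1 (half_pos hη)
  refine ⟨2 * C, by positivity, fun n N χ hχ τ hτ x a b hx => ?_⟩
  obtain ⟨c₁, d₁, e₁, g₁⟩ := H n N χ hχ τ (4 * τ) hτ le_rfl x a b hx
  obtain ⟨c₂, d₂, e₂, g₂⟩ := H n N χ hχ τ τ hτ (by linarith) (fun k => (x k)ᴴ)
    (fun k => (b k)ᴴ) (fun k => (a k)ᴴ) (fun k => by rw [hx, conjTranspose_add, add_comm])
  simp only [conjTranspose_conjTranspose, ← rad_conjTranspose] at e₂ g₂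
  simp only [← rtr_cfc_conj] at g₂
  refine ⟨fun i k => if i then c₁ k else (d₂ k)ᴴ, fun i k => if i then d₁ k else (c₂ k)ᴴ,
    fun k => ?_, ?_⟩
  · simp only [Fintype.sum_bool, if_true, Bool.false_eq_true, if_false]
    have e₃ := congrArg conjTranspose (e₂ k)
    rw [conjTranspose_mul, conjTranspose_mul, conjTranspose_conjTranspose, cfc_isSelfAdjoint,
      cfc_isSelfAdjoint, conjTranspose_add, ← mul_assoc, add_comm] at e₃
    have hsplit : ∀ A : Matrix (Fin n) (Fin n) ℂ,
        cfc (fun t : ℝ => if t ∈ Set.Iic (4 * τ) then (1 : ℝ) else 0) A =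
        cfc (fun t : ℝ => if t ∈ Set.Ioc τ (4 * τ) then (1 : ℝ) else 0) A +
        cfc (fun t : ℝ => if t ∈ Set.Iic τ then (1 : ℝ) else 0) A := by
      intro A
      rw [cfc_add_mat]
      congr 1; funext t
      by_cases h1 : t ≤ τ
      · have h2 : t ≤ 4 * τ := by linarith
        simp [h1, h2, not_lt.2 h1]
      · simp [h1, not_le.1 h1]
    rw [← e₁, ← e₃, hsplit (∑ k, b k * (b k)ᴴ), add_mul, add_mul, add_sub_assoc]
    congr 1
    rw [hsplit (∑ k, (a k)ᴴ * a k), mul_add, add_sub_cancel_right]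
  · simp only [Fintype.sum_bool, if_true, Bool.false_eq_true, if_false,
      conjTranspose_conjTranspose]
    linarith

/-- Any decomposition can be halved, up to an error controlled by the signed sums. -/
lemma exists_halved_decomposition {s : ℝ} (h0 : 0 < s) (h1 : s ≤ 1 / 2) :
    ∃ C : ℝ, 0 < C ∧ ∀ (n N : ℕ) (χ : (Fin N → Bool) → ℝ), IsHeavy χ →
      ∀ x a b : Fin N → Matrix (Fin n) (Fin n) ℂ, (∀ k, x k = a k + b k) →
      ∃ c d : Fin N → Matrix (Fin n) (Fin n) ℂ, (∀ k, x k = c k + d k) ∧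
      numSigns (Fin N) * (trPow s (∑ k, (c k)ᴴ * c k) + trPow s (∑ k, d k * (d k)ᴴ)) ≤
        1 / 2 * (numSigns (Fin N) *
          (trPow s (∑ k, (a k)ᴴ * a k) + trPow s (∑ k, b k * (b k)ᴴ))) +
        C * ∑ ε, χ ε * trPow s ((rad x ε)ᴴ * rad x ε) := by
  obtain ⟨C₁, hC₁, H₁⟩ := exists_sum_rtr_scales_le h0 (by linarith)
  obtain ⟨C₂, hC₂, H₂⟩ := exists_scale_decomposition h0 h1 (η := 1 / (2 * C₁)) (by positivity)
  refine ⟨C₂ * C₁, by positivity, fun n N χ hχ x a b hx => ?_⟩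
  set α := ∑ k, b k * (b k)ᴴ with hα
  set γ := ∑ k, (a k)ᴴ * a k with hγ
  have hγ0 : 0 ≤ γ := Finset.sum_nonneg fun k _ => conj_mul_self_nonneg _
  have hα0 : 0 ≤ α := Finset.sum_nonneg fun k _ => self_mul_conj_nonneg _
  obtain ⟨τ, hτ, L, hL, hM⟩ := exists_scale α γ hα0 hγ0
  obtain ⟨hα1, hα2⟩ := hM α (Or.inl rfl)
  obtain ⟨hγ1, hγ2⟩ := hM γ (Or.inr rfl)
  have hτl : ∀ l : ℕ, 0 < τ * 4 ^ l := fun l => by positivity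
  choose c d e g using fun l : Fin L => H₂ n N χ hχ (τ * 4 ^ (l : ℕ)) (hτl l) x a b hx
  have : Nonempty (Fin L × Bool) := ⟨⟨⟨0, hL⟩, true⟩⟩
  refine ⟨fun k => ∑ p : Fin L × Bool, c p.1 p.2 k, fun k => ∑ p : Fin L × Bool, d p.1 p.2 k,
    fun k => ?_, ?_⟩
  · have htel := Finset.sum_range_sub (fun l : ℕ =>
      cfc (fun t : ℝ => if t ∈ Set.Iic (τ * 4 ^ l) then (1 : ℝ) else 0) α * x k *
        cfc (fun t : ℝ => if t ∈ Set.Iic (τ * 4 ^ l) then (1 : ℝ) else 0) γ) L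
    have hz : cfc (fun t : ℝ => if t ∈ Set.Iic (τ * 4 ^ 0) then (1 : ℝ) else 0) α * x k *
        cfc (fun t : ℝ => if t ∈ Set.Iic (τ * 4 ^ 0) then (1 : ℝ) else 0) γ = 0 := by
      rw [pow_zero, mul_one]
      have z1 := proj_mul_eq_zero (cfc_isSelfAdjoint _ _) (cfc_indicator_mul_self _ _) b hα1 k
      have z2 := proj_mul_eq_zero (cfc_isSelfAdjoint _ _) (cfc_indicator_mul_self _ _)
        (fun k => (a k)ᴴ) (by simpa only [conjTranspose_conjTranspose] using hγ1) k
      have z3 := congrArg conjTranspose z2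
      rw [conjTranspose_mul, conjTranspose_conjTranspose, cfc_isSelfAdjoint,
        conjTranspose_zero] at z3
      rw [hx, mul_add, z1, add_zero, mul_assoc, z3, mul_zero]
    rw [hz, hα2, hγ2, one_mul, mul_one, sub_zero] at htel
    rw [← Finset.sum_add_distrib, Fintype.sum_prod_type, ← htel, ← Fin.sum_univ_eq_sum_range
      (fun l => cfc (fun t : ℝ => if t ∈ Set.Iic (τ * 4 ^ (l + 1)) then (1 : ℝ) else 0) α * x k *
        cfc (fun t : ℝ => if t ∈ Set.Iic (τ * 4 ^ (l + 1)) then (1 : ℝ) else 0) γ -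
        cfc (fun t : ℝ => if t ∈ Set.Iic (τ * 4 ^ l) then (1 : ℝ) else 0) α * x k *
        cfc (fun t : ℝ => if t ∈ Set.Iic (τ * 4 ^ l) then (1 : ℝ) else 0) γ)]
    refine Finset.sum_congr rfl fun l _ => ?_
    rw [← e l k]
    have : τ * 4 ^ ((l : ℕ) + 1) = 4 * (τ * 4 ^ (l : ℕ)) := by ring
    rw [this]
  · have hN := numSigns_pos (ι := Fin N)
    have r1 := trPow_sum_conj_mul_le h0 h1 fun (p : Fin L × Bool) k => c p.1 p.2 k
    have r2 := trPow_sum_mul_conj_le h0 h1 fun (p : Fin L × Bool) k => d p.1 p.2 k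
    have r3 := mul_le_mul_of_nonneg_left (add_le_add r1 r2) hN.le
    rw [← Finset.sum_add_distrib, Fintype.sum_prod_type, Finset.mul_sum] at r3
    refine r3.trans ((Finset.sum_le_sum fun l _ => g l).trans ?_)
    rw [Finset.sum_add_distrib, ← Finset.mul_sum, ← Finset.mul_sum, ← Finset.mul_sum,
      Finset.sum_add_distrib]
    have s1 := add_le_add (H₁ n L τ γ hτ hγ0) (H₁ n L τ α hτ hα0)
    have s2 : ∑ l : Fin L, (τ * 4 ^ (l : ℕ)) ^ s * ∑ ε, χ ε *
        rtr (cfc (fun t : ℝ => t / (t + τ * 4 ^ (l : ℕ))) ((rad x ε)ᴴ * rad x ε)) ≤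
        C₁ * ∑ ε, χ ε * trPow s ((rad x ε)ᴴ * rad x ε) := by
      simp only [Finset.mul_sum]
      rw [Finset.sum_comm]
      refine Finset.sum_le_sum fun ε _ => ?_
      have := mul_le_mul_of_nonneg_left (H₁ n L τ _ hτ (conj_mul_self_nonneg (rad x ε)))
        (hχ.nonneg ε)
      rw [Finset.mul_sum] at this
      convert this using 1
      · exact Finset.sum_congr rfl fun _ _ => by ring
      · ring
    have s3 := mul_le_mul_of_nonneg_left s2 hC₂.le
    have s4 := mul_le_mul_of_nonneg_left (mul_le_mul_of_nonneg_left s1 hN.le)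
      (by positivity : 0 ≤ 1 / (2 * C₁))
    refine (add_le_add s4 s3).trans_eq ?_
    field_simp

/-- The lower Khintchine inequality for `s ≤ 1`, on a large set of sign patterns. -/
lemma exists_lower_khintchine_small {s : ℝ} (h0 : 0 < s) (h1 : s ≤ 1) :
    ∃ C : ℝ, 0 < C ∧ ∀ (n N : ℕ) (χ : (Fin N → Bool) → ℝ), IsHeavy χ →
      ∀ (x : Fin N → Matrix (Fin n) (Fin n) ℂ) (θ : ℝ), 0 < θ →
      ∃ a b : Fin N → Matrix (Fin n) (Fin n) ℂ, (∀ k, x k = a k + b k) ∧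
      numSigns (Fin N) * (trPow s (∑ k, (a k)ᴴ * a k) + trPow s (∑ k, b k * (b k)ᴴ)) ≤
        C * ∑ ε, χ ε * trPow s ((rad x ε)ᴴ * rad x ε) + θ := by
  rcases le_or_gt s (1 / 2) with h2 | h2
  · obtain ⟨C, hC, H⟩ := exists_halved_decomposition h0 h2
    refine ⟨2 * C, by positivity, fun n N χ hχ x θ hθ => ?_⟩
    set R := ∑ ε, χ ε * trPow s ((rad x ε)ᴴ * rad x ε)
    set S : Set ℝ := {r | ∃ a b : Fin N → Matrix (Fin n) (Fin n) ℂ, (∀ k, x k = a k + b k) ∧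
      r = numSigns (Fin N) * (trPow s (∑ k, (a k)ᴴ * a k) + trPow s (∑ k, b k * (b k)ᴴ))} with hS
    have hbdd : BddBelow S := ⟨0, by
      rintro r ⟨a, b, -, rfl⟩
      exact mul_nonneg numSigns_pos.le (add_nonneg
        (trPow_nonneg (Finset.sum_nonneg fun k _ => conj_mul_self_nonneg _) _)
        (trPow_nonneg (Finset.sum_nonneg fun k _ => self_mul_conj_nonneg _) _))⟩
    have hne : S.Nonempty := ⟨_, x, 0, fun k => by simp, rfl⟩
    have hinf : sInf S ≤ 2 * C * R := by
      refine le_of_forall_pos_le_add fun θ hθ => ?_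
      obtain ⟨r, ⟨a, b, hab, rfl⟩, hr⟩ := Real.lt_sInf_add_pos hne hθ
      obtain ⟨c, d, hcd, hle⟩ := H n N χ hχ x a b hab
      have := csInf_le hbdd (show _ ∈ S from ⟨c, d, hcd, rfl⟩)
      linarith
    obtain ⟨r, ⟨a, b, hab, rfl⟩, hr⟩ := Real.lt_sInf_add_pos hne hθ
    exact ⟨a, b, hab, by linarith⟩
  rcases h1.lt_or_eq with h1 | rfl
  · obtain ⟨C, hC, H⟩ := exists_lower_khintchine_mid h2 h1
    refine ⟨C, hC, fun n N χ hχ x θ hθ => ?_⟩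
    obtain ⟨a, b, hab, hle⟩ := H n N χ hχ x
    exact ⟨a, b, hab, by linarith⟩
  · refine ⟨2, two_pos, fun n N χ hχ x θ hθ => ⟨x, 0, fun k => by simp, ?_⟩⟩
    have := lower_khintchine_one hχ x
    simp only [Pi.zero_apply, zero_mul, Finset.sum_const_zero, trPow_zero_mat one_ne_zero, add_zero]
    linarith

lemma posPow_eq {A : Matrix n n ℂ} (hA : A.IsHermitian) (β : ℝ) :
    posPow A β = cfc (fun t : ℝ => t ^ β) A := by
  rw [posPow, dif_pos hA, hA.cfc_eq]

lemma schattenNorm_eq (p : ℝ) (A : Matrix n n ℂ) :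
    schattenNorm p A = trPow (p / 2) (Aᴴ * A) ^ (1 / p) := by
  rw [schattenNorm, posPow_eq (isHermitian_conjTranspose_mul_self A)]
  rfl

lemma schattenNorm_nonneg (p : ℝ) (A : Matrix n n ℂ) : 0 ≤ schattenNorm p A := by
  rw [schattenNorm_eq]
  exact Real.rpow_nonneg (trPow_nonneg (conj_mul_self_nonneg A) _) _

lemma schattenNorm_rpow {p : ℝ} (hp : 0 < p) (A : Matrix n n ℂ) :
    schattenNorm p A ^ p = trPow (p / 2) (Aᴴ * A) := by
  rw [schattenNorm_eq, one_div,
    Real.rpow_inv_rpow (trPow_nonneg (conj_mul_self_nonneg A) _) hp.ne']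

lemma schattenNorm_posPow_rpow {p : ℝ} (hp : 0 < p) {Z : Matrix n n ℂ} (hZ : 0 ≤ Z) :
    schattenNorm p (posPow Z (1 / 2)) ^ p = trPow (p / 2) Z := by
  rw [schattenNorm_rpow hp, posPow_eq hZ.posSemidef.1, cfc_isSelfAdjoint, cfc_mul_mat,
    cfc_congr_nonneg hZ (g := fun t => t) fun t ht => ?_, cfc_eq_self (nonneg_isSelfAdjoint hZ)]
  rw [← Real.sqrt_eq_rpow, Real.mul_self_sqrt ht]

lemma tripleNorm_le {N d : ℕ} (p : ℝ) {x a b : Fin N → Matrix (Fin d) (Fin d) ℂ}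
    (h : ∀ k, x k = a k + b k) :
    tripleNorm p x ≤ schattenNorm p (posPow (∑ k, (a k)ᴴ * a k) (1 / 2)) +
      schattenNorm p (posPow (∑ k, b k * (b k)ᴴ) (1 / 2)) := by
  refine csInf_le ⟨0, ?_⟩ ⟨a, b, h, rfl⟩
  rintro r ⟨a, b, -, rfl⟩
  exact add_nonneg (schattenNorm_nonneg _ _) (schattenNorm_nonneg _ _)

lemma le_tripleNorm {N d : ℕ} (p : ℝ) (x : Fin N → Matrix (Fin d) (Fin d) ℂ) {c : ℝ}
    (h : ∀ a b : Fin N → Matrix (Fin d) (Fin d) ℂ, (∀ k, x k = a k + b k) →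
      c ≤ schattenNorm p (posPow (∑ k, (a k)ᴴ * a k) (1 / 2)) +
        schattenNorm p (posPow (∑ k, b k * (b k)ᴴ) (1 / 2))) : c ≤ tripleNorm p x := by
  refine le_csInf ⟨_, x, 0, fun k => by simp, rfl⟩ ?_
  rintro r ⟨a, b, hab, rfl⟩
  exact h a b hab

lemma tripleNormFull_nonneg {N d : ℕ} (p : ℝ) (x : Fin N → Matrix (Fin d) (Fin d) ℂ) :
    0 ≤ tripleNormFull p x := by
  rw [tripleNormFull]
  split_ifs
  · exact le_tripleNorm p x fun a b _ =>
      add_nonneg (schattenNorm_nonneg _ _) (schattenNorm_nonneg _ _)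
  · exact le_max_of_le_left (schattenNorm_nonneg _ _)

lemma exists_sum_trPow_rad_le {p : ℝ} (hp : 0 < p) : ∃ C : ℝ, 0 < C ∧
    ∀ (d N : ℕ) (x : Fin N → Matrix (Fin d) (Fin d) ℂ),
      ∑ ε, trPow (p / 2) ((rad x ε)ᴴ * rad x ε) ≤
        C * numSigns (Fin N) * tripleNormFull p x ^ p := by
  rcases le_or_gt p 2 with h | h
  · refine ⟨4 ^ (p / 2) * 2, by positivity, fun d N x => ?_⟩
    have hN := numSigns_pos (ι := Fin N)
    rw [tripleNormFull, if_pos h]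
    set S := ∑ ε, trPow (p / 2) ((rad x ε)ᴴ * rad x ε) with hSdef
    have hS : 0 ≤ S := Finset.sum_nonneg fun ε _ => trPow_nonneg (conj_mul_self_nonneg _) _
    have hc : (0 : ℝ) < 4 ^ (p / 2) * 2 * numSigns (Fin N) := by positivity
    have key : (S / (4 ^ (p / 2) * 2 * numSigns (Fin N))) ^ (1 / p) ≤ tripleNorm p x := by
      refine le_tripleNorm p x fun a b hab => ?_
      have h1 := upper_khintchine_small (half_pos hp) (by linarith) x a b hab
      rw [← hSdef, ← schattenNorm_posPow_rpow hp (Finset.sum_nonneg fun k _ => conj_mul_self_nonneg _),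
        ← schattenNorm_posPow_rpow hp (Finset.sum_nonneg fun k _ => self_mul_conj_nonneg _)] at h1
      set A := schattenNorm p (posPow (∑ k, (a k)ᴴ * a k) (1 / 2))
      set B := schattenNorm p (posPow (∑ k, b k * (b k)ᴴ) (1 / 2))
      have hA : 0 ≤ A := schattenNorm_nonneg _ _
      have hB : 0 ≤ B := schattenNorm_nonneg _ _
      clear_value A B S
      rw [one_div, Real.rpow_inv_le_iff_of_pos (by positivity) (by positivity) hp, div_le_iff₀ hc]
      have h2 : A ^ p ≤ (A + B) ^ p := Real.rpow_le_rpow hA (by linarith) hp.le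
      have h3 : B ^ p ≤ (A + B) ^ p := Real.rpow_le_rpow hB (by linarith) hp.le
      refine h1.trans ((mul_le_mul_of_nonneg_left (add_le_add h2 h3) (by positivity)).trans_eq ?_)
      ring
    have hT : 0 ≤ tripleNorm p x := le_trans (by positivity) key
    rw [one_div, Real.rpow_inv_le_iff_of_pos (by positivity) hT hp, div_le_iff₀ hc] at key
    linarith
  · obtain ⟨C, hC, H⟩ := exists_upper_khintchine_large (s := p / 2) (by linarith)
    refine ⟨C * 2, by positivity, fun d N x => ?_⟩
    have hN := numSigns_pos (ι := Fin N)
    rw [tripleNormFull, if_neg (not_le.2 h)]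
    have h1 := H d N x
    rw [← schattenNorm_posPow_rpow hp (Finset.sum_nonneg fun k _ => conj_mul_self_nonneg _),
      ← schattenNorm_posPow_rpow hp (Finset.sum_nonneg fun k _ => self_mul_conj_nonneg _)] at h1
    have h2 := Real.rpow_le_rpow (schattenNorm_nonneg p _) (le_max_left
      (schattenNorm p (posPow (∑ k, (x k)ᴴ * x k) (1 / 2)))
      (schattenNorm p (posPow (∑ k, x k * (x k)ᴴ) (1 / 2)))) hp.le
    have h3 := Real.rpow_le_rpow (schattenNorm_nonneg p _) (le_max_right
      (schattenNorm p (posPow (∑ k, (x k)ᴴ * x k) (1 / 2)))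
      (schattenNorm p (posPow (∑ k, x k * (x k)ᴴ) (1 / 2)))) hp.le
    refine h1.trans ((mul_le_mul_of_nonneg_left (add_le_add h2 h3) (by positivity)).trans_eq ?_)
    ring

lemma add_rpow_le_two_rpow_mul {p : ℝ} (hp : 0 < p) {A B : ℝ} (hA : 0 ≤ A) (hB : 0 ≤ B) :
    (A + B) ^ p ≤ 2 ^ p * (A ^ p + B ^ p) := by
  have hA' : 0 ≤ A ^ p := by positivity
  have hB' : 0 ≤ B ^ p := by positivity
  have h2 : (0 : ℝ) ≤ 2 ^ p := by positivity
  rcases le_total A B with h | h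
  · have := Real.rpow_le_rpow (by positivity) (by linarith : A + B ≤ 2 * B) hp.le
    rw [Real.mul_rpow two_pos.le hB] at this
    nlinarith
  · have := Real.rpow_le_rpow (by positivity) (by linarith : A + B ≤ 2 * A) hp.le
    rw [Real.mul_rpow two_pos.le hA] at this
    nlinarith

lemma exists_tripleNormFull_rpow_le {p : ℝ} (hp : 0 < p) : ∃ C : ℝ, 0 < C ∧
    ∀ (d N : ℕ) (χ : (Fin N → Bool) → ℝ), IsHeavy χ →
      ∀ x : Fin N → Matrix (Fin d) (Fin d) ℂ,
      numSigns (Fin N) * tripleNormFull p x ^ p ≤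
        C * ∑ ε, χ ε * trPow (p / 2) ((rad x ε)ᴴ * rad x ε) := by
  rcases le_or_gt p 2 with h | h
  · obtain ⟨C, hC, H⟩ := exists_lower_khintchine_small (half_pos hp) (by linarith)
    refine ⟨2 ^ p * C, by positivity, fun d N χ hχ x => ?_⟩
    have hN := numSigns_pos (ι := Fin N)
    have hT := tripleNormFull_nonneg p x
    rw [tripleNormFull, if_pos h] at hT ⊢
    refine le_of_forall_pos_le_add fun θ hθ => ?_
    obtain ⟨a, b, hab, h1⟩ := H d N χ hχ x (θ / 2 ^ p) (by positivity)
    rw [← schattenNorm_posPow_rpow hp (Finset.sum_nonneg fun k _ => conj_mul_self_nonneg _),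
      ← schattenNorm_posPow_rpow hp (Finset.sum_nonneg fun k _ => self_mul_conj_nonneg _)] at h1
    have h2 := (Real.rpow_le_rpow hT (tripleNorm_le p hab) hp.le).trans
      (add_rpow_le_two_rpow_mul hp (schattenNorm_nonneg _ _) (schattenNorm_nonneg _ _))
    have h3 := mul_le_mul_of_nonneg_left h1 (by positivity : (0 : ℝ) ≤ 2 ^ p)
    rw [mul_add _ (C * _), mul_div_cancel₀ _ (by positivity)] at h3
    have h4 := mul_le_mul_of_nonneg_left h2 hN.le
    linarith
  · obtain ⟨C, hC, H⟩ := exists_lower_khintchine_large (s := p / 2) (by linarith)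
    refine ⟨C, hC, fun d N χ hχ x => ?_⟩
    have h1 := H d N χ hχ x
    rw [← schattenNorm_posPow_rpow hp (Finset.sum_nonneg fun k _ => conj_mul_self_nonneg _),
      ← schattenNorm_posPow_rpow hp (Finset.sum_nonneg fun k _ => self_mul_conj_nonneg _)] at h1
    rw [tripleNormFull, if_neg (not_le.2 h)]
    refine (mul_le_mul_of_nonneg_left ?_ (numSigns_pos (ι := Fin N)).le).trans h1
    have hA := Real.rpow_nonneg
      (schattenNorm_nonneg p (posPow (∑ k, (x k)ᴴ * x k) (1 / 2))) p
    have hB := Real.rpow_nonneg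
      (schattenNorm_nonneg p (posPow (∑ k, x k * (x k)ᴴ) (1 / 2))) p
    rcases max_choice (schattenNorm p (posPow (∑ k, (x k)ᴴ * x k) (1 / 2)))
      (schattenNorm p (posPow (∑ k, x k * (x k)ᴴ) (1 / 2))) with e | e <;> rw [e] <;> linarith

lemma isHeavy_indicator_le {f : (ι → Bool) → ℝ} (hf : ∀ ε, 0 ≤ f ε) {B : ℝ} (hB : 0 ≤ B)
    (h : 12 * ∑ ε, f ε ≤ numSigns ι * B) : IsHeavy fun ε => if f ε ≤ B then (1 : ℝ) else 0 := by
  refine ⟨fun ε => by split_ifs <;> norm_num, fun ε => by split_ifs <;> norm_num, ?_⟩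
  have hN := numSigns_pos (ι := ι)
  rcases hB.eq_or_lt with rfl | hB
  · have h0 : ∑ ε, f ε = 0 := le_antisymm (by linarith) (Finset.sum_nonneg fun ε _ => hf ε)
    rw [Finset.sum_eq_zero_iff_of_nonneg fun ε _ => hf ε] at h0
    rw [Finset.sum_eq_zero fun ε hε => by rw [h0 ε hε]; simp]
    positivity
  · have h1 : ∀ ε, (1 - if f ε ≤ B then (1 : ℝ) else 0) ≤ f ε / B := fun ε => by
      split_ifs with h
      · rw [sub_self]; exact div_nonneg (hf ε) hB.le
      · rw [sub_zero, one_le_div hB]; exact (not_le.1 h).le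
    refine (Finset.sum_le_sum fun ε _ => h1 ε).trans ?_
    rw [← Finset.sum_div, div_le_div_iff₀ hB (by norm_num)]
    linarith

lemma map_rad {d m N : ℕ} (u : Matrix (Fin d) (Fin d) ℂ →ₗ[ℂ] Matrix (Fin m) (Fin m) ℂ)
    (x : Fin N → Matrix (Fin d) (Fin d) ℂ) (ε : Fin N → Bool) :
    u (rad x ε) = rad (fun k => u (x k)) ε := by
  simp only [rad, map_sum, LinearMap.map_smul_of_tower]

end SchattenKhintchine

open SchattenKhintchine in
/-- Bounded operators between Schatten classes are bounded for the norms `|||·|||`. -/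
theorem statement5 (p₁ p₂ : ℝ) (hp₁ : 0 < p₁) (hp₂ : 0 < p₂) :
    ∃ C : ℝ, 0 < C ∧ ∀ (n m : ℕ)
      (u : Matrix (Fin n) (Fin n) ℂ →ₗ[ℂ] Matrix (Fin m) (Fin m) ℂ) (K : ℝ), 0 ≤ K →
      (∀ y : Matrix (Fin n) (Fin n) ℂ, schattenNorm p₂ (u y) ≤ K * schattenNorm p₁ y) →
      ∀ (N : ℕ) (x : Fin N → Matrix (Fin n) (Fin n) ℂ),
        tripleNormFull p₂ (fun k => u (x k)) ≤ C * K * tripleNormFull p₁ x := by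
  obtain ⟨C₁, hC₁, H₁⟩ := exists_sum_trPow_rad_le hp₁
  obtain ⟨C₂, hC₂, H₂⟩ := exists_tripleNormFull_rpow_le hp₂
  refine ⟨C₂ ^ (1 / p₂) * (12 * C₁) ^ (1 / p₁), by positivity, fun n m u K hK hu N x => ?_⟩
  set T := tripleNormFull p₁ x
  have hT : 0 ≤ T := tripleNormFull_nonneg p₁ x
  have hN := numSigns_pos (ι := Fin N)
  have hχ := isHeavy_indicator_le (f := fun ε => trPow (p₁ / 2) ((rad x ε)ᴴ * rad x ε))
    (fun ε => trPow_nonneg (conj_mul_self_nonneg _) _) (B := 12 * C₁ * T ^ p₁) (by positivity)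
    (by linarith [H₁ n N x])
  set D := K * ((12 * C₁) ^ (1 / p₁) * T) with hD
  have hD0 : 0 ≤ D := by positivity
  have hle := H₂ m N _ hχ fun k => u (x k)
  have hsum : ∑ ε, (if trPow (p₁ / 2) ((rad x ε)ᴴ * rad x ε) ≤ 12 * C₁ * T ^ p₁ then (1 : ℝ)
      else 0) * trPow (p₂ / 2) ((rad (fun k => u (x k)) ε)ᴴ * rad (fun k => u (x k)) ε) ≤
      numSigns (Fin N) * D ^ p₂ := by
    have hterm : ∀ ε ∈ Finset.univ, (if trPow (p₁ / 2) ((rad x ε)ᴴ * rad x ε) ≤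
        12 * C₁ * T ^ p₁ then (1 : ℝ) else 0) *
        trPow (p₂ / 2) ((rad (fun k => u (x k)) ε)ᴴ * rad (fun k => u (x k)) ε) ≤ D ^ p₂ := by
      intro ε _
      split_ifs with h
      · rw [one_mul, ← schattenNorm_rpow hp₂, ← map_rad]
        refine Real.rpow_le_rpow (schattenNorm_nonneg _ _) ((hu _).trans ?_) hp₂.le
        refine mul_le_mul_of_nonneg_left ?_ hK
        rw [schattenNorm_eq]
        refine (Real.rpow_le_rpow (trPow_nonneg (conj_mul_self_nonneg _) _) h
          (by positivity)).trans_eq ?_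
        rw [Real.mul_rpow (by positivity) (by positivity), one_div, Real.rpow_rpow_inv hT hp₁.ne']
      · rw [zero_mul]; positivity
    refine (Finset.sum_le_sum hterm).trans_eq ?_
    rw [Finset.sum_const, Finset.card_univ, nsmul_eq_mul, numSigns]
  have hfin : tripleNormFull p₂ (fun k => u (x k)) ^ p₂ ≤ C₂ * D ^ p₂ := by
    have := hle.trans (mul_le_mul_of_nonneg_left hsum hC₂.le)
    rw [mul_left_comm] at this
    exact le_of_mul_le_mul_left this hN
  have := Real.rpow_le_rpow (Real.rpow_nonneg (tripleNormFull_nonneg _ _) _) hfin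
    (by positivity : 0 ≤ 1 / p₂)
  rw [Real.mul_rpow hC₂.le (by positivity), one_div,
    Real.rpow_rpow_inv (tripleNormFull_nonneg _ _) hp₂.ne', Real.rpow_rpow_inv hD0 hp₂.ne'] at this
  rw [one_div]
  refine this.trans_eq ?_
  rw [hD]; ring
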